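/- Let S be an entire maximal surface in three-dimensional Anti-de Sitter space with principal curvatures satisfying ‖λ‖∞ ≤ 1 (equivalently ‖λ‖∞ < 1 so that the bound is finite), and let w be the width of the convex hull of its asymptotic boundary. Then tan(w) ≤ 2‖λ‖∞ / (1 − ‖λ‖∞²). -/

import Mathlib

/-!
Common framework for formalizing "Maximal surfaces in Anti-de Sitter space, width of
convex hulls and quasiconformal extensions of quasisymmetric homeomorphisms" (A. Seppi).

Anti-de Sitter space is modeled projectively: `qform` is the bilinear form of
signature (2,2) on ℝ⁴, `AdS3` is the projectivization of its negative cone,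
and spacelike surfaces are recorded through (lifts of) smooth spacelike embeddings
of ℝ² into the quadric {⟨x,x⟩ = -1} (the double cover of AdS³), together with a
future-directed unit normal field and the associated shape operator.
-/

noncomputable section

open Real Set Filter Topology

namespace AdSPaper

/-- The bilinear form of signature `(2,2)` on `ℝ⁴`. -/
def qform (x y : Fin 4 → ℝ) : ℝ :=
  x 0 * y 0 + x 1 * y 1 - x 2 * y 2 - x 3 * y 3

/-- Quotient topology on a projectivization. -/
instance (K V : Type*) [DivisionRing K] [AddCommGroup V] [Module K V] [TopologicalSpace V] :
    TopologicalSpace (Projectivization K V) := by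
  unfold Projectivization
  infer_instance

/-- Real projective 3-space. -/
abbrev RP3 := Projectivization ℝ (Fin 4 → ℝ)

/-- The real projective line. -/
abbrev RP1 := Projectivization ℝ (Fin 2 → ℝ)

/-- The point of `ℝP³` determined by a nonzero vector of `ℝ⁴`. -/
def projPt (x : Fin 4 → ℝ) (hx : x ≠ 0) : RP3 := Projectivization.mk ℝ x hx

/-- Anti-de Sitter space: the projectivization of the negative cone of `qform`.
(The sign of `qform x x` does not depend on the chosen representative.) -/
def AdS3 : Set RP3 := {P | qform P.rep P.rep < 0}

/-- The boundary at infinity of Anti-de Sitter space: the projectivization of the null cone. -/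
def bdryAdS3 : Set RP3 := {P | qform P.rep P.rep = 0}

/-- The nonzero lifts of a subset of `ℝP³`. -/
def lifts (Γ : Set RP3) : Set (Fin 4 → ℝ) :=
  {x | ∃ hx : x ≠ 0, projPt x hx ∈ Γ}

/-- The (projective) convex hull of a set `Γ ⊆ ℝP³` contained in an affine chart:
the image of the convex hull of a coherent family of lifts of `Γ`, chosen on the positive
side of a linear hyperplane avoiding all lifts of `Γ` (i.e. an affine chart containing `Γ`). -/
def projConvexHull (Γ : Set RP3) : Set RP3 :=
  {P | ∃ L : (Fin 4 → ℝ) →ₗ[ℝ] ℝ, (∀ x ∈ lifts Γ, L x ≠ 0) ∧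
      ∃ (y : Fin 4 → ℝ) (hy : y ≠ 0), projPt y hy = P ∧
        y ∈ convexHull ℝ {x | x ∈ lifts Γ ∧ 0 < L x}}

/-- The width of (the convex hull of) a set `Γ ⊆ ℝP³`: the supremum of the lengths of
timelike geodesic segments `t ↦ [cos t • a + sin t • b]` contained in the convex hull of `Γ`. -/
def width (Γ : Set RP3) : ℝ :=
  sSup {T : ℝ | 0 ≤ T ∧ T < π ∧ ∃ a b : Fin 4 → ℝ,
      qform a a = -1 ∧ qform b b = -1 ∧ qform a b = 0 ∧
      ∀ t ∈ Icc (0 : ℝ) T, ∃ h : (Real.cos t • a + Real.sin t • b) ≠ 0,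
        projPt (Real.cos t • a + Real.sin t • b) h ∈ projConvexHull Γ}

/-- Inverse hyperbolic cosine. -/
def arcosh (x : ℝ) : ℝ := Real.log (x + Real.sqrt (x ^ 2 - 1))

/-! ### The projective line, cross-ratios and quasisymmetric homeomorphisms -/

/-- Determinant of a pair of vectors of ℝ². -/
def det2 (v w : Fin 2 → ℝ) : ℝ := v 0 * w 1 - v 1 * w 0

/-- The cross-ratio of a quadruple of points of `ℝP¹`, with the convention
`cr(z₁,z₂,z₃,z₄) = (z₄−z₁)(z₃−z₂)/((z₂−z₁)(z₃−z₄))`.  (The expression below is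
invariant under rescaling of each of the four representatives.) -/
def crossRatio (z₁ z₂ z₃ z₄ : RP1) : ℝ :=
  (det2 z₄.rep z₁.rep * det2 z₃.rep z₂.rep) / (det2 z₂.rep z₁.rep * det2 z₃.rep z₄.rep)

/-- The cyclic orientation invariant of a triple of points of `ℝP¹`
(for finite points `a,b,c` it equals `(a−b)(b−c)(c−a)` and its sign is scale invariant). -/
def tripleOrient (a b c : RP1) : ℝ :=
  det2 a.rep b.rep * det2 b.rep c.rep * det2 c.rep a.rep

/-- A map of `ℝP¹` is orientation-preserving if it preserves the cyclic orientation
of triples of points. -/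
def OrientationPreserving (φ : RP1 → RP1) : Prop :=
  ∀ a b c : RP1, 0 < tripleOrient a b c → 0 < tripleOrient (φ a) (φ b) (φ c)

/-- The set of cross-ratio distortions `|ln |cr(φ(Q))||` of symmetric quadruples
(`cr(Q) = -1`) under the map `φ`. -/
def crSet (φ : RP1 → RP1) : Set ℝ :=
  {r | ∃ z₁ z₂ z₃ z₄ : RP1, crossRatio z₁ z₂ z₃ z₄ = -1 ∧
      r = |Real.log (abs (crossRatio (φ z₁) (φ z₂) (φ z₃) (φ z₄)))|}

/-- The cross-ratio norm `‖φ‖_cr` of a circle map `φ`. -/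
def crNorm (φ : RP1 → RP1) : ℝ := sSup (crSet φ)

/-- A quasisymmetric homeomorphism of `ℝP¹`: an orientation-preserving homeomorphism
with finite cross-ratio norm. -/
def Quasisymmetric (φ : RP1 ≃ₜ RP1) : Prop :=
  OrientationPreserving ⇑φ ∧ BddAbove (crSet ⇑φ)

/-- The null vector of ℝ^{2,2} corresponding to the pair of lines `([v],[w]) ∈ ℝP¹ × ℝP¹`
under the standard identification of `∂∞AdS³` with `ℝP¹ × ℝP¹` (via the rank-one
2×2 matrix `v wᵀ`, identifying ℝ^{2,2} with 2×2 matrices with minus the determinant). -/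
def toBoundary (v w : Fin 2 → ℝ) : Fin 4 → ℝ :=
  ![(v 0 * w 0 - v 1 * w 1) / 2, (v 0 * w 1 + v 1 * w 0) / 2,
    (v 0 * w 0 + v 1 * w 1) / 2, (v 0 * w 1 - v 1 * w 0) / 2]

/-- The graph `gr(φ)` of a map `φ : ℝP¹ → ℝP¹`, as a curve in `∂∞AdS³ ⊆ ℝP³`. -/
def grGraph (φ : RP1 → RP1) : Set RP3 :=
  {P | ∃ (v w : Fin 2 → ℝ) (hv : v ≠ 0) (hw : w ≠ 0) (hx : toBoundary v w ≠ 0),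
      projPt (toBoundary v w) hx = P ∧
      φ (Projectivization.mk ℝ v hv) = Projectivization.mk ℝ w hw}

/-! ### Spacelike and maximal surfaces in AdS³ -/

/-- The global timelike vector field `x ↦ (0,0,−x₄,x₃)` on the quadric, fixing the
time orientation of AdS³. -/
def timeVec (x : Fin 4 → ℝ) : Fin 4 → ℝ := ![0, 0, -(x 3), x 2]

/-- A (lifted, parametrized) smooth spacelike embedded disc in AdS³: a smooth embedding
of ℝ² into the quadric `{⟨x,x⟩ = −1} ⊆ ℝ^{2,2}` (the double cover of AdS³), with spacelike
first fundamental form, together with its future-directed unit normal field and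
the associated shape operator `B = ∇N`. -/
structure SpacelikeSurface where
  /-- the embedding of ℝ² into the quadric -/
  emb : (Fin 2 → ℝ) → (Fin 4 → ℝ)
  /-- the future-directed unit normal vector field -/
  normal : (Fin 2 → ℝ) → (Fin 4 → ℝ)
  /-- the shape operator, in the coordinates of the parametrization -/
  shape : (Fin 2 → ℝ) → ((Fin 2 → ℝ) →ₗ[ℝ] (Fin 2 → ℝ))
  smooth_emb : ContDiff ℝ (⊤ : ℕ∞) emb
  smooth_normal : ContDiff ℝ (⊤ : ℕ∞) normal
  inj : Function.Injective emb
  on_quadric : ∀ y, qform (emb y) (emb y) = -1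
  spacelike : ∀ y v, v ≠ 0 → 0 < qform (fderiv ℝ emb y v) (fderiv ℝ emb y v)
  normal_unit : ∀ y, qform (normal y) (normal y) = -1
  normal_orth_base : ∀ y, qform (normal y) (emb y) = 0
  normal_orth : ∀ y v, qform (normal y) (fderiv ℝ emb y v) = 0
  normal_future : ∀ y, qform (normal y) (timeVec (emb y)) < 0
  shape_spec : ∀ y v, fderiv ℝ normal y v = fderiv ℝ emb y (shape y v)

namespace SpacelikeSurface

variable (S : SpacelikeSurface)

/-- A spacelike surface is maximal if its shape operator is traceless. -/
def IsMaximal : Prop := ∀ y, LinearMap.trace ℝ (Fin 2 → ℝ) (S.shape y) = 0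

/-- The surface as a subset of `ℝP³` (i.e. of AdS³). -/
def proj : Set RP3 :=
  {P | ∃ (y : Fin 2 → ℝ) (h : S.emb y ≠ 0), projPt (S.emb y) h = P}

/-- The asymptotic boundary `∂∞S` of the surface: the frontier `closure S \ S`. -/
def bdryAtInfinity : Set RP3 := closure S.proj \ S.proj

/-- The surface is entire if its frontier is contained in the boundary at
infinity of AdS³. -/
def IsEntire : Prop := S.bdryAtInfinity ⊆ bdryAdS3

/-- The nonnegative principal curvature `λ` at a point: for a maximal surface the
principal curvatures are `±λ` with `λ = √(−det B)`. -/
def lambdaAt (y : Fin 2 → ℝ) : ℝ := Real.sqrt (-(LinearMap.det (S.shape y)))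

/-- The supremum `‖λ‖∞` of the principal curvatures of the surface. -/
def lambdaSup : ℝ := ⨆ y, S.lambdaAt y

/-- Nonpositive curvature: by the Gauss equation `K = −1 + λ²`, this is `λ ≤ 1`. -/
def NonpositiveCurvature : Prop := ∀ y, S.lambdaAt y ≤ 1

/-- Uniformly negative curvature: `λ ≤ 1 − ε` for some `ε > 0`. -/
def UniformlyNegativeCurvature : Prop := ∃ ε > 0, ∀ y, S.lambdaAt y ≤ 1 - ε

/-- The set of non-umbilical points of a maximal surface (where `λ ≠ 0`). -/
def nonUmbilic : Set (Fin 2 → ℝ) := {y | LinearMap.det (S.shape y) ≠ 0}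

/-- The intrinsic distance of the induced Riemannian metric on the surface. -/
def idist (y₁ y₂ : Fin 2 → ℝ) : ℝ :=
  sInf {L | ∃ c : ℝ → (Fin 2 → ℝ), ContDiff ℝ (⊤ : ℕ∞) c ∧ c 0 = y₁ ∧ c 1 = y₂ ∧
      L = ∫ t in (0:ℝ)..(1:ℝ),
        Real.sqrt (qform (deriv (fun s => S.emb (c s)) t) (deriv (fun s => S.emb (c s)) t))}

/-- `F` is the intrinsic gradient field of the function `f` on `U ⊆ S`: the vector field
which is `I`-dual to the differential of `f`. -/
def IsGradientOn (U : Set (Fin 2 → ℝ)) (f : (Fin 2 → ℝ) → ℝ)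
    (F : (Fin 2 → ℝ) → (Fin 2 → ℝ)) : Prop :=
  ∀ y ∈ U, ∀ v, qform (fderiv ℝ S.emb y (F y)) (fderiv ℝ S.emb y v) = fderiv ℝ f y v

/-- `H` is the intrinsic Hessian (as a (1,1)-tensor) of a function with gradient field `F`
on `U ⊆ S`: the tangential part of the ambient flat derivative of the ambient gradient
field (the normal part, in the ambient coordinates, lies in `span{σ(y), N(y)}`). -/
def IsHessianOn (U : Set (Fin 2 → ℝ)) (F : (Fin 2 → ℝ) → (Fin 2 → ℝ))
    (H : (Fin 2 → ℝ) → ((Fin 2 → ℝ) →ₗ[ℝ] (Fin 2 → ℝ))) : Prop :=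
  ∀ y ∈ U, ∀ v, ∃ a b : ℝ,
    fderiv ℝ (fun y' => fderiv ℝ S.emb y' (F y')) y v
      = fderiv ℝ S.emb y (H y v) + a • S.emb y + b • S.normal y

/-- The squared norm `‖grad f‖²` of a gradient field `F`, for the induced metric. -/
def gradNormSq (F : (Fin 2 → ℝ) → (Fin 2 → ℝ)) (y : Fin 2 → ℝ) : ℝ :=
  qform (fderiv ℝ S.emb y (F y)) (fderiv ℝ S.emb y (F y))

/-- `Δf` is the Laplace–Beltrami operator of the induced metric applied to `f`, on `U`:
the trace of the intrinsic Hessian. -/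
def IsLaplacianOn (U : Set (Fin 2 → ℝ)) (f Δf : (Fin 2 → ℝ) → ℝ) : Prop :=
  ∃ F H, S.IsGradientOn U f F ∧ S.IsHessianOn U F H ∧
    ∀ y ∈ U, Δf y = LinearMap.trace ℝ (Fin 2 → ℝ) (H y)

/-- `c` parametrizes an intrinsic geodesic of the surface: the ambient acceleration
is orthogonal to the surface, i.e. lies in `span{σ(c t), N(c t)}`. -/
def IsIntrinsicGeodesic (c : ℝ → (Fin 2 → ℝ)) : Prop :=
  ∀ t, ∃ a b : ℝ,
    deriv (deriv (fun s => S.emb (c s))) t = a • S.emb (c t) + b • S.normal (c t)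

/-- `E` is a system of normal coordinates for the surface centered at `y₀` (i.e. the
exponential map of the induced metric at that point, read in an orthonormal frame). -/
def IsNormalCoordsAt (y₀ : Fin 2 → ℝ) (E : (Fin 2 → ℝ) → (Fin 2 → ℝ)) : Prop :=
  E 0 = y₀ ∧ (∀ v, S.IsIntrinsicGeodesic (fun t => E (t • v))) ∧
  ∀ v w : Fin 2 → ℝ,
    qform (deriv (fun t : ℝ => S.emb (E (t • v))) 0) (deriv (fun t : ℝ => S.emb (E (t • w))) 0)
      = v 0 * w 0 + v 1 * w 1

end SpacelikeSurface

/-- The normal flow at time `ρ`: the parametrization of the surface `S_ρ` at constant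
timelike distance `ρ` from `S`. -/
def parallelEmb (S : SpacelikeSurface) (ρ : ℝ) : (Fin 2 → ℝ) → (Fin 4 → ℝ) :=
  fun y => Real.cos ρ • S.emb y + Real.sin ρ • S.normal y

/-- The pull-back to `S` of the first fundamental form of the parallel surface `S_ρ`. -/
def Irho (S : SpacelikeSurface) (ρ : ℝ) (y : Fin 2 → ℝ) (v w : Fin 2 → ℝ) : ℝ :=
  qform (fderiv ℝ (parallelEmb S ρ) y v) (fderiv ℝ (parallelEmb S ρ) y w)

/-- The second fundamental form of the parallel surface `S_ρ`, via `II_ρ = ½ dI_ρ/dρ`. -/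
def IIrho (S : SpacelikeSurface) (ρ : ℝ) (y : Fin 2 → ℝ) (v w : Fin 2 → ℝ) : ℝ :=
  (1 / 2) * deriv (fun ρ' => Irho S ρ' y v w) ρ

/-! ### Euclidean balls and `C⁰`/`C²` norms on ℝ² -/

/-- The Euclidean ball of radius `r` centered at the origin of ℝ². -/
def eball (r : ℝ) : Set (Fin 2 → ℝ) := {z | Real.sqrt ((z 0) ^ 2 + (z 1) ^ 2) < r}

/-- The `C⁰` norm of a function on the Euclidean ball of radius `r`. -/
def C0norm (u : (Fin 2 → ℝ) → ℝ) (r : ℝ) : ℝ :=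
  sSup {a | ∃ z ∈ eball r, a = |u z|}

/-- The `C²` norm of a function on the Euclidean ball of radius `r`. -/
def C2norm (u : (Fin 2 → ℝ) → ℝ) (r : ℝ) : ℝ :=
  sSup {a | ∃ z ∈ eball r, a = |u z| + ‖fderiv ℝ u z‖ + ‖fderiv ℝ (fderiv ℝ u) z‖}

end AdSPaper

namespace AdSPaper

/-! ### Algebra of the bilinear form -/

theorem qform_comm (x y : Fin 4 → ℝ) : qform x y = qform y x := by
  unfold qform; ring

@[simp] theorem qform_add_left (x y z : Fin 4 → ℝ) :
    qform (x + y) z = qform x z + qform y z := by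
  simp only [qform, Pi.add_apply]; ring

@[simp] theorem qform_add_right (x y z : Fin 4 → ℝ) :
    qform x (y + z) = qform x y + qform x z := by
  simp only [qform, Pi.add_apply]; ring

@[simp] theorem qform_sub_left (x y z : Fin 4 → ℝ) :
    qform (x - y) z = qform x z - qform y z := by
  simp only [qform, Pi.sub_apply]; ring

@[simp] theorem qform_sub_right (x y z : Fin 4 → ℝ) :
    qform x (y - z) = qform x y - qform x z := by
  simp only [qform, Pi.sub_apply]; ring

@[simp] theorem qform_smul_left (c : ℝ) (x y : Fin 4 → ℝ) :
    qform (c • x) y = c * qform x y := by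
  simp only [qform, Pi.smul_apply, smul_eq_mul]; ring

@[simp] theorem qform_smul_right (c : ℝ) (x y : Fin 4 → ℝ) :
    qform x (c • y) = c * qform x y := by
  simp only [qform, Pi.smul_apply, smul_eq_mul]; ring

@[simp] theorem qform_neg_left (x y : Fin 4 → ℝ) : qform (-x) y = -qform x y := by
  simp only [qform, Pi.neg_apply]; ring

@[simp] theorem qform_neg_right (x y : Fin 4 → ℝ) : qform x (-y) = -qform x y := by
  simp only [qform, Pi.neg_apply]; ring

@[simp] theorem qform_zero_left (y : Fin 4 → ℝ) : qform 0 y = 0 := by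
  simp [qform]

@[simp] theorem qform_zero_right (y : Fin 4 → ℝ) : qform y 0 = 0 := by
  simp [qform]

/-- `qform x` as a linear form. -/
def qlin (x : Fin 4 → ℝ) : (Fin 4 → ℝ) →ₗ[ℝ] ℝ where
  toFun := qform x
  map_add' := qform_add_right x
  map_smul' := by simp

@[simp] theorem qlin_apply (x y : Fin 4 → ℝ) : qlin x y = qform x y := rfl

theorem continuous_qform_pair : Continuous fun p : (Fin 4 → ℝ) × (Fin 4 → ℝ) => qform p.1 p.2 := by
  unfold qform; fun_prop

theorem continuous_qform {X : Type*} [TopologicalSpace X] {f g : X → Fin 4 → ℝ}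
    (hf : Continuous f) (hg : Continuous g) : Continuous fun x => qform (f x) (g x) :=
  continuous_qform_pair.comp (hf.prodMk hg)

theorem tendsto_qform {X : Type*} {l : Filter X} {f g : X → Fin 4 → ℝ} {a b : Fin 4 → ℝ}
    (hf : Tendsto f l (𝓝 a)) (hg : Tendsto g l (𝓝 b)) :
    Tendsto (fun x => qform (f x) (g x)) l (𝓝 (qform a b)) :=
  (continuous_qform_pair.tendsto (a, b)).comp (hf.prodMk_nhds hg)

theorem qform_nondegenerate {x : Fin 4 → ℝ} (h : ∀ y, qform x y = 0) : x = 0 := by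
  have h0 := h ![1, 0, 0, 0]
  have h1 := h ![0, 1, 0, 0]
  have h2 := h ![0, 0, 1, 0]
  have h3 := h ![0, 0, 0, 1]
  simp [qform] at h0 h1 h2 h3
  ext i; fin_cases i <;> simp [*]

/-! ### Calculus -/

theorem contDiff_qform {E : Type*} [NormedAddCommGroup E] [NormedSpace ℝ E] {n : WithTop ℕ∞}
    {f g : E → Fin 4 → ℝ} (hf : ContDiff ℝ n f) (hg : ContDiff ℝ n g) :
    ContDiff ℝ n fun x => qform (f x) (g x) := by
  rw [contDiff_pi] at hf hg
  unfold qform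
  exact ((((hf 0).mul (hg 0)).add ((hf 1).mul (hg 1))).sub ((hf 2).mul (hg 2))).sub
    ((hf 3).mul (hg 3))

theorem hasFDerivAt_qform {E : Type*} [NormedAddCommGroup E] [NormedSpace ℝ E]
    {f g : E → Fin 4 → ℝ} {x : E} (hf : DifferentiableAt ℝ f x) (hg : DifferentiableAt ℝ g x) :
    DifferentiableAt ℝ (fun x => qform (f x) (g x)) x ∧
    ∀ v, fderiv ℝ (fun x => qform (f x) (g x)) x v =
      qform (fderiv ℝ f x v) (g x) + qform (f x) (fderiv ℝ g x v) := by
  have hf' := hasFDerivAt_pi'.1 hf.hasFDerivAt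
  have hg' := hasFDerivAt_pi'.1 hg.hasFDerivAt
  have h := ((((hf' 0).mul (hg' 0)).add ((hf' 1).mul (hg' 1))).sub ((hf' 2).mul (hg' 2))).sub
    ((hf' 3).mul (hg' 3))
  have h2 : HasFDerivAt (fun x => qform (f x) (g x)) _ x := h
  refine ⟨h2.differentiableAt, fun v => ?_⟩
  rw [h2.fderiv]
  simp [qform]
  ring

theorem hasDerivAt_qform {f g : ℝ → Fin 4 → ℝ} {x : ℝ} {f' g' : Fin 4 → ℝ}
    (hf : HasDerivAt f f' x) (hg : HasDerivAt g g' x) :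
    HasDerivAt (fun x => qform (f x) (g x)) (qform f' (g x) + qform (f x) g') x := by
  have hf' := hasDerivAt_pi.1 hf
  have hg' := hasDerivAt_pi.1 hg
  have h := ((((hf' 0).mul (hg' 0)).add ((hf' 1).mul (hg' 1))).sub ((hf' 2).mul (hg' 2))).sub
    ((hf' 3).mul (hg' 3))
  refine HasDerivAt.congr_deriv (f := fun x => qform (f x) (g x)) h ?_
  simp only [qform]
  ring

/-- Derivative in the constant direction `v`. -/
def dirD {E : Type*} [NormedAddCommGroup E] [NormedSpace ℝ E] (v : Fin 2 → ℝ)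
    (F : (Fin 2 → ℝ) → E) : (Fin 2 → ℝ) → E := fun x => fderiv ℝ F x v

theorem contDiff_dirD {E : Type*} [NormedAddCommGroup E] [NormedSpace ℝ E] (v : Fin 2 → ℝ)
    {F : (Fin 2 → ℝ) → E} (hF : ContDiff ℝ (⊤ : ℕ∞) F) : ContDiff ℝ (⊤ : ℕ∞) (dirD v F) :=
  (hF.fderiv_right (m := (⊤ : ℕ∞)) (by norm_num)).clm_apply contDiff_const

theorem differentiableAt_of_smooth {E G : Type*} [NormedAddCommGroup E] [NormedSpace ℝ E]
    [NormedAddCommGroup G] [NormedSpace ℝ G]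
    {F : G → E} (hF : ContDiff ℝ (⊤ : ℕ∞) F) (x : G) : DifferentiableAt ℝ F x :=
  (hF.differentiable (by norm_num)).differentiableAt

theorem dirD_comm {E : Type*} [NormedAddCommGroup E] [NormedSpace ℝ E] (v w : Fin 2 → ℝ)
    {F : (Fin 2 → ℝ) → E} (hF : ContDiff ℝ (⊤ : ℕ∞) F) :
    dirD v (dirD w F) = dirD w (dirD v F) := by
  funext x
  have hd : DifferentiableAt ℝ (fderiv ℝ F) x :=
    differentiableAt_of_smooth (hF.fderiv_right (m := (⊤ : ℕ∞)) (by norm_num)) x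
  have key : ∀ a b, dirD a (dirD b F) x = fderiv ℝ (fderiv ℝ F) x a b := by
    intro a b
    have := (hd.hasFDerivAt.clm_apply (hasFDerivAt_const b x)).fderiv
    change fderiv ℝ (fun y => fderiv ℝ F y b) x a = _
    rw [this]; simp
  rw [key, key]
  have := (hF.contDiffAt (x := x)).isSymmSndFDerivAt (by
    rw [minSmoothness_of_isRCLikeNormedField]
    exact WithTop.coe_le_coe.2 (le_top : (2 : ℕ∞) ≤ ⊤))
  exact this v w

theorem dirD_qform (v : Fin 2 → ℝ) {F G : (Fin 2 → ℝ) → Fin 4 → ℝ}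
    (hF : ContDiff ℝ (⊤ : ℕ∞) F) (hG : ContDiff ℝ (⊤ : ℕ∞) G) :
    dirD v (fun x => qform (F x) (G x)) =
      fun x => qform (dirD v F x) (G x) + qform (F x) (dirD v G x) := by
  funext x
  exact (hasFDerivAt_qform (differentiableAt_of_smooth hF x)
    (differentiableAt_of_smooth hG x)).2 v

theorem dirD_mul (v : Fin 2 → ℝ) {f g : (Fin 2 → ℝ) → ℝ}
    (hf : ContDiff ℝ (⊤ : ℕ∞) f) (hg : ContDiff ℝ (⊤ : ℕ∞) g) :
    dirD v (fun x => f x * g x) = fun x => dirD v f x * g x + f x * dirD v g x := by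
  funext x
  have := ((differentiableAt_of_smooth hf x).hasFDerivAt.mul
    (differentiableAt_of_smooth hg x).hasFDerivAt).fderiv
  simp only [dirD]
  rw [show (fun x => f x * g x) = f * g from rfl, this]
  simp; ring

theorem dirD_add (v : Fin 2 → ℝ) {f g : (Fin 2 → ℝ) → ℝ}
    (hf : ContDiff ℝ (⊤ : ℕ∞) f) (hg : ContDiff ℝ (⊤ : ℕ∞) g) :
    dirD v (fun x => f x + g x) = fun x => dirD v f x + dirD v g x := by
  funext x
  simp only [dirD]
  rw [show (fun x => f x + g x) = f + g from rfl, fderiv_add (differentiableAt_of_smooth hf x)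
    (differentiableAt_of_smooth hg x)]
  simp

theorem dirD_const_mul (v : Fin 2 → ℝ) (c : ℝ) {f : (Fin 2 → ℝ) → ℝ}
    (hf : ContDiff ℝ (⊤ : ℕ∞) f) :
    dirD v (fun x => c * f x) = fun x => c * dirD v f x := by
  funext x
  simp only [dirD]
  rw [fderiv_const_mul (differentiableAt_of_smooth hf x)]
  simp

/-! ### Pseudo-orthonormal frames -/

/-- Four vectors whose Gram matrix is `diag(1,1,-1,-1)`. -/
structure IsFrame (a b c d : Fin 4 → ℝ) : Prop where
  aa : qform a a = 1
  bb : qform b b = 1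
  cc : qform c c = -1
  dd : qform d d = -1
  ab : qform a b = 0
  ac : qform a c = 0
  ad : qform a d = 0
  bc : qform b c = 0
  bd : qform b d = 0
  cd : qform c d = 0

/-- The linear map sending the standard basis to the four given vectors. -/
def frameMap (a b c d : Fin 4 → ℝ) : (Fin 4 → ℝ) →ₗ[ℝ] (Fin 4 → ℝ) where
  toFun x := x 0 • a + x 1 • b + x 2 • c + x 3 • d
  map_add' x y := by simp only [Pi.add_apply]; module
  map_smul' r x := by simp only [Pi.smul_apply, smul_eq_mul, RingHom.id_apply]; module

theorem frameMap_apply (a b c d x : Fin 4 → ℝ) :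
    frameMap a b c d x = x 0 • a + x 1 • b + x 2 • c + x 3 • d := rfl

namespace IsFrame

variable {a b c d : Fin 4 → ℝ}

theorem qform_frameMap (h : IsFrame a b c d) (x y : Fin 4 → ℝ) :
    qform (frameMap a b c d x) (frameMap a b c d y) = qform x y := by
  simp only [frameMap_apply, qform_add_left, qform_add_right, qform_smul_left, qform_smul_right,
    h.aa, h.bb, h.cc, h.dd, h.ab, h.ac, h.ad, h.bc, h.bd, h.cd, qform_comm b a, qform_comm c a,
    qform_comm d a, qform_comm c b, qform_comm d b, qform_comm d c]
  simp only [qform]; ring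

theorem frameMap_bijective (h : IsFrame a b c d) : Function.Bijective (frameMap a b c d) := by
  have hinj : Function.Injective (frameMap a b c d) := by
    rw [injective_iff_map_eq_zero]
    intro x hx
    refine qform_nondegenerate fun y => ?_
    rw [← h.qform_frameMap, hx, qform_zero_left]
  exact ⟨hinj, (LinearMap.injective_iff_surjective.1 hinj)⟩

theorem expand (h : IsFrame a b c d) (x : Fin 4 → ℝ) :
    x = qform x a • a + qform x b • b - qform x c • c - qform x d • d := by
  obtain ⟨u, rfl⟩ := h.frameMap_bijective.2 x
  simp only [frameMap_apply, qform_add_left, qform_smul_left,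
    h.aa, h.bb, h.cc, h.dd, h.ab, h.ac, h.ad, h.bc, h.bd, h.cd, qform_comm b a, qform_comm c a,
    qform_comm d a, qform_comm c b, qform_comm d b, qform_comm d c]
  module

theorem qform_expand (h : IsFrame a b c d) (x y : Fin 4 → ℝ) :
    qform x y = qform x a * qform y a + qform x b * qform y b - qform x c * qform y c
      - qform x d * qform y d := by
  conv_lhs => rw [h.expand x]
  simp only [qform_add_left, qform_sub_left, qform_smul_left]
  rw [qform_comm a y, qform_comm b y, qform_comm c y, qform_comm d y]

end IsFrame

namespace SpacelikeSurface

variable (S : SpacelikeSurface)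

/-- First fundamental form. -/
def ff1 (y v w : Fin 2 → ℝ) : ℝ := qform (fderiv ℝ S.emb y v) (fderiv ℝ S.emb y w)

/-- Second fundamental form. -/
def ff2 (y v w : Fin 2 → ℝ) : ℝ := qform (fderiv ℝ S.normal y v) (fderiv ℝ S.emb y w)

theorem ff1_comm (y v w : Fin 2 → ℝ) : S.ff1 y v w = S.ff1 y w v := qform_comm _ _

@[simp] theorem ff1_add_left (y u v w : Fin 2 → ℝ) :
    S.ff1 y (u + v) w = S.ff1 y u w + S.ff1 y v w := by simp [ff1]
@[simp] theorem ff1_add_right (y u v w : Fin 2 → ℝ) :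
    S.ff1 y w (u + v) = S.ff1 y w u + S.ff1 y w v := by simp [ff1]
@[simp] theorem ff1_smul_left (y v w : Fin 2 → ℝ) (c : ℝ) :
    S.ff1 y (c • v) w = c * S.ff1 y v w := by simp [ff1]
@[simp] theorem ff1_smul_right (y v w : Fin 2 → ℝ) (c : ℝ) :
    S.ff1 y w (c • v) = c * S.ff1 y w v := by simp [ff1]
@[simp] theorem ff2_add_left (y u v w : Fin 2 → ℝ) :
    S.ff2 y (u + v) w = S.ff2 y u w + S.ff2 y v w := by simp [ff2]
@[simp] theorem ff2_add_right (y u v w : Fin 2 → ℝ) :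
    S.ff2 y w (u + v) = S.ff2 y w u + S.ff2 y w v := by simp [ff2]
@[simp] theorem ff2_smul_left (y v w : Fin 2 → ℝ) (c : ℝ) :
    S.ff2 y (c • v) w = c * S.ff2 y v w := by simp [ff2]
@[simp] theorem ff2_smul_right (y v w : Fin 2 → ℝ) (c : ℝ) :
    S.ff2 y w (c • v) = c * S.ff2 y w v := by simp [ff2]

theorem ff2_eq (y v w : Fin 2 → ℝ) : S.ff2 y v w = S.ff1 y (S.shape y v) w := by
  simp [ff1, ff2, S.shape_spec]

theorem ff1_pos (y : Fin 2 → ℝ) {v : Fin 2 → ℝ} (hv : v ≠ 0) : 0 < S.ff1 y v v :=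
  S.spacelike y v hv

theorem ff1_nonneg (y v : Fin 2 → ℝ) : 0 ≤ S.ff1 y v v := by
  by_cases h : v = 0
  · simp [h, ff1]
  · exact (S.ff1_pos y h).le

theorem diff_emb (y : Fin 2 → ℝ) : DifferentiableAt ℝ S.emb y :=
  differentiableAt_of_smooth S.smooth_emb y

theorem diff_normal (y : Fin 2 → ℝ) : DifferentiableAt ℝ S.normal y :=
  differentiableAt_of_smooth S.smooth_normal y

theorem emb_orth (y v : Fin 2 → ℝ) : qform (fderiv ℝ S.emb y v) (S.emb y) = 0 := by
  have h := (hasFDerivAt_qform (S.diff_emb y) (S.diff_emb y)).2 v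
  rw [show (fun x => qform (S.emb x) (S.emb x)) = fun _ => (-1 : ℝ) from
    funext S.on_quadric] at h
  simp only [hasFDerivAt_const (-1 : ℝ) y |>.fderiv] at h
  rw [qform_comm (S.emb y)] at h
  simp at h
  linarith

theorem ff2_comm (y v w : Fin 2 → ℝ) : S.ff2 y v w = S.ff2 y w v := by
  have hz : ∀ w : Fin 2 → ℝ, (fun x => qform (S.normal x) (dirD w S.emb x)) = fun _ => (0 : ℝ) :=
    fun w => funext fun x => S.normal_orth x w
  have h : ∀ v w : Fin 2 → ℝ, S.ff2 y v w = - qform (S.normal y) (dirD v (dirD w S.emb) y) := by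
    intro v w
    have := congrFun (dirD_qform v S.smooth_normal (contDiff_dirD w S.smooth_emb)) y
    rw [hz] at this
    have h0 : dirD v (fun _ => (0 : ℝ)) y = 0 := by simp [dirD]
    rw [h0] at this
    change qform (dirD v S.normal y) (dirD w S.emb y) = _
    linarith
  rw [h, h, dirD_comm v w S.smooth_emb]

theorem ff1_cauchy (y u w : Fin 2 → ℝ) : S.ff1 y u w ^ 2 ≤ S.ff1 y u u * S.ff1 y w w := by
  by_cases hw : w = 0
  · simp [hw, ff1]
  have h1 := S.ff1_pos y hw
  have h2 := S.ff1_nonneg y (S.ff1 y w w • u + (-S.ff1 y u w) • w)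
  simp only [ff1_add_left, ff1_add_right, ff1_smul_left, ff1_smul_right, S.ff1_comm y w u] at h2
  have h3 : 0 ≤ S.ff1 y w w * (S.ff1 y u u * S.ff1 y w w - S.ff1 y u w ^ 2) := by
    nlinarith
  have := nonneg_of_mul_nonneg_right h3 h1
  linarith

theorem exists_unit (y : Fin 2 → ℝ) {u : Fin 2 → ℝ} (hu : u ≠ 0) :
    ∃ c : ℝ, 0 < c ∧ S.ff1 y (c • u) (c • u) = 1 := by
  have h := S.ff1_pos y hu
  refine ⟨(√(S.ff1 y u u))⁻¹, by positivity, ?_⟩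
  simp only [ff1_smul_left, ff1_smul_right]
  have h2 : √(S.ff1 y u u) ^ 2 = S.ff1 y u u := Real.sq_sqrt h.le
  have : √(S.ff1 y u u) ≠ 0 := by positivity
  field_simp
  linarith

theorem exists_orthonormal_of_unit (y : Fin 2 → ℝ) {v : Fin 2 → ℝ} (hv : S.ff1 y v v = 1) :
    ∃ w, S.ff1 y w w = 1 ∧ S.ff1 y v w = 0 := by
  set u : Fin 2 → ℝ := ![-v 1, v 0] with hu
  have hne : u + (-S.ff1 y u v) • v ≠ 0 := by
    intro h0
    have e0 := congrFun h0 0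
    have e1 := congrFun h0 1
    simp [hu] at e0 e1
    have : v 0 ^ 2 + v 1 ^ 2 = 0 := by
      rw [← hu] at e0 e1
      linear_combination (-v 1) * e0 + v 0 * e1
    have h0 : v = 0 := by
      ext i; fin_cases i
      · simp; nlinarith [sq_nonneg (v 0), sq_nonneg (v 1)]
      · simp; nlinarith [sq_nonneg (v 0), sq_nonneg (v 1)]
    rw [h0] at hv
    simp [ff1] at hv
  obtain ⟨c, -, hc⟩ := S.exists_unit y hne
  refine ⟨_, hc, ?_⟩
  simp only [ff1_add_right, ff1_smul_right, hv, S.ff1_comm y v u]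
  ring

theorem exists_orthonormal (y : Fin 2 → ℝ) :
    ∃ v w, S.ff1 y v v = 1 ∧ S.ff1 y w w = 1 ∧ S.ff1 y v w = 0 := by
  obtain ⟨c, -, hc⟩ := S.exists_unit y (u := ![1, 0]) (by
    intro h; simpa using congrFun h 0)
  obtain ⟨w, h1, h2⟩ := S.exists_orthonormal_of_unit y hc
  exact ⟨_, w, hc, h1, h2⟩

theorem isFrame (y : Fin 2 → ℝ) {v w : Fin 2 → ℝ} (hv : S.ff1 y v v = 1) (hw : S.ff1 y w w = 1)
    (hvw : S.ff1 y v w = 0) :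
    IsFrame (fderiv ℝ S.emb y v) (fderiv ℝ S.emb y w) (S.emb y) (S.normal y) where
  aa := hv
  bb := hw
  cc := S.on_quadric y
  dd := S.normal_unit y
  ab := hvw
  ac := S.emb_orth y v
  ad := by rw [qform_comm]; exact S.normal_orth y v
  bc := S.emb_orth y w
  bd := by rw [qform_comm]; exact S.normal_orth y w
  cd := by rw [qform_comm]; exact S.normal_orth_base y

section Shape

theorem shape_apply (y w : Fin 2 → ℝ) (i : Fin 2) :
    S.shape y w i = S.shape y ![1, 0] i * w 0 + S.shape y ![0, 1] i * w 1 := by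
  have : w = w 0 • ![1, 0] + w 1 • ![0, 1] := by
    ext j; fin_cases j <;> simp
  conv_lhs => rw [this, map_add, map_smul, map_smul]
  simp only [Pi.add_apply, Pi.smul_apply, smul_eq_mul]; ring

theorem det_shape (y : Fin 2 → ℝ) : LinearMap.det (S.shape y) =
    S.shape y ![1, 0] 0 * S.shape y ![0, 1] 1 - S.shape y ![0, 1] 0 * S.shape y ![1, 0] 1 := by
  rw [← LinearMap.det_toMatrix', Matrix.det_fin_two]
  simp only [LinearMap.toMatrix'_apply]
  rw [show (Pi.single 0 1 : Fin 2 → ℝ) = ![1, 0] by ext j; fin_cases j <;> simp,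
    show (Pi.single 1 1 : Fin 2 → ℝ) = ![0, 1] by ext j; fin_cases j <;> simp]

theorem trace_shape (y : Fin 2 → ℝ) : LinearMap.trace ℝ _ (S.shape y) =
    S.shape y ![1, 0] 0 + S.shape y ![0, 1] 1 := by
  rw [LinearMap.trace_eq_matrix_trace ℝ (Pi.basisFun ℝ (Fin 2)), Matrix.trace_fin_two]
  simp only [LinearMap.toMatrix_apply, Pi.basisFun_apply, Pi.basisFun_repr]
  rw [show (Pi.single 0 1 : Fin 2 → ℝ) = ![1, 0] by ext j; fin_cases j <;> simp,
    show (Pi.single 1 1 : Fin 2 → ℝ) = ![0, 1] by ext j; fin_cases j <;> simp]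

variable {S}

theorem shape_shape (hmax : S.IsMaximal) (y w : Fin 2 → ℝ) :
    S.shape y (S.shape y w) = (-LinearMap.det (S.shape y)) • w := by
  have ht := hmax y
  rw [trace_shape] at ht
  ext i
  rw [S.shape_apply y _ i, S.shape_apply y w 0, S.shape_apply y w 1, det_shape]
  fin_cases i
  · simp; linear_combination (S.shape y ![1, 0] 0 * w 0 + S.shape y ![0, 1] 0 * w 1) * ht
  · simp; linear_combination (S.shape y ![1, 0] 1 * w 0 + S.shape y ![0, 1] 1 * w 1) * ht

theorem ff1_shape_shape (hmax : S.IsMaximal) (y w : Fin 2 → ℝ) :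
    S.ff1 y (S.shape y w) (S.shape y w) = (-LinearMap.det (S.shape y)) * S.ff1 y w w := by
  rw [← ff2_eq, ff2_comm, ff2_eq, shape_shape hmax, ff1_smul_left]

theorem trace_identity (hmax : S.IsMaximal) (y u w : Fin 2 → ℝ) :
    S.ff1 y w w * S.ff2 y u u - 2 * S.ff1 y u w * S.ff2 y u w + S.ff1 y u u * S.ff2 y w w = 0 := by
  have ht := hmax y
  rw [trace_shape] at ht
  have hexp : ∀ v : Fin 2 → ℝ, v = v 0 • ![1, 0] + v 1 • ![0, 1] := by
    intro v; ext j; fin_cases j <;> simp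
  have hs := S.ff2_comm y ![1, 0] ![0, 1]
  rw [ff2_eq, ff2_eq] at hs
  simp only [ff2_eq]
  have hB : ∀ v, S.shape y v = (v 0 * S.shape y ![1, 0] 0 + v 1 * S.shape y ![0, 1] 0) • ![1, 0]
      + (v 0 * S.shape y ![1, 0] 1 + v 1 * S.shape y ![0, 1] 1) • ![0, 1] := by
    intro v
    rw [hexp (S.shape y v), S.shape_apply y v 0, S.shape_apply y v 1]
    congr 2 <;> ring
  rw [hB ![1, 0], hB ![0, 1]] at hs
  rw [hB u, hB w, hexp u, hexp w]
  simp only [ff1_add_left, ff1_add_right, ff1_smul_left, ff1_smul_right,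
    S.ff1_comm y ![0, 1] ![1, 0]] at hs ⊢
  simp at hs ⊢
  set m00 := S.shape y ![1, 0] 0
  set m01 := S.shape y ![0, 1] 0
  set m10 := S.shape y ![1, 0] 1
  set m11 := S.shape y ![0, 1] 1
  set g00 := S.ff1 y ![1, 0] ![1, 0]
  set g01 := S.ff1 y ![1, 0] ![0, 1]
  set g11 := S.ff1 y ![0, 1] ![0, 1]
  linear_combination ((g00 * g11 - g01 ^ 2) * (u 0 * w 1 - u 1 * w 0) ^ 2) * ht +
    (-(u 0 * w 1 - u 1 * w 0) * (g00 * u 0 * w 0 + g01 * (u 0 * w 1 + u 1 * w 0) + g11 * u 1 * w 1)) * hs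

theorem neg_det_nonneg (hmax : S.IsMaximal) (y : Fin 2 → ℝ) : 0 ≤ -LinearMap.det (S.shape y) := by
  have hw : (![1, 0] : Fin 2 → ℝ) ≠ 0 := by intro h; simpa using congrFun h 0
  have h1 := S.ff1_pos y hw
  have h2 := ff1_shape_shape hmax y ![1, 0]
  have h3 := S.ff1_nonneg y (S.shape y ![1, 0])
  rw [h2] at h3
  exact nonneg_of_mul_nonneg_left h3 h1

theorem abs_ff2_le (hmax : S.IsMaximal) (y w : Fin 2 → ℝ) : |S.ff2 y w w| ≤ S.lambdaAt y * S.ff1 y w w := by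
  have h1 := S.ff1_nonneg y w
  have h2 : 0 ≤ S.lambdaAt y := Real.sqrt_nonneg _
  have h3 : S.lambdaAt y ^ 2 = _ := Real.sq_sqrt (neg_det_nonneg hmax y)
  apply abs_le_of_sq_le_sq _ (by positivity)
  rw [mul_pow, h3, ff2_eq]
  have := S.ff1_cauchy y (S.shape y w) w
  rw [ff1_shape_shape hmax] at this
  linarith

theorem lambdaAt_le_of_ff2_le (hmax : S.IsMaximal) (y : Fin 2 → ℝ) {C : ℝ} (hC : 0 ≤ C)
    (h : ∀ v, S.ff2 y v v ≤ C * S.ff1 y v v) : S.lambdaAt y ≤ C := by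
  by_contra hlt
  push Not at hlt
  set l := S.lambdaAt y with hl
  have hl0 : 0 < l := lt_of_le_of_lt hC hlt
  have h3 : l ^ 2 = _ := Real.sq_sqrt (neg_det_nonneg hmax y)
  have key : ∀ w, S.shape y w + l • w = 0 := by
    intro w
    by_contra hne
    have hpos := S.ff1_pos y hne
    have hB : S.shape y (S.shape y w + l • w) = l • (S.shape y w + l • w) := by
      rw [map_add, map_smul, shape_shape hmax, ← h3]
      module
    have := h (S.shape y w + l • w)
    rw [ff2_eq, hB, ff1_smul_left] at this
    nlinarith
  have e0 := congrFun (key ![1, 0]) 0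
  have e1 := congrFun (key ![0, 1]) 1
  have ht := hmax y
  rw [trace_shape] at ht
  simp at e0 e1
  linarith

end Shape

end SpacelikeSurface

/-! ### Projective closures and cones -/

theorem continuous_projPt :
    Continuous fun x : {x : Fin 4 → ℝ // x ≠ 0} => projPt x.1 x.2 :=
  continuous_quotient_mk'

theorem projPt_eq_iff {x y : Fin 4 → ℝ} (hx : x ≠ 0) (hy : y ≠ 0) :
    projPt x hx = projPt y hy ↔ ∃ c : ℝ, c ≠ 0 ∧ x = c • y := by
  unfold projPt
  rw [Projectivization.mk_eq_mk_iff]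
  constructor
  · rintro ⟨a, ha⟩
    exact ⟨a, a.ne_zero, ha.symm⟩
  · rintro ⟨c, hc, h⟩
    exact ⟨Units.mk0 c hc, h.symm⟩

theorem isOpenMap_projPt :
    IsOpenMap fun x : {x : Fin 4 → ℝ // x ≠ 0} => projPt x.1 x.2 := by
  intro U hU
  have hq : IsQuotientMap fun x : {x : Fin 4 → ℝ // x ≠ 0} => projPt x.1 x.2 :=
    isQuotientMap_quotient_mk'
  rw [← hq.isOpen_preimage]
  have : (fun x : {x : Fin 4 → ℝ // x ≠ 0} => projPt x.1 x.2) ⁻¹'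
      ((fun x : {x : Fin 4 → ℝ // x ≠ 0} => projPt x.1 x.2) '' U) =
      ⋃ c : {c : ℝ // c ≠ 0}, (fun x : {x : Fin 4 → ℝ // x ≠ 0} =>
        (⟨c.1 • x.1, smul_ne_zero c.2 x.2⟩ : {x : Fin 4 → ℝ // x ≠ 0})) ⁻¹' U := by
    ext x
    simp only [mem_preimage, mem_image, mem_iUnion]
    constructor
    · rintro ⟨z, hz, h⟩
      obtain ⟨c, hc, h⟩ := (projPt_eq_iff z.2 x.2).1 h
      refine ⟨⟨c, hc⟩, ?_⟩
      convert hz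
      exact h.symm
    · rintro ⟨c, hc⟩
      exact ⟨_, hc, (projPt_eq_iff _ _).2 ⟨c.1, c.2, rfl⟩⟩
  rw [this]
  refine isOpen_iUnion fun c => hU.preimage ?_
  fun_prop

namespace SpacelikeSurface

variable (S : SpacelikeSurface)

theorem emb_ne_zero (y : Fin 2 → ℝ) : S.emb y ≠ 0 := by
  intro h
  have := S.on_quadric y
  simp [h] at this

/-- The union of the lines through the points of the surface, without the origin. -/
def cone : Set (Fin 4 → ℝ) := {x | ∃ (c : ℝ) (y : Fin 2 → ℝ), c ≠ 0 ∧ x = c • S.emb y}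

theorem projPt_mem_proj {x : Fin 4 → ℝ} (hx : x ≠ 0) : projPt x hx ∈ S.proj ↔ x ∈ S.cone := by
  constructor
  · rintro ⟨y, h, e⟩
    obtain ⟨c, hc, e⟩ := (projPt_eq_iff hx h).1 e.symm
    exact ⟨c, y, hc, e⟩
  · rintro ⟨c, y, hc, e⟩
    exact ⟨y, S.emb_ne_zero y, ((projPt_eq_iff hx _).2 ⟨c, hc, e⟩).symm⟩

theorem projPt_mem_closure_proj {x : Fin 4 → ℝ} (hx : x ≠ 0) :
    projPt x hx ∈ closure S.proj ↔ x ∈ closure S.cone := by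
  have h := isOpenMap_projPt.preimage_closure_eq_closure_preimage continuous_projPt S.proj
  have h1 : projPt x hx ∈ closure S.proj ↔ (⟨x, hx⟩ : {x : Fin 4 → ℝ // x ≠ 0}) ∈
      (fun x : {x : Fin 4 → ℝ // x ≠ 0} => projPt x.1 x.2) ⁻¹' closure S.proj := Iff.rfl
  rw [h1, h, closure_subtype]
  have : (Subtype.val '' ((fun x : {x : Fin 4 → ℝ // x ≠ 0} => projPt x.1 x.2) ⁻¹' S.proj))
      = S.cone := by
    ext z
    constructor
    · rintro ⟨u, hu, rfl⟩
      exact (S.projPt_mem_proj u.2).1 hu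
    · intro hz
      have hz0 : z ≠ 0 := by
        obtain ⟨c, y, hc, rfl⟩ := hz
        exact smul_ne_zero hc (S.emb_ne_zero y)
      exact ⟨⟨z, hz0⟩, (S.projPt_mem_proj hz0).2 hz, rfl⟩
  rw [this]

theorem smul_mem_closure_cone {x : Fin 4 → ℝ} (hx : x ∈ closure S.cone) (c : ℝ) :
    c • x ∈ closure S.cone := by
  by_cases hc : c = 0
  · have : ∀ t : ℝ, t ≠ 0 → t • S.emb 0 ∈ S.cone := fun t ht => ⟨t, 0, ht, rfl⟩
    have hcl : (0 : ℝ) ∈ closure {t : ℝ | t ≠ 0} := by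
      have : Dense ({0}ᶜ : Set ℝ) := dense_compl_singleton 0
      exact this 0
    have hm : Continuous fun t : ℝ => t • S.emb 0 := by fun_prop
    have := map_mem_closure hm hcl this
    simpa [hc] using this
  · have hm : Continuous fun x : Fin 4 → ℝ => c • x := by fun_prop
    refine map_mem_closure hm hx ?_
    rintro z ⟨d, y, hd, rfl⟩
    exact ⟨c * d, y, mul_ne_zero hc hd, by rw [mul_smul]⟩

theorem mem_lifts_iff (x : Fin 4 → ℝ) : x ∈ lifts S.bdryAtInfinity ↔
    x ≠ 0 ∧ x ∈ closure S.cone ∧ x ∉ S.cone := by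
  constructor
  · rintro ⟨hx, h1, h2⟩
    exact ⟨hx, (S.projPt_mem_closure_proj hx).1 h1, fun h => h2 ((S.projPt_mem_proj hx).2 h)⟩
  · rintro ⟨hx, h1, h2⟩
    exact ⟨hx, (S.projPt_mem_closure_proj hx).2 h1, fun h => h2 ((S.projPt_mem_proj hx).1 h)⟩

variable {S}

theorem null_of_mem_lifts (hent : S.IsEntire) {x : Fin 4 → ℝ}
    (hx : x ∈ lifts S.bdryAtInfinity) : qform x x = 0 := by
  obtain ⟨hx0, hx⟩ := hx
  have h : qform (projPt x hx0).rep (projPt x hx0).rep = 0 := hent hx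
  obtain ⟨a, ha⟩ := Projectivization.exists_smul_eq_mk_rep ℝ x hx0
  change qform (Projectivization.mk ℝ x hx0).rep (Projectivization.mk ℝ x hx0).rep = 0 at h
  rw [← ha] at h
  have : (a : ℝ) ≠ 0 := a.ne_zero
  change qform ((a : ℝ) • x) ((a : ℝ) • x) = 0 at h
  simpa [this] using h

theorem mem_lifts_iff_null (hent : S.IsEntire) (x : Fin 4 → ℝ) :
    x ∈ lifts S.bdryAtInfinity ↔ x ≠ 0 ∧ x ∈ closure S.cone ∧ qform x x = 0 := by
  constructor
  · intro h
    have h' := (S.mem_lifts_iff x).1 h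
    exact ⟨h'.1, h'.2.1, null_of_mem_lifts hent h⟩
  · rintro ⟨h0, h1, h2⟩
    refine (S.mem_lifts_iff x).2 ⟨h0, h1, ?_⟩
    rintro ⟨c, y, hc, rfl⟩
    simp [S.on_quadric, hc] at h2

theorem mem_cone_of_not_null (hent : S.IsEntire) {x : Fin 4 → ℝ} (hx : x ∈ closure S.cone)
    (hq : qform x x ≠ 0) : x ∈ S.cone := by
  by_contra h
  have h0 : x ≠ 0 := by rintro rfl; simp at hq
  exact hq (null_of_mem_lifts hent ((S.mem_lifts_iff x).2 ⟨h0, hx, h⟩))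

end SpacelikeSurface

/-! ### Local structure of spacelike sheets -/

theorem abs_qform_le (x y : Fin 4 → ℝ) : |qform x y| ≤ 4 * (‖x‖ * ‖y‖) := by
  have h : ∀ i, |x i * y i| ≤ ‖x‖ * ‖y‖ := fun i => by
    rw [abs_mul]
    exact mul_le_mul (norm_le_pi_norm x i) (norm_le_pi_norm y i) (abs_nonneg _) (norm_nonneg _)
  unfold qform
  have h0 := abs_le.1 (h 0)
  have h1 := abs_le.1 (h 1)
  have h2 := abs_le.1 (h 2)
  have h3 := abs_le.1 (h 3)
  rw [abs_le]
  constructor <;> linarith [h0.1, h0.2, h1.1, h1.2, h2.1, h2.2, h3.1, h3.2]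

/-- The projection to the first two coordinates. -/
def projXY : (Fin 4 → ℝ) →L[ℝ] (Fin 2 → ℝ) :=
  ContinuousLinearMap.pi ![ContinuousLinearMap.proj 0, ContinuousLinearMap.proj 1]

@[simp] theorem projXY_zero (x : Fin 4 → ℝ) : projXY x 0 = x 0 := rfl
@[simp] theorem projXY_one (x : Fin 4 → ℝ) : projXY x 1 = x 1 := rfl

theorem projXY_fderiv_surj {s : (Fin 2 → ℝ) → Fin 4 → ℝ} {z : Fin 2 → ℝ}
    (hsp : ∀ v, v ≠ 0 → 0 < qform (fderiv ℝ s z v) (fderiv ℝ s z v)) :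
    (projXY ∘L fderiv ℝ s z).range = ⊤ := by
  rw [LinearMap.range_eq_top]
  apply LinearMap.injective_iff_surjective.1
  rw [injective_iff_map_eq_zero]
  intro v hv
  by_contra hne
  have h := hsp v hne
  have h0 := congrFun hv 0
  have h1 := congrFun hv 1
  change fderiv ℝ s z v 0 = 0 at h0
  change fderiv ℝ s z v 1 = 0 at h1
  unfold qform at h
  rw [h0, h1] at h
  nlinarith [sq_nonneg (fderiv ℝ s z v 2), sq_nonneg (fderiv ℝ s z v 3)]

theorem map_nhds_projXY {s : (Fin 2 → ℝ) → Fin 4 → ℝ} (hs : ContDiff ℝ (⊤ : ℕ∞) s) {z : Fin 2 → ℝ}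
    (hsp : ∀ v, v ≠ 0 → 0 < qform (fderiv ℝ s z v) (fderiv ℝ s z v)) :
    Filter.map (fun y => projXY (s y)) (𝓝 z) = 𝓝 (projXY (s z)) := by
  have h1 : HasStrictFDerivAt s (fderiv ℝ s z) z :=
    hs.contDiffAt.hasStrictFDerivAt (by simp)
  have h2 : HasStrictFDerivAt (fun y => projXY (s y)) (projXY ∘L fderiv ℝ s z) z :=
    projXY.hasStrictFDerivAt.comp z h1
  exact h2.map_nhds_eq_of_surj (projXY_fderiv_surj hsp)

theorem exists_pos_lower_bound {A : (Fin 2 → ℝ) →L[ℝ] (Fin 4 → ℝ)}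
    (hsp : ∀ v, v ≠ 0 → 0 < qform (A v) (A v)) :
    ∃ κ > 0, ∀ v, κ * ‖v‖ ^ 2 ≤ qform (A v) (A v) := by
  have hcont : Continuous fun v => qform (A v) (A v) :=
    continuous_qform A.continuous A.continuous
  obtain ⟨v₀, hv₀, hmin⟩ := (isCompact_sphere (0 : Fin 2 → ℝ) 1).exists_isMinOn
    (NormedSpace.sphere_nonempty.2 zero_le_one) hcont.continuousOn
  have hv₀' : v₀ ≠ 0 := by
    rintro rfl; simp at hv₀
  refine ⟨_, hsp v₀ hv₀', fun v => ?_⟩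
  by_cases hv : v = 0
  · simp [hv]
  have hn : 0 < ‖v‖ := norm_pos_iff.2 hv
  have := hmin (show ‖v‖⁻¹ • v ∈ Metric.sphere (0 : Fin 2 → ℝ) 1 by
    simp [norm_smul, hn.ne'])
  simp only [mem_ofPred_eq, map_smul, qform_smul_left, qform_smul_right] at this
  calc _ ≤ (‖v‖⁻¹ * (‖v‖⁻¹ * qform (A v) (A v))) * ‖v‖ ^ 2 := by gcongr
    _ = _ := by field_simp

theorem sheet_local {s : (Fin 2 → ℝ) → Fin 4 → ℝ} (hs : ContDiff ℝ (⊤ : ℕ∞) s) {z : Fin 2 → ℝ}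
    (hq : ∀ y, qform (s y) (s y) = -1)
    (hsp : ∀ v, v ≠ 0 → 0 < qform (fderiv ℝ s z v) (fderiv ℝ s z v)) :
    ∃ κ > 0, ∃ δ > 0, ∀ u : Fin 2 → ℝ, ‖u - projXY (s z)‖ < δ → ∃ y, projXY (s y) = u ∧
      κ * ((u 0 - s z 0) ^ 2 + (u 1 - s z 1) ^ 2) ≤ -2 - 2 * qform (s y) (s z) := by
  obtain ⟨κ, hκ, hlow⟩ := exists_pos_lower_bound hsp
  set A := fderiv ℝ s z with hA
  have hd : HasFDerivAt s A z := (differentiableAt_of_smooth hs z).hasFDerivAt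
  set M := ‖A‖ + 1 with hM
  have hM0 : 0 < M := by positivity
  obtain ⟨θ, hθ, hθ1, hθ2⟩ : ∃ θ > 0, θ ≤ 1 ∧ 12 * M * θ ≤ κ / 2 := by
    refine ⟨min 1 (κ / (24 * M)), by positivity, min_le_left _ _, ?_⟩
    calc 12 * M * min 1 (κ / (24 * M)) ≤ 12 * M * (κ / (24 * M)) := by
          gcongr; exact min_le_right _ _
      _ = κ / 2 := by field_simp; norm_num
  have hev : ∀ᶠ y in 𝓝 z, κ / (4 * M ^ 2) * ((s y 0 - s z 0) ^ 2 + (s y 1 - s z 1) ^ 2) ≤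
      -2 - 2 * qform (s y) (s z) := by
    filter_upwards [hd.isLittleO.bound hθ] with y hy
    set v := y - z
    set r := s y - s z - A v with hr
    have hsy : s y - s z = A v + r := by rw [hr]; abel
    have hAv : ‖A v‖ ≤ (M - 1) * ‖v‖ := by simpa [hM] using A.le_opNorm v
    have hAv' : ‖A v‖ ≤ M * ‖v‖ := hAv.trans (by nlinarith [norm_nonneg v])
    have e1 : -2 - 2 * qform (s y) (s z) = qform (s y - s z) (s y - s z) := by
      simp only [qform_sub_left, qform_sub_right, hq, qform_comm (s z) (s y)]; ring
    have e2 : qform (s y - s z) (s y - s z) = qform (A v) (A v) + 2 * qform (A v) r + qform r r := by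
      rw [hsy]
      simp only [qform_add_left, qform_add_right, qform_comm r (A v)]; ring
    have b1 := abs_le.1 (abs_qform_le (A v) r)
    have b2 := abs_le.1 (abs_qform_le r r)
    have b3 : ‖A v‖ * ‖r‖ ≤ M * θ * ‖v‖ ^ 2 := by
      calc ‖A v‖ * ‖r‖ ≤ (M * ‖v‖) * (θ * ‖v‖) := by gcongr
        _ = _ := by ring
    have b4 : ‖r‖ * ‖r‖ ≤ M * θ * ‖v‖ ^ 2 := by
      calc ‖r‖ * ‖r‖ ≤ (θ * ‖v‖) * (θ * ‖v‖) := by gcongr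
        _ = θ * θ * ‖v‖ ^ 2 := by ring
        _ ≤ M * θ * ‖v‖ ^ 2 := by
          gcongr
          linarith [norm_nonneg A]
    have b5 : κ / 2 * ‖v‖ ^ 2 ≤ qform (s y - s z) (s y - s z) := by
      rw [e2]
      have := hlow v
      have : 12 * M * θ * ‖v‖ ^ 2 ≤ κ / 2 * ‖v‖ ^ 2 := by gcongr
      nlinarith
    have b6 : ‖s y - s z‖ ≤ M * ‖v‖ := by
      rw [hsy]
      calc ‖A v + r‖ ≤ ‖A v‖ + ‖r‖ := norm_add_le _ _
        _ ≤ (M - 1) * ‖v‖ + θ * ‖v‖ := by gcongr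
        _ ≤ M * ‖v‖ := by nlinarith [norm_nonneg v]
    have b7 : ∀ i, (s y i - s z i) ^ 2 ≤ M ^ 2 * ‖v‖ ^ 2 := by
      intro i
      rw [← mul_pow, ← sq_abs]
      have := (norm_le_pi_norm (s y - s z) i).trans b6
      gcongr
      exact this
    rw [e1]
    refine le_trans ?_ b5
    calc _ ≤ κ / (4 * M ^ 2) * (M ^ 2 * ‖v‖ ^ 2 + M ^ 2 * ‖v‖ ^ 2) := by
          gcongr <;> apply b7
      _ = _ := by field_simp; ring
  have himg := image_mem_map hev (m := fun y => projXY (s y))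
  rw [map_nhds_projXY hs hsp, Metric.mem_nhds_iff] at himg
  obtain ⟨δ, hδ, hball⟩ := himg
  refine ⟨κ / (4 * M ^ 2), by positivity, δ, hδ, fun u hu => ?_⟩
  obtain ⟨y, hy, rfl⟩ := hball (show u ∈ Metric.ball _ _ by rwa [mem_ball_iff_norm])
  exact ⟨y, rfl, by simpa using hy⟩

/-- A closed cone whose non-null part is swept out by spacelike sheets. -/
structure IsSheeted (Y : Set (Fin 4 → ℝ)) : Prop where
  closed : IsClosed Y
  smul_mem : ∀ x ∈ Y, ∀ c : ℝ, c • x ∈ Y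
  sheet : ∀ x ∈ Y, qform x x ≠ 0 → ∃ (s : (Fin 2 → ℝ) → Fin 4 → ℝ) (z : Fin 2 → ℝ) (c : ℝ),
    ContDiff ℝ (⊤ : ℕ∞) s ∧ (∀ y, s y ∈ Y) ∧ (∀ y, qform (s y) (s y) = -1) ∧
    (∀ v, v ≠ 0 → 0 < qform (fderiv ℝ s z v) (fderiv ℝ s z v)) ∧ x = c • s z

/-- A point of the cone `x₂² + x₃² = 1`, `x₀² + x₁² = sin² s`. -/
def rayPt (s φ α : ℝ) : Fin 4 → ℝ := ![sin s * cos φ, sin s * sin φ, cos α, sin α]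

theorem qform_rayPt (s φ α s' φ' α' : ℝ) : qform (rayPt s φ α) (rayPt s' φ' α') =
    sin s * sin s' * cos (φ' - φ) - cos (α' - α) := by
  simp [qform, rayPt, cos_sub]; ring

theorem qform_rayPt_self (s φ α : ℝ) : qform (rayPt s φ α) (rayPt s φ α) = - cos s ^ 2 := by
  rw [qform_rayPt]; simp; nlinarith [sin_sq_add_cos_sq s]

theorem exists_angle {a b : ℝ} (h : a ^ 2 + b ^ 2 = 1) :
    ∃ β, |β| ≤ π ∧ cos β = a ∧ sin β = b := by
  have ha : -1 ≤ a := by nlinarith [sq_nonneg b]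
  have ha' : a ≤ 1 := by nlinarith [sq_nonneg b]
  have hs : √(1 - a ^ 2) = |b| := by
    rw [show 1 - a ^ 2 = b ^ 2 by linarith, Real.sqrt_sq_eq_abs]
  rcases le_total 0 b with hb | hb
  · refine ⟨arccos a, ?_, cos_arccos ha ha', ?_⟩
    · rw [abs_of_nonneg (arccos_nonneg a)]; exact arccos_le_pi a
    · rw [sin_arccos, hs, abs_of_nonneg hb]
  · refine ⟨-arccos a, ?_, by rw [cos_neg, cos_arccos ha ha'], ?_⟩
    · rw [abs_neg, abs_of_nonneg (arccos_nonneg a)]; exact arccos_le_pi a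
    · rw [sin_neg, sin_arccos, hs, abs_of_nonpos hb]; ring

/-- From a point of the sheet through `rayPt s φ α` above the right place, a point of the cone. -/
theorem exists_rayPt {Y : Set (Fin 4 → ℝ)} (hY : IsSheeted Y) {w x : Fin 4 → ℝ} {c s φ α s' φ' : ℝ}
    (hw : w ∈ Y) (hwq : qform w w = -1) (hc : c ≠ 0) (hx : rayPt s φ α = c • x)
    (hxq : qform x x = -1) (hs : 0 < cos s) (hs' : 0 < cos s')
    (h0 : w 0 = sin s' * cos s / (c * cos s') * cos φ')
    (h1 : w 1 = sin s' * cos s / (c * cos s') * sin φ') :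
    ∃ β, |β| ≤ π ∧ rayPt s' φ' (α + β) ∈ Y ∧
      cos β = sin s * sin s' * cos (φ' - φ) - cos s * cos s' * qform w x := by
  have hc2 : c ^ 2 = cos s ^ 2 := by
    have := qform_rayPt_self s φ α
    rw [hx] at this
    simp [hxq] at this
    linarith
  set d := c * cos s' / cos s with hd
  have hd0 : d ≠ 0 := by positivity
  have hd2 : d ^ 2 = cos s' ^ 2 := by
    rw [hd, div_pow, mul_pow, hc2]; field_simp
  have e0 : d * w 0 = sin s' * cos φ' := by rw [h0, hd]; field_simp
  have e1 : d * w 1 = sin s' * sin φ' := by rw [h1, hd]; field_simp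
  have hunit : (d * w 2) ^ 2 + (d * w 3) ^ 2 = 1 := by
    have : (d * w 0) ^ 2 + (d * w 1) ^ 2 - (d * w 2) ^ 2 - (d * w 3) ^ 2 = - cos s' ^ 2 := by
      rw [← hd2]
      unfold qform at hwq
      linear_combination d ^ 2 * hwq
    rw [e0, e1] at this
    have h3 := sin_sq_add_cos_sq s'
    have h4 := sin_sq_add_cos_sq φ'
    linear_combination (-1) * this + h3 + sin s' ^ 2 * h4
  obtain ⟨β, hβ, hcβ, hsβ⟩ := exists_angle
    (a := cos α * (d * w 2) + sin α * (d * w 3)) (b := cos α * (d * w 3) - sin α * (d * w 2)) (by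
      have := sin_sq_add_cos_sq α
      linear_combination hunit + ((d * w 2) ^ 2 + (d * w 3) ^ 2) * this)
  have hpt : rayPt s' φ' (α + β) = d • w := by
    have hα := sin_sq_add_cos_sq α
    ext i; fin_cases i
    · simp [rayPt, e0]
    · simp [rayPt, e1]
    · simp [rayPt, cos_add, hcβ, hsβ]; linear_combination (d * w 2) * hα
    · simp [rayPt, sin_add, hcβ, hsβ]; linear_combination (d * w 3) * hα
  refine ⟨β, hβ, ?_, ?_⟩
  · rw [hpt]; exact hY.smul_mem w hw d
  · have := qform_rayPt s φ α s' φ' (α + β)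
    rw [hpt, hx, qform_smul_left, qform_smul_right, qform_comm x w, add_sub_cancel_left] at this
    have hcd : c * d = cos s * cos s' := by
      rw [hd]; field_simp; rw [hc2]
    linear_combination this - qform w x * hcd

theorem exists_step {Y : Set (Fin 4 → ℝ)} (hY : IsSheeted Y) {s φ α b : ℝ}
    (hp : rayPt s φ α ∈ Y) (hs0 : 0 ≤ s) (hs : s < π / 2) (hb : s < b) :
    ∃ s' α', s < s' ∧ s' ≤ b ∧ |α' - α| ≤ s' - s ∧ rayPt s' φ α' ∈ Y := by
  have hcs : 0 < cos s := cos_pos_of_mem_Ioo ⟨by linarith, hs⟩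
  have hq := qform_rayPt_self s φ α
  obtain ⟨f, z, c, hf, hfY, hfq, hsp, hx⟩ := hY.sheet _ hp (by rw [hq]; simp [hcs.ne'])
  have hc : c ≠ 0 := by
    rintro rfl
    rw [hx] at hq
    simp [hcs.ne'] at hq
  obtain ⟨κ, hκ, δ, hδ, hloc⟩ := sheet_local hf hfq hsp
  set u : ℝ → Fin 2 → ℝ := fun s' =>
    ![sin s' * cos s / (c * cos s') * cos φ, sin s' * cos s / (c * cos s') * sin φ] with hu
  have hus : u s = projXY (f z) := by
    have e0 := congrFun hx 0
    have e1 := congrFun hx 1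
    simp [rayPt] at e0 e1
    ext i; fin_cases i
    · simp [hu]; field_simp; rw [e0]
    · simp [hu]; field_simp; rw [e1]
  have hcont : ContinuousAt u s := by
    rw [continuousAt_pi]
    intro i
    have : c * cos s ≠ 0 := by positivity
    fin_cases i
    · simp only [hu]
      change ContinuousAt (fun s' => sin s' * cos s / (c * cos s') * cos φ) s
      fun_prop (disch := assumption)
    · simp only [hu]
      change ContinuousAt (fun s' => sin s' * cos s / (c * cos s') * sin φ) s
      fun_prop (disch := assumption)
  have hev : ∀ᶠ s' in 𝓝[>] s, ‖u s' - projXY (f z)‖ < δ := by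
    have := hcont.tendsto.mono_left (nhdsWithin_le_nhds (s := Ioi s))
    rw [hus] at this
    have := this.eventually (Metric.ball_mem_nhds (projXY (f z)) hδ)
    simpa [dist_eq_norm] using this
  have hev2 : ∀ᶠ s' in 𝓝[>] s, s' ∈ Ioo s (min b (π / 2)) :=
    Ioo_mem_nhdsGT (lt_min hb hs)
  obtain ⟨s', h1, h2⟩ := (hev.and hev2).exists
  obtain ⟨y, hy, hk⟩ := hloc _ h1
  have hs'b : s' < b := h2.2.trans_le (min_le_left _ _)
  have hs'p : s' < π / 2 := h2.2.trans_le (min_le_right _ _)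
  have hcs' : 0 < cos s' := cos_pos_of_mem_Ioo ⟨by linarith [h2.1], hs'p⟩
  obtain ⟨β, hβ, hβY, hcosβ⟩ := exists_rayPt hY (hfY y) (hfq y) hc hx (hfq z) hcs hcs'
    (φ' := φ) (by simpa [hu] using congrFun hy 0) (by simpa [hu] using congrFun hy 1)
  refine ⟨s', α + β, h2.1, hs'b.le, ?_, hβY⟩
  rw [add_sub_cancel_left]
  by_contra hlt
  push Not at hlt
  have hk' : qform (f y) (f z) ≤ -1 := by
    have : 0 ≤ κ * ((u s' 0 - f z 0) ^ 2 + (u s' 1 - f z 1) ^ 2) := by positivity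
    linarith
  have h3 : cos |β| < cos (s' - s) :=
    cos_lt_cos_of_nonneg_of_le_pi (by linarith [h2.1]) hβ hlt
  rw [cos_abs, hcosβ, sub_self, cos_zero, cos_sub] at h3
  nlinarith [mul_pos hcs hcs']

theorem exists_start {Y : Set (Fin 4 → ℝ)} (hY : IsSheeted Y) (he : ![0, 0, 1, 0] ∈ Y) :
    ∃ ε η : ℝ, 0 < ε ∧ ε < π / 2 ∧ 0 < η ∧ ∀ φ, ∃ α, |α| ≤ ε - η ∧ rayPt ε φ α ∈ Y := by
  have hray : ∀ φ, rayPt 0 φ 0 = ![0, 0, 1, 0] := by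
    intro φ; ext i; fin_cases i <;> simp [rayPt]
  have hq : qform ![0, 0, 1, 0] ![0, 0, 1, 0] = -1 := by simp [qform]
  obtain ⟨f, z, c, hf, hfY, hfq, hsp, hx⟩ := hY.sheet _ he (by rw [hq]; norm_num)
  have hc2 : c ^ 2 = 1 := by
    rw [hx] at hq
    simp [hfq] at hq
    linarith
  have hc : c ≠ 0 := by rintro rfl; simp at hc2
  obtain ⟨κ, hκ, δ, hδ, hloc⟩ := sheet_local hf hfq hsp
  have hz0 : f z 0 = 0 := by
    have := congrFun hx 0; simpa [hc] using this
  have hz1 : f z 1 = 0 := by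
    have := congrFun hx 1; simpa [hc] using this
  set ε := arctan (δ / 2) with hε
  have hε0 : 0 < ε := by rw [hε]; exact arctan_pos.2 (by positivity)
  have hεp : ε < π / 2 := arctan_lt_pi_div_two _
  have htan : tan ε = δ / 2 := tan_arctan _
  have hcε : 0 < cos ε := cos_arctan_pos _
  set m := cos ε * (1 + κ / 2 * (δ / 2) ^ 2) with hm
  have hm1 : cos ε < m := by
    have : 0 < cos ε * (κ / 2 * (δ / 2) ^ 2) := by positivity
    rw [hm]; linarith
  have harc : arccos m < ε := by
    rcases lt_or_ge 1 m with h1 | h1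
    · rw [arccos_eq_zero.2 h1.le]; exact hε0
    · have := strictAntiOn_arccos (show cos ε ∈ Icc (-1) 1 from ⟨neg_one_le_cos _, cos_le_one _⟩)
        (show m ∈ Icc (-1 : ℝ) 1 from ⟨by linarith, h1⟩) hm1
      rwa [arccos_cos hε0.le (by linarith [pi_pos])] at this
  refine ⟨ε, ε - arccos m, hε0, hεp, by linarith, fun φ => ?_⟩
  set u : Fin 2 → ℝ := ![sin ε * cos 0 / (c * cos ε) * cos φ, sin ε * cos 0 / (c * cos ε) * sin φ]
    with hu
  have hct : sin ε * cos 0 / (c * cos ε) = c * (δ / 2) := by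
    rw [← htan, tan_eq_sin_div_cos, cos_zero]
    field_simp
    rw [hc2]; ring
  have hcabs : |c| = 1 := by
    have := sq_abs c
    rw [hc2] at this
    nlinarith [abs_nonneg c]
  have hnorm : ‖u - projXY (f z)‖ < δ := by
    refine lt_of_le_of_lt ?_ (half_lt_self hδ)
    rw [pi_norm_le_iff_of_nonneg (by positivity)]
    intro i
    fin_cases i
    · change |u 0 - f z 0| ≤ δ / 2
      rw [hz0, sub_zero, show u 0 = c * (δ / 2) * cos φ by simp only [hu, hct]; rfl, abs_mul,
        abs_mul, hcabs, one_mul, abs_of_pos (half_pos hδ)]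
      exact mul_le_of_le_one_right (by positivity) (abs_cos_le_one φ)
    · change |u 1 - f z 1| ≤ δ / 2
      rw [hz1, sub_zero, show u 1 = c * (δ / 2) * sin φ by simp only [hu, hct]; rfl, abs_mul,
        abs_mul, hcabs, one_mul, abs_of_pos (half_pos hδ)]
      exact mul_le_of_le_one_right (by positivity) (abs_sin_le_one φ)
  obtain ⟨y, hy, hk⟩ := hloc u hnorm
  obtain ⟨β, hβ, hβY, hcosβ⟩ := exists_rayPt hY (hfY y) (hfq y) hc ((hray 0).trans hx) (hfq z)
    (s := 0) (by simp) hcε (φ' := φ) (by simpa [hu] using congrFun hy 0)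
    (by simpa [hu] using congrFun hy 1)
  refine ⟨0 + β, ?_, hβY⟩
  have hk' : 1 + κ / 2 * (δ / 2) ^ 2 ≤ - qform (f y) (f z) := by
    rw [hz0, hz1] at hk
    have : (u 0 - 0) ^ 2 + (u 1 - 0) ^ 2 = (δ / 2) ^ 2 := by
      simp only [hu, hct]
      simp
      linear_combination (c ^ 2 * (δ / 2) ^ 2) * sin_sq_add_cos_sq φ + (δ / 2) ^ 2 * hc2
    rw [this] at hk
    linarith
  have hcos : m ≤ cos |0 + β| := by
    rw [zero_add, cos_abs, hcosβ, hm]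
    simp
    nlinarith
  rw [sub_sub_cancel]
  have := antitone_arccos hcos
  rw [arccos_cos (abs_nonneg _) (by simpa using hβ)] at this
  exact this

theorem ray_lemma {Y : Set (Fin 4 → ℝ)} (hY : IsSheeted Y) (he : ![0, 0, 1, 0] ∈ Y) :
    ∃ η > 0, ∀ φ, ∃ α, |α| ≤ π / 2 - η ∧ rayPt (π / 2) φ α ∈ Y := by
  obtain ⟨ε, η, hε, hεp, hη, hstart⟩ := exists_start hY he
  refine ⟨η, hη, fun φ => ?_⟩
  set T : Set ℝ := {s | ∃ α, |α| ≤ s - η ∧ rayPt s φ α ∈ Y} with hT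
  have hclosed : IsClosed (T ∩ Icc ε (π / 2)) := by
    have hK : IsCompact ((Icc ε (π / 2) ×ˢ Icc (-π) π) ∩
        {p : ℝ × ℝ | |p.2| ≤ p.1 - η ∧ rayPt p.1 φ p.2 ∈ Y}) := by
      refine (isCompact_Icc.prod isCompact_Icc).inter_right (IsClosed.inter ?_ ?_)
      · exact isClosed_le (f := fun p : ℝ × ℝ => |p.2|) (g := fun p : ℝ × ℝ => p.1 - η)
          (by fun_prop) (by fun_prop)
      · refine hY.closed.preimage (f := fun p : ℝ × ℝ => rayPt p.1 φ p.2) ?_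
        rw [continuous_pi_iff]
        intro i
        fin_cases i <;> simp only [rayPt]
        · change Continuous fun p : ℝ × ℝ => sin p.1 * cos φ; fun_prop
        · change Continuous fun p : ℝ × ℝ => sin p.1 * sin φ; fun_prop
        · change Continuous fun p : ℝ × ℝ => cos p.2; fun_prop
        · change Continuous fun p : ℝ × ℝ => sin p.2; fun_prop
    have := (hK.image continuous_fst).isClosed
    convert this using 1
    ext s
    constructor
    · rintro ⟨⟨α, h1, h2⟩, h3⟩
      have := abs_le.1 h1
      exact ⟨(s, α), ⟨⟨h3, by simp only [mem_Icc]; constructor <;> linarith [h3.2, pi_pos]⟩,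
        h1, h2⟩, rfl⟩
    · rintro ⟨⟨s', α⟩, ⟨⟨h3, -⟩, h1, h2⟩, rfl⟩
      exact ⟨⟨α, h1, h2⟩, h3⟩
  have hsub : Icc ε (π / 2) ⊆ T := by
    refine hclosed.Icc_subset_of_forall_exists_gt (hstart φ) ?_
    rintro s ⟨⟨α, hα, hp⟩, hs⟩ b hb
    obtain ⟨s', α', h1, h2, h3, h4⟩ := exists_step hY hp (hε.le.trans hs.1) hs.2 hb
    refine ⟨s', ⟨α', ?_, h4⟩, h1, h2⟩
    have := abs_le.1 h3
    have := abs_le.1 hα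
    rw [abs_le]; constructor <;> linarith
  exact hsub ⟨hεp.le, le_rfl⟩

/-! ### The null directions of a sheeted cone -/

/-- The null vectors of `Y` on the positive side of `L`. -/
def posNull (Y : Set (Fin 4 → ℝ)) (L : (Fin 4 → ℝ) →ₗ[ℝ] ℝ) : Set (Fin 4 → ℝ) :=
  {x | x ∈ Y ∧ x ≠ 0 ∧ qform x x = 0 ∧ 0 < L x}

theorem smul_mem_posNull {Y : Set (Fin 4 → ℝ)} {L : (Fin 4 → ℝ) →ₗ[ℝ] ℝ}
    (hY : ∀ x ∈ Y, ∀ c : ℝ, c • x ∈ Y) {x : Fin 4 → ℝ} (hx : x ∈ posNull Y L) {c : ℝ}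
    (hc : 0 < c) : c • x ∈ posNull Y L := by
  obtain ⟨h1, h2, h3, h4⟩ := hx
  refine ⟨hY x h1 c, smul_ne_zero hc.ne' h2, by simp [h3], ?_⟩
  rw [map_smul, smul_eq_mul]; positivity

/-- A convex cone on which `L` is positive and which does not contain two orthogonal timelike
vectors. -/
structure IsAcausalCone (C : ConvexCone ℝ (Fin 4 → ℝ)) (L : (Fin 4 → ℝ) →ₗ[ℝ] ℝ) : Prop where
  pos : ∀ p ∈ C, 0 < L p
  not_orth : ∀ p ∈ C, ∀ p' ∈ C, qform p p < 0 → qform p' p' < 0 → qform p p' ≠ 0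

theorem qform_lt_of_opposite {C : ConvexCone ℝ (Fin 4 → ℝ)} {L : (Fin 4 → ℝ) →ₗ[ℝ] ℝ}
    (hC : IsAcausalCone C L) {x a : Fin 4 → ℝ} (hx : x ∈ C) (ha : a ∈ C)
    (hxq : qform x x = 0) (haq : qform a a = 0) (h0 : a 0 = -x 0) (h1 : a 1 = -x 1) :
    qform x a < 0 := by
  have hp := hC.pos _ (C.add_mem hx ha)
  have hne : x + a ≠ 0 := by
    intro h; rw [h] at hp; simp at hp
  have e : 2 * qform x a = -((x 2 + a 2) ^ 2 + (x 3 + a 3) ^ 2) := by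
    unfold qform at hxq haq ⊢
    rw [h0, h1] at haq ⊢
    linarith
  by_contra hge
  push Not at hge
  have h2 : x 2 + a 2 = 0 := by nlinarith [sq_nonneg (x 2 + a 2), sq_nonneg (x 3 + a 3)]
  have h3 : x 3 + a 3 = 0 := by nlinarith [sq_nonneg (x 2 + a 2), sq_nonneg (x 3 + a 3)]
  apply hne
  ext i; fin_cases i
  · simp [h0]
  · simp [h1]
  · simpa using h2
  · simpa using h3

theorem qform_nonpos_of_opposites {C : ConvexCone ℝ (Fin 4 → ℝ)} {L : (Fin 4 → ℝ) →ₗ[ℝ] ℝ}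
    (hC : IsAcausalCone C L) {x a x' a' : Fin 4 → ℝ} (hx : x ∈ C) (ha : a ∈ C)
    (hxq : qform x x = 0) (haq : qform a a = 0) (h0 : a 0 = -x 0) (h1 : a 1 = -x 1)
    (hx' : x' ∈ C) (ha' : a' ∈ C)
    (hxq' : qform x' x' = 0) (haq' : qform a' a' = 0) (h0' : a' 0 = -x' 0) (h1' : a' 1 = -x' 1) :
    qform x x' ≤ 0 := by
  by_contra hpos
  push Not at hpos
  have hxa := qform_lt_of_opposite hC hx ha hxq haq h0 h1
  have hxa' := qform_lt_of_opposite hC hx' ha' hxq' haq' h0' h1'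
  set p := x + a with hp
  set p' := x' + a' with hp'
  have hpC : p ∈ C := C.add_mem hx ha
  have hpC' : p' ∈ C := C.add_mem hx' ha'
  have hpq : qform p p < 0 := by
    simp only [hp, qform_add_left, qform_add_right, hxq, haq, qform_comm a x]; linarith
  have hpq' : qform p' p' < 0 := by
    simp only [hp', qform_add_left, qform_add_right, hxq', haq', qform_comm a' x']; linarith
  have hpp : qform p p' < 0 := by
    by_contra hge
    push Not at hge
    rcases hge.eq_or_lt with heq | hlt
    · exact hC.not_orth p hpC p' hpC' hpq hpq' heq.symm
    · set r := qform p p' • p + (-qform p p) • p' with hr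
      have hrC : r ∈ C := C.add_mem (C.smul_mem hlt hpC) (C.smul_mem (by linarith) hpC')
      have hr0 : r ≠ 0 := by
        intro h
        have := hC.pos r hrC
        rw [h] at this; simp at this
      have hz0 : r 0 = 0 := by simp [hr, hp, hp', h0, h0']
      have hz1 : r 1 = 0 := by simp [hr, hp, hp', h1, h1']
      have hrq : qform r r < 0 := by
        by_contra hge
        push Not at hge
        unfold qform at hge
        rw [hz0, hz1] at hge
        apply hr0
        have h2 : r 2 = 0 := by nlinarith [sq_nonneg (r 2), sq_nonneg (r 3)]
        have h3 : r 3 = 0 := by nlinarith [sq_nonneg (r 2), sq_nonneg (r 3)]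
        ext i; fin_cases i
        · exact hz0
        · exact hz1
        · exact h2
        · exact h3
      refine hC.not_orth p hpC r hrC hpq hrq ?_
      simp only [hr, qform_add_right, qform_smul_right]; ring
  have hcont : Continuous fun s : ℝ => qform (x + s • a) (x' + s • a') :=
    continuous_qform (by fun_prop) (by fun_prop)
  have hmem : (0 : ℝ) ∈ Ioo (qform (x + (1 : ℝ) • a) (x' + (1 : ℝ) • a'))
      (qform (x + (0 : ℝ) • a) (x' + (0 : ℝ) • a')) := by
    simp only [one_smul, zero_smul, add_zero]
    exact ⟨hpp, hpos⟩
  obtain ⟨s, hs, hsz⟩ := intermediate_value_Ioo' (zero_le_one (α := ℝ)) hcont.continuousOn hmem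
  refine hC.not_orth _ (C.add_mem hx (C.smul_mem hs.1 ha)) _
    (C.add_mem hx' (C.smul_mem hs.1 ha')) ?_ ?_ hsz
  · simp only [qform_add_left, qform_add_right, qform_smul_left, qform_smul_right, hxq, haq,
      qform_comm a x]
    nlinarith [hs.1]
  · simp only [qform_add_left, qform_add_right, qform_smul_left, qform_smul_right, hxq', haq',
      qform_comm a' x']
    nlinarith [hs.1]

theorem rayPt_null (φ α : ℝ) : qform (rayPt (π / 2) φ α) (rayPt (π / 2) φ α) = 0 := by
  rw [qform_rayPt_self]; simp

theorem rayPt_ne_zero (s φ α : ℝ) : rayPt s φ α ≠ 0 := by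
  intro h
  have h2 := congrFun h 2
  have h3 := congrFun h 3
  simp [rayPt] at h2 h3
  have := sin_sq_add_cos_sq α
  simp [h2, h3] at this

/-- For a sheeted cone through `e₂`, either all directions have a positive null vector close to
`e₂` or all have a negative one. -/
theorem exists_sign {Y : Set (Fin 4 → ℝ)} (hY : IsSheeted Y) (he : ![0, 0, 1, 0] ∈ Y)
    {L : (Fin 4 → ℝ) →ₗ[ℝ] ℝ} (hL : ∀ x ∈ Y, x ≠ 0 → qform x x = 0 → L x ≠ 0)
    {C : ConvexCone ℝ (Fin 4 → ℝ)} (hC : IsAcausalCone C L) (hΓC : posNull Y L ⊆ C) :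
    ∃ τ : ℝ, (τ = 1 ∨ τ = -1) ∧ ∀ φ, ∃ v ∈ posNull Y L, v 0 = cos φ ∧ v 1 = sin φ ∧ 0 < τ * v 2 := by
  obtain ⟨η, hη, hray⟩ := ray_lemma hY he
  have hηp : η ≤ π / 2 := by
    obtain ⟨α, h, -⟩ := hray 0
    linarith [abs_nonneg α]
  have hcos : ∀ α, |α| ≤ π / 2 - η → 0 < cos α := fun α h => by
    have := abs_le.1 h
    exact cos_pos_of_mem_Ioo ⟨by linarith, by linarith⟩
  have hcos2 : ∀ α β, |α| ≤ π / 2 - η → |β| ≤ π / 2 - η → 0 < 1 + cos (α - β) := by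
    intro α β hα hβ
    have h1 := abs_le.1 hα
    have h2 := abs_le.1 hβ
    have hlt : |α - β| < π := by rw [abs_lt]; constructor <;> linarith
    have := cos_lt_cos_of_nonneg_of_le_pi (abs_nonneg _) le_rfl hlt
    rw [cos_pi, cos_abs] at this
    linarith
  have hLray : ∀ φ α, rayPt (π / 2) φ α ∈ Y → L (rayPt (π / 2) φ α) ≠ 0 := fun φ α h =>
    hL _ h (rayPt_ne_zero _ _ _) (rayPt_null _ _)
  have hcontray : Continuous fun p : ℝ × Icc (-π) π => rayPt (π / 2) p.1 p.2 := by
    rw [continuous_pi_iff]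
    intro i
    fin_cases i <;> simp only [rayPt]
    · change Continuous fun p : ℝ × Icc (-π) π => sin (π / 2) * cos p.1; fun_prop
    · change Continuous fun p : ℝ × Icc (-π) π => sin (π / 2) * sin p.1; fun_prop
    · change Continuous fun p : ℝ × Icc (-π) π => cos (p.2 : ℝ); fun_prop
    · change Continuous fun p : ℝ × Icc (-π) π => sin (p.2 : ℝ); fun_prop
  have hLc : Continuous L := L.continuous_of_finiteDimensional
  have hcl : ∀ τ : ℝ, IsClosed {φ | ∃ α, |α| ≤ π / 2 - η ∧ rayPt (π / 2) φ α ∈ Y ∧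
      0 ≤ τ * L (rayPt (π / 2) φ α)} := by
    intro τ
    have h1 : IsClosed {p : ℝ × Icc (-π) π | |(p.2 : ℝ)| ≤ π / 2 - η ∧
        rayPt (π / 2) p.1 p.2 ∈ Y ∧ 0 ≤ τ * L (rayPt (π / 2) p.1 p.2)} := by
      refine IsClosed.inter ?_ (IsClosed.inter ?_ ?_)
      · exact isClosed_le (f := fun p : ℝ × Icc (-π) π => |(p.2 : ℝ)|) (by fun_prop)
          continuous_const
      · exact hY.closed.preimage hcontray
      · exact isClosed_le continuous_const (continuous_const.mul (hLc.comp hcontray))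
    have := isClosedMap_fst_of_compactSpace _ h1
    convert this using 1
    ext φ
    constructor
    · rintro ⟨α, hα⟩
      have := abs_le.1 hα.1
      exact ⟨(φ, ⟨α, by constructor <;> linarith [pi_pos]⟩), hα, rfl⟩
    · rintro ⟨⟨φ', α⟩, h, rfl⟩
      exact ⟨α, h⟩
  set A := {φ | ∃ α, |α| ≤ π / 2 - η ∧ rayPt (π / 2) φ α ∈ Y ∧
      0 ≤ 1 * L (rayPt (π / 2) φ α)} with hA
  set B := {φ | ∃ α, |α| ≤ π / 2 - η ∧ rayPt (π / 2) φ α ∈ Y ∧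
      0 ≤ -1 * L (rayPt (π / 2) φ α)} with hB
  have hcover : ∀ φ, φ ∈ A ∨ φ ∈ B := by
    intro φ
    obtain ⟨α, h1, h2⟩ := hray φ
    rcases le_total 0 (L (rayPt (π / 2) φ α)) with h | h
    · exact Or.inl ⟨α, h1, h2, by linarith⟩
    · exact Or.inr ⟨α, h1, h2, by linarith⟩
  have hAmem : ∀ φ ∈ A, ∃ α, |α| ≤ π / 2 - η ∧ rayPt (π / 2) φ α ∈ posNull Y L := by
    rintro φ ⟨α, h1, h2, h3⟩
    refine ⟨α, h1, h2, rayPt_ne_zero _ _ _, rayPt_null _ _, ?_⟩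
    exact lt_of_le_of_ne (by linarith) (hLray φ α h2).symm
  have hBmem : ∀ φ ∈ B, ∃ α, |α| ≤ π / 2 - η ∧ (-1 : ℝ) • rayPt (π / 2) φ α ∈ posNull Y L := by
    rintro φ ⟨α, h1, h2, h3⟩
    refine ⟨α, h1, hY.smul_mem _ h2 _, smul_ne_zero (by norm_num) (rayPt_ne_zero _ _ _),
      by simp [rayPt_null], ?_⟩
    rw [map_smul, smul_eq_mul]
    exact lt_of_le_of_ne (by linarith) (mul_ne_zero (by norm_num) (hLray φ α h2)).symm
  have hdisj : ∀ φ, φ ∈ A → φ ∈ B → False := by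
    intro φ ha hb
    obtain ⟨α, hα, h1⟩ := hAmem φ ha
    obtain ⟨β, hβ, h2⟩ := hBmem φ hb
    rcases hcover (φ + π) with hc | hc
    · obtain ⟨γ, hγ, h3⟩ := hAmem _ hc
      have := qform_nonpos_of_opposites hC (hΓC h3) (hΓC h1) h3.2.2.1 h1.2.2.1
        (by simp [rayPt]) (by simp [rayPt]) (hΓC h2) (hΓC h1) h2.2.2.1 h1.2.2.1
        (by simp [rayPt]) (by simp [rayPt])
      rw [qform_smul_right, qform_rayPt] at this
      have h4 := hcos2 β γ hβ hγ
      rw [show φ - (φ + π) = -π by ring, cos_neg, cos_pi, sin_pi_div_two] at this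
      linarith
    · obtain ⟨γ, hγ, h3⟩ := hBmem _ hc
      have := qform_nonpos_of_opposites hC (hΓC h1) (hΓC h2) h1.2.2.1 h2.2.2.1
        (by simp [rayPt]) (by simp [rayPt]) (hΓC h3) (hΓC h2) h3.2.2.1 h2.2.2.1
        (by simp [rayPt]) (by simp [rayPt])
      rw [qform_smul_right, qform_rayPt] at this
      have h4 := hcos2 γ α hγ hα
      rw [show φ + π - φ = π by ring, cos_pi, sin_pi_div_two] at this
      linarith
  have hclopen : IsClopen A := by
    refine ⟨hcl 1, ?_⟩
    rw [← isClosed_compl_iff]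
    have : Aᶜ = B := by
      ext φ
      constructor
      · intro h; exact (hcover φ).resolve_left h
      · intro h h'; exact hdisj φ h' h
    rw [this]; exact hcl (-1)
  rcases isClopen_iff.1 hclopen with h | h
  · refine ⟨-1, Or.inr rfl, fun φ => ?_⟩
    have hb : φ + π ∈ B := (hcover _).resolve_left (by rw [h]; exact fun h => h)
    obtain ⟨α, hα, h1⟩ := hBmem _ hb
    refine ⟨_, h1, by simp [rayPt], by simp [rayPt], ?_⟩
    have := hcos α hα
    simpa [rayPt] using this
  · refine ⟨1, Or.inl rfl, fun φ => ?_⟩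
    obtain ⟨α, hα, h1⟩ := hAmem φ (by rw [h]; trivial)
    refine ⟨_, h1, by simp [rayPt], by simp [rayPt], ?_⟩
    have := hcos α hα
    simpa [rayPt] using this

theorem exists_polar (a b : ℝ) : ∃ ρ φ, 0 ≤ ρ ∧ ρ ^ 2 = a ^ 2 + b ^ 2 ∧ a = ρ * cos φ ∧ b = ρ * sin φ := by
  by_cases h : a ^ 2 + b ^ 2 = 0
  · refine ⟨0, 0, le_rfl, by simp [h], ?_, ?_⟩
    · simp; nlinarith [sq_nonneg a, sq_nonneg b]
    · simp; nlinarith [sq_nonneg a, sq_nonneg b]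
  have hpos : 0 < a ^ 2 + b ^ 2 := lt_of_le_of_ne (by positivity) (Ne.symm h)
  have hs : √(a ^ 2 + b ^ 2) ≠ 0 := by positivity
  have hs2 : √(a ^ 2 + b ^ 2) ^ 2 = a ^ 2 + b ^ 2 := Real.sq_sqrt hpos.le
  obtain ⟨φ, -, h1, h2⟩ := exists_angle (a := a / √(a ^ 2 + b ^ 2)) (b := b / √(a ^ 2 + b ^ 2)) (by
    rw [div_pow, div_pow, hs2]; field_simp)
  refine ⟨√(a ^ 2 + b ^ 2), φ, by positivity, hs2, ?_, ?_⟩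
  · rw [h1]; field_simp
  · rw [h2]; field_simp

theorem exists_scaled {Y : Set (Fin 4 → ℝ)} (hY : ∀ x ∈ Y, ∀ c : ℝ, c • x ∈ Y)
    {L : (Fin 4 → ℝ) →ₗ[ℝ] ℝ} {x : Fin 4 → ℝ} (hx : x ∈ posNull Y L)
    {τ : ℝ} (h : ∀ φ, ∃ v ∈ posNull Y L, v 0 = cos φ ∧ v 1 = sin φ ∧ 0 < τ * v 2) :
    (∃ v ∈ posNull Y L, v 0 = x 0 ∧ v 1 = x 1 ∧ 0 < τ * v 2) ∧
    ∃ v ∈ posNull Y L, v 0 = -x 0 ∧ v 1 = -x 1 := by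
  obtain ⟨ρ, φ, hρ, hρ2, e0, e1⟩ := exists_polar (x 0) (x 1)
  have hρpos : 0 < ρ := by
    refine lt_of_le_of_ne hρ fun h0 => hx.2.1 ?_
    subst h0
    have hq := hx.2.2.1
    unfold qform at hq
    simp at e0 e1
    rw [e0, e1] at hq
    ext i; fin_cases i
    · simp [e0]
    · simp [e1]
    · simp; nlinarith [sq_nonneg (x 2), sq_nonneg (x 3)]
    · simp; nlinarith [sq_nonneg (x 2), sq_nonneg (x 3)]
  constructor
  · obtain ⟨v, hv, h0, h1, h2⟩ := h φ
    refine ⟨ρ • v, smul_mem_posNull hY hv hρpos, by simp [h0, e0], by simp [h1, e1], ?_⟩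
    simp only [Pi.smul_apply, smul_eq_mul]
    nlinarith [mul_pos hρpos h2]
  · obtain ⟨v, hv, h0, h1, h2⟩ := h (φ + π)
    exact ⟨ρ • v, smul_mem_posNull hY hv hρpos, by simp [h0, e0], by simp [h1, e1]⟩

theorem posNull_properties {Y : Set (Fin 4 → ℝ)} (hY : IsSheeted Y) (he : ![0, 0, 1, 0] ∈ Y)
    {L : (Fin 4 → ℝ) →ₗ[ℝ] ℝ} (hL : ∀ x ∈ Y, x ≠ 0 → qform x x = 0 → L x ≠ 0)
    {C : ConvexCone ℝ (Fin 4 → ℝ)} (hC : IsAcausalCone C L) (hΓC : posNull Y L ⊆ C) :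
    (∃ τ : ℝ, ∀ x ∈ posNull Y L, 0 < τ * x 2) ∧
    (∀ x ∈ posNull Y L, ∀ x' ∈ posNull Y L, qform x x' ≤ 0) ∧
    (∀ x ∈ posNull Y L, ∃ a ∈ posNull Y L, qform x a < 0) ∧ (posNull Y L).Nonempty := by
  obtain ⟨τ, hτ, h⟩ := exists_sign hY he hL hC hΓC
  have hneg : ∀ x ∈ posNull Y L, ∀ x' ∈ posNull Y L, qform x x' ≤ 0 := by
    intro x hx x' hx'
    obtain ⟨-, a, ha, h0, h1⟩ := exists_scaled hY.smul_mem hx h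
    obtain ⟨-, a', ha', h0', h1'⟩ := exists_scaled hY.smul_mem hx' h
    exact qform_nonpos_of_opposites hC (hΓC hx) (hΓC ha) hx.2.2.1 ha.2.2.1 h0 h1
      (hΓC hx') (hΓC ha') hx'.2.2.1 ha'.2.2.1 h0' h1'
  refine ⟨⟨τ, ?_⟩, hneg, ?_, ?_⟩
  · intro x hx
    obtain ⟨⟨v, hv, h0, h1, h2⟩, -⟩ := exists_scaled hY.smul_mem hx h
    have h3 := hneg x hx v hv
    have h4 := hx.2.2.1
    have h5 := hv.2.2.1
    unfold qform at h3 h4 h5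
    rw [h0, h1] at h3 h5
    have : x 2 = v 2 := by
      nlinarith [sq_nonneg (x 2 - v 2), sq_nonneg (x 3 - v 3)]
    rw [this]; exact h2
  · intro x hx
    obtain ⟨-, a, ha, h0, h1⟩ := exists_scaled hY.smul_mem hx h
    exact ⟨a, ha, qform_lt_of_opposite hC (hΓC hx) (hΓC ha) hx.2.2.1 ha.2.2.1 h0 h1⟩
  · obtain ⟨v, hv, -⟩ := h 0
    exact ⟨v, hv⟩

namespace SpacelikeSurface

variable {S : SpacelikeSurface}

theorem isSheeted_preimage (hent : S.IsEntire) {a b c d : Fin 4 → ℝ} (h : IsFrame a b c d) :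
    IsSheeted (frameMap a b c d ⁻¹' closure S.cone) := by
  set e := LinearEquiv.ofBijective (frameMap a b c d) h.frameMap_bijective with he
  have heq : ∀ x, e x = frameMap a b c d x := fun x => rfl
  set A : (Fin 4 → ℝ) →L[ℝ] (Fin 4 → ℝ) := LinearMap.toContinuousLinearMap e.symm.toLinearMap with hA
  have hAe : ∀ x, frameMap a b c d (A x) = x := fun x => e.apply_symm_apply x
  have hAq : ∀ x y, qform (A x) (A y) = qform x y := fun x y => by
    rw [← h.qform_frameMap, hAe, hAe]
  refine ⟨isClosed_closure.preimage (LinearMap.continuous_of_finiteDimensional _), ?_, ?_⟩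
  · intro x hx c'
    rw [mem_preimage, map_smul]
    exact S.smul_mem_closure_cone hx c'
  · intro x hx hq
    rw [← h.qform_frameMap] at hq
    obtain ⟨c', z, hc', hz⟩ := mem_cone_of_not_null hent hx hq
    refine ⟨fun y => A (S.emb y), z, c', A.contDiff.comp S.smooth_emb, ?_, ?_, ?_, ?_⟩
    · intro y
      rw [mem_preimage, hAe]
      exact subset_closure ⟨1, y, one_ne_zero, (one_smul _ _).symm⟩
    · intro y; rw [hAq]; exact S.on_quadric y
    · intro v hv
      have : fderiv ℝ (fun y => A (S.emb y)) z v = A (fderiv ℝ S.emb z v) := by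
        have := (A.hasFDerivAt.comp z (S.diff_emb z).hasFDerivAt).fderiv
        exact congrArg (fun B => B v) this
      rw [this, hAq]
      exact S.spacelike z v hv
    · apply h.frameMap_bijective.1
      rw [map_smul, hAe, hz]

theorem posNull_closure_cone_properties (hent : S.IsEntire) {L : (Fin 4 → ℝ) →ₗ[ℝ] ℝ}
    (hL : ∀ x ∈ closure S.cone, x ≠ 0 → qform x x = 0 → L x ≠ 0)
    {C : ConvexCone ℝ (Fin 4 → ℝ)} (hC : IsAcausalCone C L)
    (hΓC : posNull (closure S.cone) L ⊆ C) (y : Fin 2 → ℝ) :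
    (∃ τ : ℝ, ∀ x ∈ posNull (closure S.cone) L, 0 < τ * qform x (S.emb y)) ∧
    (∀ x ∈ posNull (closure S.cone) L, ∀ x' ∈ posNull (closure S.cone) L, qform x x' ≤ 0) ∧
    (∀ x ∈ posNull (closure S.cone) L, ∃ a ∈ posNull (closure S.cone) L, qform x a < 0) ∧
    (posNull (closure S.cone) L).Nonempty := by
  obtain ⟨v, w, hv, hw, hvw⟩ := S.exists_orthonormal y
  have h := S.isFrame y hv hw hvw
  set Φ := frameMap (fderiv ℝ S.emb y v) (fderiv ℝ S.emb y w) (S.emb y) (S.normal y) with hΦ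
  have hinj : ∀ x, Φ x = 0 ↔ x = 0 := fun x => by
    exact map_eq_zero_iff Φ h.frameMap_bijective.1
  have hmem : ∀ x, x ∈ posNull (Φ ⁻¹' closure S.cone) (L ∘ₗ Φ) ↔ Φ x ∈ posNull (closure S.cone) L := by
    intro x
    simp only [posNull, mem_ofPred_eq, mem_preimage, LinearMap.comp_apply, ne_eq, hinj,
      ← h.qform_frameMap x x]
    rfl
  have hC' : IsAcausalCone (C.comap Φ) (L ∘ₗ Φ) := by
    refine ⟨fun p hp => hC.pos _ hp, fun p hp p' hp' h1 h2 => ?_⟩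
    rw [← h.qform_frameMap] at h1 h2 ⊢
    exact hC.not_orth _ hp _ hp' h1 h2
  have he : ![0, 0, 1, 0] ∈ Φ ⁻¹' closure S.cone := by
    have : Φ ![0, 0, 1, 0] = S.emb y := by simp [hΦ, frameMap_apply]
    rw [mem_preimage, this]
    exact subset_closure ⟨1, y, one_ne_zero, (one_smul _ _).symm⟩
  have hL' : ∀ x ∈ Φ ⁻¹' closure S.cone, x ≠ 0 → qform x x = 0 → (L ∘ₗ Φ) x ≠ 0 := by
    intro x hx h0 hq
    rw [← h.qform_frameMap] at hq
    exact hL _ hx (mt (hinj x).1 h0) hq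
  obtain ⟨⟨τ, h1⟩, h2, h3, h4⟩ := posNull_properties (isSheeted_preimage hent h) he hL' hC'
    (fun x hx => hΓC ((hmem x).1 hx))
  have hsurj := h.frameMap_bijective.2
  refine ⟨⟨-τ, ?_⟩, ?_, ?_, ?_⟩
  · intro x hx
    obtain ⟨x, rfl⟩ := hsurj x
    have := h1 x ((hmem x).2 hx)
    have e : qform (Φ x) (S.emb y) = - x 2 := by
      simp [hΦ, frameMap_apply, h.ac, h.bc, h.cc, qform_comm (S.normal y), h.cd]
    change 0 < -τ * qform (Φ x) (S.emb y)
    rw [e]; linarith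
  · intro x hx x' hx'
    obtain ⟨x, rfl⟩ := hsurj x
    obtain ⟨x', rfl⟩ := hsurj x'
    rw [h.qform_frameMap]
    exact h2 x ((hmem x).2 hx) x' ((hmem x').2 hx')
  · intro x hx
    obtain ⟨x, rfl⟩ := hsurj x
    obtain ⟨a, ha, h5⟩ := h3 x ((hmem x).2 hx)
    exact ⟨Φ a, (hmem a).1 ha, by rwa [h.qform_frameMap]⟩
  · obtain ⟨x, hx⟩ := h4
    exact ⟨Φ x, (hmem x).1 hx⟩

theorem bddAbove_width_set (Γ : Set RP3) : BddAbove {T : ℝ | 0 ≤ T ∧ T < π ∧ ∃ a b : Fin 4 → ℝ,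
      qform a a = -1 ∧ qform b b = -1 ∧ qform a b = 0 ∧
      ∀ t ∈ Icc (0 : ℝ) T, ∃ h : (Real.cos t • a + Real.sin t • b) ≠ 0,
        projPt (Real.cos t • a + Real.sin t • b) h ∈ projConvexHull Γ} :=
  ⟨π, fun _ hT => hT.2.1.le⟩

theorem exists_neg_sq_smul {p : Fin 4 → ℝ} (hp : qform p p < 0) :
    ∃ c : ℝ, 0 < c ∧ qform (c • p) (c • p) = -1 := by
  have h : 0 < -qform p p := by linarith
  refine ⟨(√(-qform p p))⁻¹, by positivity, ?_⟩
  rw [qform_smul_left, qform_smul_right]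
  have h2 : √(-qform p p) ^ 2 = -qform p p := Real.sq_sqrt h.le
  have : √(-qform p p) ≠ 0 := by positivity
  field_simp
  linarith

/-- If the width is less than `π / 2`, the cone over the convex hull has no orthogonal timelike
vectors. -/
theorem isAcausalCone_toCone (hent : S.IsEntire) (hw : width S.bdryAtInfinity < π / 2)
    {L : (Fin 4 → ℝ) →ₗ[ℝ] ℝ} (hL : ∀ x ∈ lifts S.bdryAtInfinity, L x ≠ 0) :
    IsAcausalCone (ConvexCone.hull ℝ (convexHull ℝ (posNull (closure S.cone) L))) L := by
  have hset : posNull (closure S.cone) L = {x | x ∈ lifts S.bdryAtInfinity ∧ 0 < L x} := by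
    ext x
    simp only [posNull, mem_ofPred_eq, mem_lifts_iff_null hent]
    tauto
  have hpos : ∀ p ∈ ConvexCone.hull ℝ (convexHull ℝ (posNull (closure S.cone) L)), 0 < L p := by
    intro p hp
    rw [ConvexCone.mem_hull_of_convex (convex_convexHull ℝ _)] at hp
    obtain ⟨c, hc, z, hz, rfl⟩ := hp
    have : z ∈ {x | 0 < L x} := by
      refine convexHull_min (fun x hx => hx.2.2.2) ?_ hz
      exact convex_halfSpace_gt L.isLinear 0
    rw [map_smul, smul_eq_mul]
    exact mul_pos hc this
  refine ⟨hpos, ?_⟩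
  set C := ConvexCone.hull ℝ (convexHull ℝ (posNull (closure S.cone) L)) with hC
  intro p hp p' hp' hq hq' horth
  obtain ⟨c, hc, hcq⟩ := exists_neg_sq_smul hq
  obtain ⟨c', hc', hcq'⟩ := exists_neg_sq_smul hq'
  have ha : c • p ∈ C := C.smul_mem hc hp
  have hb : c' • p' ∈ C := C.smul_mem hc' hp'
  have hle : π / 2 ≤ width S.bdryAtInfinity := by
    refine le_csSup (bddAbove_width_set _) ⟨by positivity, by linarith [pi_pos], c • p, c' • p',
      hcq, hcq', by simp [horth], fun t ht => ?_⟩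
    have hmem : cos t • c • p + sin t • c' • p' ∈ C := by
      have h1 : 0 ≤ cos t := cos_nonneg_of_mem_Icc ⟨by linarith [ht.1, pi_pos], ht.2⟩
      have h2 : 0 ≤ sin t := sin_nonneg_of_mem_Icc ⟨ht.1, by linarith [ht.2, pi_pos]⟩
      rcases h1.eq_or_lt with h1 | h1
      · have : sin t ≠ 0 := fun h => by
          have := sin_sq_add_cos_sq t
          rw [h, ← h1] at this; simp at this
        rw [← h1, zero_smul, zero_add]
        exact C.smul_mem (lt_of_le_of_ne h2 this.symm) hb
      rcases h2.eq_or_lt with h2 | h2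
      · rw [← h2, zero_smul, add_zero]
        exact C.smul_mem h1 ha
      · exact C.add_mem (C.smul_mem h1 ha) (C.smul_mem h2 hb)
    have hLp := hpos _ hmem
    have hne : cos t • c • p + sin t • c' • p' ≠ 0 := by
      intro h; rw [h] at hLp; simp at hLp
    refine ⟨hne, L, hL, ?_⟩
    rw [hC, ConvexCone.mem_hull_of_convex (convex_convexHull ℝ _)] at hmem
    obtain ⟨r, hr, z, hz, e⟩ := hmem
    change r • z = _ at e
    have hz0 : z ≠ 0 := by rintro rfl; rw [smul_zero] at e; exact hne e.symm
    refine ⟨z, hz0, ?_, by rwa [← hset]⟩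
    rw [projPt_eq_iff]
    exact ⟨r⁻¹, by positivity, by rw [← e, smul_smul, inv_mul_cancel₀ hr.ne', one_smul]⟩
  linarith

variable (S) in
/-- `L` selects lifts of the asymptotic boundary which are coherent with the surface. -/
structure IsTame (L : (Fin 4 → ℝ) →ₗ[ℝ] ℝ) : Prop where
  ne_zero : ∀ x ∈ closure S.cone, x ≠ 0 → qform x x = 0 → L x ≠ 0
  neg : ∀ x ∈ posNull (closure S.cone) L, ∀ y, qform x (S.emb y) < 0
  nonpos : ∀ x ∈ posNull (closure S.cone) L, ∀ x' ∈ posNull (closure S.cone) L, qform x x' ≤ 0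
  opp : ∀ x ∈ posNull (closure S.cone) L, ∃ a ∈ posNull (closure S.cone) L, qform x a < 0
  nonempty : (posNull (closure S.cone) L).Nonempty

theorem mem_posNull_neg {Y : Set (Fin 4 → ℝ)} (hY : ∀ x ∈ Y, ∀ c : ℝ, c • x ∈ Y)
    {L : (Fin 4 → ℝ) →ₗ[ℝ] ℝ} {x : Fin 4 → ℝ} (hx : x ∈ posNull Y L) : -x ∈ posNull Y (-L) := by
  obtain ⟨h1, h2, h3, h4⟩ := hx
  refine ⟨?_, neg_ne_zero.2 h2, by simp [h3], by simpa using h4⟩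
  have := hY x h1 (-1)
  simpa using this

theorem exists_isTame (hent : S.IsEntire) (hw : width S.bdryAtInfinity < π / 2)
    {L : (Fin 4 → ℝ) →ₗ[ℝ] ℝ} (hL : ∀ x ∈ lifts S.bdryAtInfinity, L x ≠ 0) :
    ∃ L', S.IsTame L' := by
  have hL' : ∀ x ∈ closure S.cone, x ≠ 0 → qform x x = 0 → L x ≠ 0 := fun x h1 h2 h3 =>
    hL x ((mem_lifts_iff_null hent x).2 ⟨h2, h1, h3⟩)
  have hprop := posNull_closure_cone_properties hent hL' (isAcausalCone_toCone hent hw hL)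
    (fun x hx => ConvexCone.subset_hull (subset_convexHull ℝ _ hx))
  obtain ⟨-, h2, h3, x₀, hx₀⟩ := hprop 0
  have hsign : ∀ y, ∃ τ : ℝ, ∀ x ∈ posNull (closure S.cone) L, 0 < τ * qform x (S.emb y) :=
    fun y => (hprop y).1
  have hcont : Continuous fun y => qform x₀ (S.emb y) :=
    continuous_qform continuous_const S.smooth_emb.continuous
  have hne : ∀ y, qform x₀ (S.emb y) ≠ 0 := fun y h => by
    obtain ⟨τ, hτ⟩ := hsign y
    have := hτ x₀ hx₀
    rw [h] at this; simp at this
  have hconst : (∀ y, qform x₀ (S.emb y) < 0) ∨ ∀ y, 0 < qform x₀ (S.emb y) := by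
    by_contra hcon
    push Not at hcon
    obtain ⟨⟨y₁, h₁⟩, y₂, h₂⟩ := hcon
    obtain ⟨z, hz⟩ := mem_range_of_exists_le_of_exists_ge hcont ⟨y₂, h₂⟩ ⟨y₁, h₁⟩
    exact hne z hz
  rcases hconst with h | h
  · refine ⟨L, hL', fun x hx y => ?_, h2, h3, x₀, hx₀⟩
    obtain ⟨τ, hτ⟩ := hsign y
    have h4 := hτ x₀ hx₀
    have h5 := hτ x hx
    have : τ < 0 := by
      by_contra h6
      push Not at h6
      nlinarith [h y]
    nlinarith
  · have hsm := fun x hx c => S.smul_mem_closure_cone (x := x) hx c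
    have hback : ∀ x ∈ posNull (closure S.cone) (-L), -x ∈ posNull (closure S.cone) L := by
      intro x hx
      simpa using mem_posNull_neg hsm hx
    refine ⟨-L, fun x h1 h2 h3 => ?_, fun x hx y => ?_, fun x hx x' hx' => ?_, fun x hx => ?_,
      -x₀, mem_posNull_neg hsm hx₀⟩
    · simpa using hL' x h1 h2 h3
    · obtain ⟨τ, hτ⟩ := hsign y
      have h4 := hτ x₀ hx₀
      have h5 := hτ _ (hback x hx)
      rw [qform_neg_left] at h5
      have : 0 < τ := by
        by_contra h6
        push Not at h6
        nlinarith [h y]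
      nlinarith
    · simpa using h2 _ (hback x hx) _ (hback x' hx')
    · obtain ⟨a, ha, h4⟩ := h3 _ (hback x hx)
      exact ⟨-a, mem_posNull_neg hsm ha, by simpa using h4⟩

end SpacelikeSurface

namespace SpacelikeSurface

/-! ### Properness -/

variable {S : SpacelikeSurface} {L : (Fin 4 → ℝ) →ₗ[ℝ] ℝ}

theorem emb_mem_cone (S : SpacelikeSurface) (y : Fin 2 → ℝ) {c : ℝ} (hc : c ≠ 0) :
    c • S.emb y ∈ S.cone := ⟨c, y, hc, rfl⟩

theorem IsTame.mem_posNull_of_tendsto (hT : S.IsTame L) {y : ℕ → Fin 2 → ℝ} {c : ℕ → ℝ}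
    (hc : ∀ n, 0 < c n) {x : Fin 4 → ℝ} (h : Tendsto (fun n => c n • S.emb (y n)) atTop (𝓝 x))
    (hx : x ≠ 0) (hq : qform x x = 0) : x ∈ posNull (closure S.cone) L := by
  have hcl : x ∈ closure S.cone := mem_closure_of_tendsto h
    (Eventually.of_forall fun n => S.emb_mem_cone (y n) (hc n).ne')
  refine ⟨hcl, hx, hq, ?_⟩
  by_contra hneg
  have hneg : L x < 0 := lt_of_le_of_ne (not_lt.1 hneg) (hT.ne_zero x hcl hx hq)
  have hm : -x ∈ posNull (closure S.cone) L := by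
    have := S.smul_mem_closure_cone hcl (-1)
    rw [neg_one_smul] at this
    exact ⟨this, neg_ne_zero.2 hx, by simp [hq], by simpa using hneg⟩
  obtain ⟨a, ha, h1⟩ := hT.opp _ hm
  have h2 : qform x a ≤ 0 := by
    refine le_of_tendsto (tendsto_qform h tendsto_const_nhds) (Eventually.of_forall fun n => ?_)
    have := hT.neg a ha (y n)
    rw [qform_smul_left, qform_comm]
    nlinarith [hc n]
  rw [qform_neg_left] at h1
  linarith

theorem IsTame.isClosed_range (hT : S.IsTame L) (hent : S.IsEntire) : IsClosed (range S.emb) := by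
  rw [← isSeqClosed_iff_isClosed]
  intro x p hx hp
  choose y hy using hx
  have hq : qform p p = -1 := by
    have h := tendsto_qform hp hp
    refine tendsto_nhds_unique h (tendsto_const_nhds.congr fun n => ?_)
    rw [← hy, S.on_quadric]
  have hcl : p ∈ closure S.cone := mem_closure_of_tendsto hp
    (Eventually.of_forall fun n => by
      rw [← hy, ← one_smul ℝ (S.emb _)]; exact S.emb_mem_cone _ one_ne_zero)
  obtain ⟨c, y', hc, rfl⟩ := mem_cone_of_not_null hent hcl (by rw [hq]; norm_num)
  obtain ⟨x₀, hx₀⟩ := hT.nonempty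
  have hle : qform (c • S.emb y') x₀ ≤ 0 :=
    le_of_tendsto (tendsto_qform hp tendsto_const_nhds) (Eventually.of_forall fun n => by
      rw [← hy, qform_comm]; exact (hT.neg x₀ hx₀ _).le)
  have h1 := hT.neg x₀ hx₀ y'
  rw [qform_smul_left, qform_comm] at hle
  have hc0 : 0 ≤ c := by
    by_contra h; push Not at h; nlinarith
  have : c = 1 := by
    simp only [qform_smul_left, qform_smul_right, S.on_quadric] at hq
    nlinarith
  exact ⟨y', by simp [this]⟩

/-- A linear form positive on the asymptotic boundary is proper on the surface. -/
theorem IsTame.isCompact_sublevel (hT : S.IsTame L) (hent : S.IsEntire)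
    {M : (Fin 4 → ℝ) →ₗ[ℝ] ℝ} (hM : ∀ x ∈ posNull (closure S.cone) L, 0 < M x) (R : ℝ) :
    IsCompact (range S.emb ∩ {x | M x ≤ R}) := by
  have hMc : Continuous M := M.continuous_of_finiteDimensional
  refine Metric.isCompact_of_isClosed_isBounded
    ((hT.isClosed_range hent).inter (isClosed_le hMc continuous_const)) ?_
  by_contra hunb
  have h1 : ∀ n : ℕ, ∃ y, M (S.emb y) ≤ R ∧ (n : ℝ) + 1 < ‖S.emb y‖ := by
    intro n
    by_contra hcon
    push Not at hcon
    refine hunb ((Metric.isBounded_closedBall (x := (0 : Fin 4 → ℝ)) (r := n + 1)).subset ?_)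
    rintro _ ⟨⟨y, rfl⟩, hy⟩
    simpa using hcon y hy
  choose y hyM hyn using h1
  have hpos : ∀ n, 0 < ‖S.emb (y n)‖ := fun n => lt_trans (by positivity) (hyn n)
  have htop : Tendsto (fun n => ‖S.emb (y n)‖) atTop atTop :=
    tendsto_atTop_mono (fun n => (by linarith [hyn n] : (n : ℝ) ≤ _)) tendsto_natCast_atTop_atTop
  have hinv : Tendsto (fun n => ‖S.emb (y n)‖⁻¹) atTop (𝓝 0) := tendsto_inv_atTop_zero.comp htop
  obtain ⟨x, hx, φ, hφ, hlim⟩ := (isCompact_sphere (0 : Fin 4 → ℝ) 1).tendsto_subseq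
    (x := fun n => ‖S.emb (y n)‖⁻¹ • S.emb (y n)) (fun n => by
      simp [norm_smul, (hpos n).ne'])
  have hinv' := hinv.comp hφ.tendsto_atTop
  have hq : qform x x = 0 := by
    refine tendsto_nhds_unique (tendsto_qform hlim hlim) ?_
    have h2 : Tendsto (fun n => -(‖S.emb (y (φ n))‖⁻¹ * ‖S.emb (y (φ n))‖⁻¹)) atTop (𝓝 0) := by
      simpa using (hinv'.mul hinv').neg
    refine h2.congr fun n => ?_
    simp [S.on_quadric]
  have hx0 : x ≠ 0 := by rintro rfl; simp at hx
  have hmem := hT.mem_posNull_of_tendsto (y := fun n => y (φ n))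
    (fun n => inv_pos.2 (hpos (φ n))) hlim hx0 hq
  have h3 : M x ≤ 0 := by
    have hR : Tendsto (fun n => ‖S.emb (y (φ n))‖⁻¹ * R) atTop (𝓝 0) := by
      simpa using hinv'.mul_const R
    refine le_of_tendsto_of_tendsto ((hMc.tendsto x).comp hlim) hR (Eventually.of_forall fun n => ?_)
    simp only [Function.comp_apply, map_smul, smul_eq_mul]
    exact mul_le_mul_of_nonneg_left (hyM _) (inv_nonneg.2 (norm_nonneg _))
  linarith [hM x hmem]

theorem IsTame.exists_isMinOn (hT : S.IsTame L) (hent : S.IsEntire)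
    {M : (Fin 4 → ℝ) →ₗ[ℝ] ℝ} (hM : ∀ x ∈ posNull (closure S.cone) L, 0 < M x) :
    ∃ y, ∀ y', M (S.emb y) ≤ M (S.emb y') := by
  have hK := hT.isCompact_sublevel hent hM (M (S.emb 0))
  obtain ⟨_, ⟨⟨y, rfl⟩, hy⟩, hmin⟩ := hK.exists_isMinOn ⟨S.emb 0, mem_range_self _, le_refl (M (S.emb 0))⟩
    (f := fun x => M x) M.continuous_of_finiteDimensional.continuousOn
  refine ⟨y, fun y' => ?_⟩
  rcases le_total (M (S.emb y')) (M (S.emb 0)) with h | h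
  · exact hmin ⟨mem_range_self _, h⟩
  · exact le_trans hy h

end SpacelikeSurface

/-! ### Second derivative tests -/

theorem second_deriv_nonpos {f f' : ℝ → ℝ} {f'' : ℝ} (hf : ∀ t, HasDerivAt f (f' t) t)
    (hf' : HasDerivAt f' f'' 0) (hmax : IsLocalMax f 0) : f' 0 = 0 ∧ f'' ≤ 0 := by
  have h0 : f' 0 = 0 := hmax.hasDerivAt_eq_zero (hf 0)
  refine ⟨h0, ?_⟩
  by_contra hpos
  push Not at hpos
  have hd : deriv f = f' := funext fun t => (hf t).deriv
  have hmin : IsLocalMin f 0 := isLocalMin_of_deriv_deriv_pos (by rw [hd, hf'.deriv]; exact hpos)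
    (by rw [hd, h0]) (hf 0).continuousAt
  have hconst : f =ᶠ[𝓝 0] fun _ => f 0 := by
    filter_upwards [hmin, hmax] with t h1 h2 using le_antisymm h2 h1
  have h1 : f' =ᶠ[𝓝 0] fun _ => 0 := by
    have := hconst.deriv
    rw [hd] at this
    simpa using this
  have := h1.deriv_eq
  rw [hf'.deriv] at this
  simp at this
  linarith

theorem hasDerivAt_line {E : Type*} [NormedAddCommGroup E] [NormedSpace ℝ E] (v : Fin 2 → ℝ)
    {F : (Fin 2 → ℝ) → E} (hF : ContDiff ℝ (⊤ : ℕ∞) F) (t : ℝ) :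
    HasDerivAt (fun t : ℝ => F (t • v)) (dirD v F (t • v)) t := by
  have h1 : HasDerivAt (fun t : ℝ => t • v) v t := by
    simpa using (hasDerivAt_id t).smul_const v
  exact (differentiableAt_of_smooth hF (t • v)).hasFDerivAt.comp_hasDerivAt t h1

theorem dirD_nonpos_of_isLocalMax (v : Fin 2 → ℝ) {F : (Fin 2 → ℝ) → ℝ}
    (hF : ContDiff ℝ (⊤ : ℕ∞) F) (hmax : IsLocalMax F 0) :
    dirD v F 0 = 0 ∧ dirD v (dirD v F) 0 ≤ 0 := by
  have hc : Continuous fun t : ℝ => t • v := by fun_prop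
  have h : IsLocalMax (fun t : ℝ => F (t • v)) 0 := by
    have h2 : Tendsto (fun t : ℝ => t • v) (𝓝 0) (𝓝 0) := by
      simpa using hc.tendsto 0
    have := h2.eventually hmax
    simpa [IsLocalMax, IsMaxFilter] using this
  have h3 := second_deriv_nonpos (hasDerivAt_line v hF) (hasDerivAt_line v (contDiff_dirD v hF) 0) h
  simpa using h3

namespace SpacelikeSurface

/-! ### Normal charts -/

variable (S : SpacelikeSurface)

theorem qform_normal_dirD (y v w : Fin 2 → ℝ) :
    qform (dirD v (dirD w S.emb) y) (S.normal y) = -S.ff2 y v w := by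
  have hz : (fun x => qform (S.normal x) (dirD w S.emb x)) = fun _ => (0 : ℝ) :=
    funext fun x => S.normal_orth x w
  have := congrFun (dirD_qform v S.smooth_normal (contDiff_dirD w S.smooth_emb)) y
  rw [hz] at this
  have h0 : dirD v (fun _ => (0 : ℝ)) y = 0 := by simp [dirD]
  rw [h0] at this
  change _ = -qform (dirD v S.normal y) (dirD w S.emb y)
  rw [qform_comm]
  linarith

theorem qform_emb_dirD (y v w : Fin 2 → ℝ) :
    qform (dirD v (dirD w S.emb) y) (S.emb y) = -S.ff1 y v w := by
  have hz : (fun x => qform (dirD w S.emb x) (S.emb x)) = fun _ => (0 : ℝ) :=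
    funext fun x => S.emb_orth x w
  have := congrFun (dirD_qform v (contDiff_dirD w S.smooth_emb) S.smooth_emb) y
  rw [hz] at this
  have h0 : dirD v (fun _ => (0 : ℝ)) y = 0 := by simp [dirD]
  rw [h0] at this
  change _ = -qform (dirD v S.emb y) (dirD w S.emb y)
  rw [qform_comm (dirD v S.emb y)]
  linarith

/-- Coordinates in which the surface osculates, to second order, its normal coordinates. -/
structure IsNormalChart (y e₁ e₂ : Fin 2 → ℝ) (χ : (Fin 2 → ℝ) → Fin 2 → ℝ) : Prop where
  smooth : ContDiff ℝ (⊤ : ℕ∞) χ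
  map_zero : χ 0 = y
  d1 : fderiv ℝ χ 0 ![1, 0] = e₁
  d2 : fderiv ℝ χ 0 ![0, 1] = e₂
  d11 : dirD ![1, 0] (dirD ![1, 0] (fun z => S.emb (χ z))) 0 = S.emb y + S.ff2 y e₁ e₁ • S.normal y
  d12 : dirD ![1, 0] (dirD ![0, 1] (fun z => S.emb (χ z))) 0 = S.ff2 y e₁ e₂ • S.normal y
  d22 : dirD ![0, 1] (dirD ![0, 1] (fun z => S.emb (χ z))) 0 = S.emb y + S.ff2 y e₂ e₂ • S.normal y

theorem dirD_comp {E : Type*} [NormedAddCommGroup E] [NormedSpace ℝ E]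
    {F : (Fin 2 → ℝ) → E} (hF : ContDiff ℝ (⊤ : ℕ∞) F)
    {χ : (Fin 2 → ℝ) → Fin 2 → ℝ} (hχ : ContDiff ℝ (⊤ : ℕ∞) χ) (v z : Fin 2 → ℝ) :
    dirD v (fun z => F (χ z)) z = fderiv ℝ F (χ z) (fderiv ℝ χ z v) := by
  have := ((differentiableAt_of_smooth hF (χ z)).hasFDerivAt.comp z
    (differentiableAt_of_smooth hχ z).hasFDerivAt).fderiv
  exact congrArg (fun B => B v) this

theorem dirD_dirD_comp {E : Type*} [NormedAddCommGroup E] [NormedSpace ℝ E]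
    {F : (Fin 2 → ℝ) → E} (hF : ContDiff ℝ (⊤ : ℕ∞) F)
    {χ : (Fin 2 → ℝ) → Fin 2 → ℝ} (hχ : ContDiff ℝ (⊤ : ℕ∞) χ) (v w z : Fin 2 → ℝ) :
    dirD v (dirD w (fun z => F (χ z))) z =
      dirD (fderiv ℝ χ z v) (dirD (fderiv ℝ χ z w) F) (χ z) +
        fderiv ℝ F (χ z) (dirD v (dirD w χ) z) := by
  have e : dirD w (fun z => F (χ z)) = fun z => fderiv ℝ F (χ z) (dirD w χ z) :=
    funext fun z => dirD_comp hF hχ w z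
  rw [e]
  have hF' : ContDiff ℝ (⊤ : ℕ∞) (fderiv ℝ F) := hF.fderiv_right (m := (⊤ : ℕ∞)) (by norm_num)
  have h1 := (differentiableAt_of_smooth hF' (χ z)).hasFDerivAt.comp z
    (differentiableAt_of_smooth hχ z).hasFDerivAt
  have h2 := (differentiableAt_of_smooth (contDiff_dirD w hχ) z).hasFDerivAt
  have h3 := (h1.clm_apply h2).fderiv
  have h4 : dirD v (fun z => fderiv ℝ F (χ z) (dirD w χ z)) z = _ := congrArg (fun B => B v) h3
  rw [h4]
  have key : ∀ a b x, dirD a (dirD b F) x = fderiv ℝ (fderiv ℝ F) x a b := by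
    intro a b x
    have := ((differentiableAt_of_smooth hF' x).hasFDerivAt.clm_apply (hasFDerivAt_const b x)).fderiv
    change fderiv ℝ (fun y => fderiv ℝ F y b) x a = _
    rw [this]; simp
  rw [key]
  simp [dirD, add_comm]

theorem exists_isNormalChart (y : Fin 2 → ℝ) {e₁ e₂ : Fin 2 → ℝ} (h1 : S.ff1 y e₁ e₁ = 1)
    (h2 : S.ff1 y e₂ e₂ = 1) (h12 : S.ff1 y e₁ e₂ = 0) : ∃ χ, S.IsNormalChart y e₁ e₂ χ := by
  have hfr := S.isFrame y h1 h2 h12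
  set Γ : (Fin 2 → ℝ) → (Fin 2 → ℝ) → Fin 2 → ℝ := fun v w =>
    qform (dirD v (dirD w S.emb) y) (fderiv ℝ S.emb y e₁) • e₁ +
      qform (dirD v (dirD w S.emb) y) (fderiv ℝ S.emb y e₂) • e₂ with hΓ
  have hdec : ∀ v w, dirD v (dirD w S.emb) y =
      fderiv ℝ S.emb y (Γ v w) + S.ff1 y v w • S.emb y + S.ff2 y v w • S.normal y := by
    intro v w
    conv_lhs => rw [hfr.expand (dirD v (dirD w S.emb) y)]
    rw [qform_emb_dirD, qform_normal_dirD]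
    simp only [hΓ, map_add, map_smul]
    module
  set χ : (Fin 2 → ℝ) → Fin 2 → ℝ := fun z => y + (z 0 • e₁ + z 1 • e₂ -
    ((z 0 ^ 2 / 2) • Γ e₁ e₁ + (z 0 * z 1) • Γ e₁ e₂ + (z 1 ^ 2 / 2) • Γ e₂ e₂)) with hχ
  have hsm : ContDiff ℝ (⊤ : ℕ∞) χ := by
    have hp : ∀ i : Fin 2, ContDiff ℝ (⊤ : ℕ∞) fun z : Fin 2 → ℝ => z i := fun i => contDiff_apply ℝ ℝ i
    have h0 := hp 0
    have h1 := hp 1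
    refine contDiff_const.add (((h0.smul contDiff_const).add (h1.smul contDiff_const)).sub
      (((((h0.pow 2).div_const 2).smul contDiff_const).add
        ((h0.mul h1).smul contDiff_const)).add (((h1.pow 2).div_const 2).smul contDiff_const)))
  have hpr : ∀ (i : Fin 2) (z : Fin 2 → ℝ), HasFDerivAt (fun z : Fin 2 → ℝ => z i)
      (ContinuousLinearMap.proj (R := ℝ) (φ := fun _ : Fin 2 => ℝ) i) z := fun i z =>
    (ContinuousLinearMap.proj (R := ℝ) (φ := fun _ : Fin 2 => ℝ) i).hasFDerivAt
  have hd : ∀ v z, dirD v χ z = v 0 • e₁ + v 1 • e₂ - ((z 0 * v 0) • Γ e₁ e₁ +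
      (z 0 * v 1 + z 1 * v 0) • Γ e₁ e₂ + (z 1 * v 1) • Γ e₂ e₂) := by
    intro v z
    have h0 := hpr 0 z
    have h1 := hpr 1 z
    have := ((((h0.smul_const e₁).add (h1.smul_const e₂)).sub
      ((((h0.mul h0).const_mul (1 / 2)).smul_const (Γ e₁ e₁)).add
        ((h0.mul h1).smul_const (Γ e₁ e₂)) |>.add
        (((h1.mul h1).const_mul (1 / 2)).smul_const (Γ e₂ e₂)))).const_add y)
    have hχ' : χ = fun z => y + ((fun z : Fin 2 → ℝ => z 0 • e₁ + z 1 • e₂ -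
      ((1 / 2 * (z 0 * z 0)) • Γ e₁ e₁ + (z 0 * z 1) • Γ e₁ e₂ +
        (1 / 2 * (z 1 * z 1)) • Γ e₂ e₂)) z) := by
      funext z; rw [hχ]; simp only; ring_nf
    have h3 := this.congr_of_eventuallyEq (f₁ := χ) (Eventually.of_forall fun z => congrFun hχ' z)
    change fderiv ℝ χ z v = _
    rw [h3.fderiv]
    simp
    module
  have hdd : ∀ v w, dirD v (dirD w χ) 0 = -((v 0 * w 0) • Γ e₁ e₁ +
      (v 0 * w 1 + v 1 * w 0) • Γ e₁ e₂ + (v 1 * w 1) • Γ e₂ e₂) := by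
    intro v w
    have h0 := hpr 0 0
    have h1 := hpr 1 0
    have h00 := h0.mul_const (w 0)
    have h01 := (h0.mul_const (w 1)).add (h1.mul_const (w 0))
    have h11 := h1.mul_const (w 1)
    have := (((h00.smul_const (Γ e₁ e₁)).add (h01.smul_const (Γ e₁ e₂))).add
      (h11.smul_const (Γ e₂ e₂))).const_sub (w 0 • e₁ + w 1 • e₂)
    have e : dirD w χ = fun z => w 0 • e₁ + w 1 • e₂ - ((fun z : Fin 2 → ℝ => (z 0 * w 0) • Γ e₁ e₁ +
      (z 0 * w 1 + z 1 * w 0) • Γ e₁ e₂ + (z 1 * w 1) • Γ e₂ e₂) z) := funext fun z => hd w z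
    have h3 := this.congr_of_eventuallyEq (f₁ := dirD w χ) (Eventually.of_forall fun z => congrFun e z)
    change fderiv ℝ (dirD w χ) 0 v = _
    rw [h3.fderiv]
    simp
    module
  have hd1 : fderiv ℝ χ 0 ![1, 0] = e₁ := by
    have := hd ![1, 0] 0
    simpa [dirD] using this
  have hd2 : fderiv ℝ χ 0 ![0, 1] = e₂ := by
    have := hd ![0, 1] 0
    simpa [dirD] using this
  have h0 : χ 0 = y := by simp [hχ]
  refine ⟨χ, hsm, h0, hd1, hd2, ?_, ?_, ?_⟩
  · rw [dirD_dirD_comp S.smooth_emb hsm, hd1, h0, hdec, hdd, h1]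
    simp
    abel
  · rw [dirD_dirD_comp S.smooth_emb hsm, hd1, hd2, h0, hdec, hdd, h12]
    simp
  · rw [dirD_dirD_comp S.smooth_emb hsm, hd2, h0, hdec, hdd, h2]
    simp
    abel

variable {S} in
theorem IsNormalChart.emb_zero {y e₁ e₂ : Fin 2 → ℝ} {χ : (Fin 2 → ℝ) → Fin 2 → ℝ}
    (h : S.IsNormalChart y e₁ e₂ χ) :
    dirD ![1, 0] (fun z => S.emb (χ z)) 0 = fderiv ℝ S.emb y e₁ ∧
      dirD ![0, 1] (fun z => S.emb (χ z)) 0 = fderiv ℝ S.emb y e₂ := by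
  rw [dirD_comp S.smooth_emb h.smooth, dirD_comp S.smooth_emb h.smooth, h.d1, h.d2, h.map_zero]
  exact ⟨rfl, rfl⟩

variable {S} in
theorem ff2_add_eq_zero (hmax : S.IsMaximal) {y e₁ e₂ : Fin 2 → ℝ} (h1 : S.ff1 y e₁ e₁ = 1)
    (h2 : S.ff1 y e₂ e₂ = 1) (h12 : S.ff1 y e₁ e₂ = 0) :
    S.ff2 y e₁ e₁ + S.ff2 y e₂ e₂ = 0 := by
  have := trace_identity hmax y e₁ e₂
  rw [h1, h2, h12] at this
  linarith

end SpacelikeSurface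

theorem dirD_qform_const (v : Fin 2 → ℝ) (p : Fin 4 → ℝ) {G : (Fin 2 → ℝ) → Fin 4 → ℝ}
    (hG : ContDiff ℝ (⊤ : ℕ∞) G) :
    dirD v (fun z => qform p (G z)) = fun z => qform p (dirD v G z) := by
  rw [dirD_qform v (F := fun _ => p) contDiff_const hG]
  funext z
  simp [dirD]

/-- Orthonormal bases of two spacelike planes can be rotated to become close. -/
theorem exists_rotation_trace_ge {a₁₁ a₁₂ a₂₁ a₂₂ c₁ c₂ d₁ d₂ : ℝ}
    (h11 : a₁₁ ^ 2 + a₂₁ ^ 2 = 1 + c₁ ^ 2 + d₁ ^ 2) (h22 : a₁₂ ^ 2 + a₂₂ ^ 2 = 1 + c₂ ^ 2 + d₂ ^ 2)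
    (h12 : a₁₁ * a₁₂ + a₂₁ * a₂₂ = c₁ * c₂ + d₁ * d₂) :
    ∃ x y τ : ℝ, x ^ 2 + y ^ 2 = 1 ∧ τ ^ 2 = 1 ∧
      2 ≤ (x * a₁₁ + y * (τ * a₁₂)) + (-y * a₂₁ + x * (τ * a₂₂)) := by
  obtain ⟨τ, hτ, hdet⟩ : ∃ τ : ℝ, τ ^ 2 = 1 ∧ 1 ≤ τ * (a₁₁ * a₂₂ - a₁₂ * a₂₁) := by
    have hsq : 1 ≤ (a₁₁ * a₂₂ - a₁₂ * a₂₁) ^ 2 := by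
      have : (a₁₁ * a₂₂ - a₁₂ * a₂₁) ^ 2 = (a₁₁ ^ 2 + a₂₁ ^ 2) * (a₁₂ ^ 2 + a₂₂ ^ 2) -
          (a₁₁ * a₁₂ + a₂₁ * a₂₂) ^ 2 := by ring
      rw [this, h11, h22, h12]
      nlinarith [sq_nonneg (c₁ * d₂ - c₂ * d₁), sq_nonneg c₁, sq_nonneg c₂, sq_nonneg d₁,
        sq_nonneg d₂]
    rcases le_total 0 (a₁₁ * a₂₂ - a₁₂ * a₂₁) with h | h
    · exact ⟨1, by norm_num, by nlinarith⟩
    · exact ⟨-1, by norm_num, by nlinarith⟩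
  set P := a₁₁ + τ * a₂₂ with hP
  set Q := τ * a₁₂ - a₂₁ with hQ
  have h4 : 2 ^ 2 ≤ P ^ 2 + Q ^ 2 := by
    have : P ^ 2 + Q ^ 2 = (a₁₁ ^ 2 + a₂₁ ^ 2) + τ ^ 2 * (a₁₂ ^ 2 + a₂₂ ^ 2) +
      2 * (τ * (a₁₁ * a₂₂ - a₁₂ * a₂₁)) := by rw [hP, hQ]; ring
    rw [this, h11, h22, hτ]
    nlinarith [sq_nonneg c₁, sq_nonneg c₂, sq_nonneg d₁, sq_nonneg d₂]
  have hR : 2 ≤ √(P ^ 2 + Q ^ 2) := by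
    rw [← Real.sqrt_sq (show (0 : ℝ) ≤ 2 by norm_num)]
    exact Real.sqrt_le_sqrt h4
  have hR2 : √(P ^ 2 + Q ^ 2) ^ 2 = P ^ 2 + Q ^ 2 := Real.sq_sqrt (by positivity)
  have hR0 : √(P ^ 2 + Q ^ 2) ≠ 0 := by linarith
  refine ⟨P / √(P ^ 2 + Q ^ 2), Q / √(P ^ 2 + Q ^ 2), τ, ?_, hτ, ?_⟩
  · rw [div_pow, div_pow, hR2]
    have : P ^ 2 + Q ^ 2 ≠ 0 := by linarith
    field_simp
  · have : P / √(P ^ 2 + Q ^ 2) * a₁₁ + Q / √(P ^ 2 + Q ^ 2) * (τ * a₁₂) +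
        (-(Q / √(P ^ 2 + Q ^ 2)) * a₂₁ + P / √(P ^ 2 + Q ^ 2) * (τ * a₂₂)) =
        (P ^ 2 + Q ^ 2) / √(P ^ 2 + Q ^ 2) := by
      field_simp
      rw [hP, hQ]; ring
    rw [this, Real.div_sqrt]
    exact hR

namespace SpacelikeSurface

variable {S : SpacelikeSurface} {L : (Fin 4 → ℝ) →ₗ[ℝ] ℝ}

theorem IsTame.pos_neg_qlin (hT : S.IsTame L) (y₀ : Fin 2 → ℝ) :
    ∀ x ∈ posNull (closure S.cone) L, 0 < (-qlin (S.emb y₀)) x := by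
  intro x hx
  have := hT.neg x hx y₀
  rw [LinearMap.neg_apply, qlin_apply, qform_comm]
  linarith

theorem IsTame.qform_emb_nonpos (hT : S.IsTame L) (hent : S.IsEntire) (hmax : S.IsMaximal)
    (y₀ y : Fin 2 → ℝ) : qform (S.emb y₀) (S.emb y) ≤ 0 := by
  obtain ⟨y₁, hmin⟩ := hT.exists_isMinOn hent (hT.pos_neg_qlin y₀)
  simp only [LinearMap.neg_apply, qlin_apply] at hmin
  obtain ⟨e₁, e₂, h1, h2, h12⟩ := S.exists_orthonormal y₁
  obtain ⟨χ, hχ⟩ := S.exists_isNormalChart y₁ h1 h2 h12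
  have hs : ContDiff ℝ (⊤ : ℕ∞) fun z => S.emb (χ z) := S.smooth_emb.comp hχ.smooth
  have hF : ContDiff ℝ (⊤ : ℕ∞) fun z => qform (S.emb y₀) (S.emb (χ z)) :=
    contDiff_qform contDiff_const hs
  have hm : IsLocalMax (fun z => qform (S.emb y₀) (S.emb (χ z))) 0 :=
    Eventually.of_forall fun z => by
      have := hmin (χ z)
      simp only [hχ.map_zero]
      linarith
  have k1 := (dirD_nonpos_of_isLocalMax ![1, 0] hF hm).2
  have k2 := (dirD_nonpos_of_isLocalMax ![0, 1] hF hm).2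
  rw [dirD_qform_const _ _ hs, dirD_qform_const _ _ (contDiff_dirD _ hs)] at k1
  rw [dirD_qform_const _ _ hs, dirD_qform_const _ _ (contDiff_dirD _ hs)] at k2
  simp only [hχ.d11, hχ.d22] at k1 k2
  have ht := ff2_add_eq_zero hmax h1 h2 h12
  simp only [qform_add_right, qform_smul_right] at k1 k2
  have : qform (S.emb y₀) (S.emb y₁) ≤ 0 := by
    have e : S.ff2 y₁ e₂ e₂ = -S.ff2 y₁ e₁ e₁ := by linarith
    rw [e] at k2
    linarith
  linarith [hmin y]

theorem exists_close_frames (S : SpacelikeSurface) (y y' : Fin 2 → ℝ) :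
    ∃ e₁ e₂ e₁' e₂', S.ff1 y e₁ e₁ = 1 ∧ S.ff1 y e₂ e₂ = 1 ∧ S.ff1 y e₁ e₂ = 0 ∧
      S.ff1 y' e₁' e₁' = 1 ∧ S.ff1 y' e₂' e₂' = 1 ∧ S.ff1 y' e₁' e₂' = 0 ∧
      2 ≤ qform (fderiv ℝ S.emb y e₁) (fderiv ℝ S.emb y' e₁') +
        qform (fderiv ℝ S.emb y e₂) (fderiv ℝ S.emb y' e₂') := by
  obtain ⟨e₁, e₂, h1, h2, h12⟩ := S.exists_orthonormal y
  obtain ⟨f₁, f₂, k1, k2, k12⟩ := S.exists_orthonormal y'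
  have hfr := S.isFrame y h1 h2 h12
  have hfr' := S.isFrame y' k1 k2 k12
  have q11 := hfr.qform_expand (fderiv ℝ S.emb y' f₁) (fderiv ℝ S.emb y' f₁)
  have q22 := hfr.qform_expand (fderiv ℝ S.emb y' f₂) (fderiv ℝ S.emb y' f₂)
  have q12 := hfr.qform_expand (fderiv ℝ S.emb y' f₁) (fderiv ℝ S.emb y' f₂)
  rw [hfr'.aa] at q11
  rw [hfr'.bb] at q22
  rw [hfr'.ab] at q12
  obtain ⟨a, b, τ, hab, hτ, hge⟩ := exists_rotation_trace_ge
    (a₁₁ := qform (fderiv ℝ S.emb y' f₁) (fderiv ℝ S.emb y e₁))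
    (a₂₁ := qform (fderiv ℝ S.emb y' f₁) (fderiv ℝ S.emb y e₂))
    (a₁₂ := qform (fderiv ℝ S.emb y' f₂) (fderiv ℝ S.emb y e₁))
    (a₂₂ := qform (fderiv ℝ S.emb y' f₂) (fderiv ℝ S.emb y e₂))
    (c₁ := qform (fderiv ℝ S.emb y' f₁) (S.emb y)) (d₁ := qform (fderiv ℝ S.emb y' f₁) (S.normal y))
    (c₂ := qform (fderiv ℝ S.emb y' f₂) (S.emb y)) (d₂ := qform (fderiv ℝ S.emb y' f₂) (S.normal y))
    (by linarith) (by linarith) (by linarith)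
  refine ⟨e₁, e₂, a • f₁ + (b * τ) • f₂, (-b) • f₁ + (a * τ) • f₂, h1, h2, h12, ?_, ?_, ?_, ?_⟩
  · simp only [ff1_add_left, ff1_add_right, ff1_smul_left, ff1_smul_right, k1, k2, k12,
      S.ff1_comm y' f₂ f₁]
    linear_combination hab + b ^ 2 * hτ
  · simp only [ff1_add_left, ff1_add_right, ff1_smul_left, ff1_smul_right, k1, k2, k12,
      S.ff1_comm y' f₂ f₁]
    linear_combination hab + a ^ 2 * hτ
  · simp only [ff1_add_left, ff1_add_right, ff1_smul_left, ff1_smul_right, k1, k2, k12,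
      S.ff1_comm y' f₂ f₁]
    linear_combination a * b * hτ
  · have c := fun i j => qform_comm (fderiv ℝ S.emb y i) (fderiv ℝ S.emb y' j)
    simp only [map_add, map_smul, qform_add_right, qform_smul_right]
    rw [c e₁ f₁, c e₁ f₂, c e₂ f₁, c e₂ f₂]
    linarith

theorem hasDerivAt_linear_comp (M : (Fin 4 → ℝ) →ₗ[ℝ] ℝ) {a : ℝ → Fin 4 → ℝ} {a' : Fin 4 → ℝ} {t : ℝ}
    (h : HasDerivAt a a' t) : HasDerivAt (fun t => M (a t)) (M a') t :=
  (LinearMap.toContinuousLinearMap M).hasFDerivAt.comp_hasDerivAt t h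

/-- Second derivative test for the penalized product along a pair of curves. -/
theorem penalized_second_deriv (M : (Fin 4 → ℝ) →ₗ[ℝ] ℝ) {h : ℝ} (hh : 0 ≤ h)
    {a a' b b' : ℝ → Fin 4 → ℝ} {a'' b'' : Fin 4 → ℝ}
    (ha : ∀ t, HasDerivAt a (a' t) t) (ha' : HasDerivAt a' a'' 0)
    (hb : ∀ t, HasDerivAt b (b' t) t) (hb' : HasDerivAt b' b'' 0)
    (hMa : ∀ t, 0 ≤ M (a t)) (hMb : ∀ t, 0 ≤ M (b t))
    (hmax : IsLocalMax (fun t => qform (a t) (b t) - h * log (1 + M (a t)) - h * log (1 + M (b t))) 0) :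
    qform a'' (b 0) + 2 * qform (a' 0) (b' 0) + qform (a 0) b'' ≤
      h * (M a'' / (1 + M (a 0))) + h * (M b'' / (1 + M (b 0))) := by
  have hl : ∀ {a a' : ℝ → Fin 4 → ℝ}, (∀ t, HasDerivAt a (a' t) t) → (∀ t, 0 ≤ M (a t)) → ∀ t,
      HasDerivAt (fun t => log (1 + M (a t))) (M (a' t) / (1 + M (a t))) t := by
    intro a a' ha hMa t
    exact ((hasDerivAt_linear_comp M (ha t)).const_add 1).log (by linarith [hMa t])
  have hl' : ∀ {a a' : ℝ → Fin 4 → ℝ} {a'' : Fin 4 → ℝ}, (∀ t, HasDerivAt a (a' t) t) →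
      HasDerivAt a' a'' 0 → (∀ t, 0 ≤ M (a t)) →
      HasDerivAt (fun t => M (a' t) / (1 + M (a t)))
        ((M a'' * (1 + M (a 0)) - M (a' 0) * M (a' 0)) / (1 + M (a 0)) ^ 2) 0 := by
    intro a a' a'' ha ha' hMa
    exact (hasDerivAt_linear_comp M ha').div ((hasDerivAt_linear_comp M (ha 0)).const_add 1)
      (by linarith [hMa 0])
  have d1 : ∀ t, HasDerivAt
      (fun t => qform (a t) (b t) - h * log (1 + M (a t)) - h * log (1 + M (b t)))
      (qform (a' t) (b t) + qform (a t) (b' t) - h * (M (a' t) / (1 + M (a t)))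
        - h * (M (b' t) / (1 + M (b t)))) t := fun t =>
    ((hasDerivAt_qform (ha t) (hb t)).sub ((hl ha hMa t).const_mul h)).sub ((hl hb hMb t).const_mul h)
  have d2 := ((((hasDerivAt_qform ha' (hb 0)).add (hasDerivAt_qform (ha 0) hb')).sub
    ((hl' ha ha' hMa).const_mul h)).sub ((hl' hb hb' hMb).const_mul h))
  have key := (second_deriv_nonpos d1 d2 hmax).2
  have hq : ∀ {u v w : ℝ}, 0 ≤ w → (u * (1 + w) - v * v) / (1 + w) ^ 2 ≤ u / (1 + w) := by
    intro u v w hw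
    rw [div_le_div_iff₀ (by positivity) (by positivity)]
    nlinarith [mul_nonneg (mul_self_nonneg v) (show (0 : ℝ) ≤ 1 + w by linarith)]
  have k1 := mul_le_mul_of_nonneg_left (hq (u := M a'') (v := M (a' 0)) (hMa 0)) hh
  have k2 := mul_le_mul_of_nonneg_left (hq (u := M b'') (v := M (b' 0)) (hMb 0)) hh
  linarith

end SpacelikeSurface

namespace SpacelikeSurface

variable {S : SpacelikeSurface} {L : (Fin 4 → ℝ) →ₗ[ℝ] ℝ}

theorem IsTame.exists_max_penalized (hT : S.IsTame L) (hent : S.IsEntire) (hmax : S.IsMaximal)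
    (y₀ : Fin 2 → ℝ) {h : ℝ} (hh : 0 < h) : ∃ y₁ y₂, ∀ z₁ z₂,
      qform (S.emb z₁) (S.emb z₂) - h * log (1 + (-qlin (S.emb y₀)) (S.emb z₁)) -
        h * log (1 + (-qlin (S.emb y₀)) (S.emb z₂)) ≤
      qform (S.emb y₁) (S.emb y₂) - h * log (1 + (-qlin (S.emb y₀)) (S.emb y₁)) -
        h * log (1 + (-qlin (S.emb y₀)) (S.emb y₂)) := by
  set M := -qlin (S.emb y₀) with hMdef
  have hMp : ∀ z, 0 ≤ M (S.emb z) := fun z => by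
    have := hT.qform_emb_nonpos hent hmax y₀ z
    rw [hMdef, LinearMap.neg_apply, qlin_apply]
    linarith
  have hMc : Continuous M := M.continuous_of_finiteDimensional
  have hlog : ∀ z, 0 ≤ log (1 + M (S.emb z)) := fun z => log_nonneg (by linarith [hMp z])
  set Φ : (Fin 4 → ℝ) × (Fin 4 → ℝ) → ℝ := fun x =>
    qform x.1 x.2 - h * log (1 + M x.1) - h * log (1 + M x.2) with hΦ
  set c := Φ (S.emb y₀, S.emb y₀) with hc
  set R := max (M (S.emb y₀)) (exp (-c / h)) with hR
  set K := range S.emb ∩ {x | M x ≤ R} with hK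
  have hKc : IsCompact K := hT.isCompact_sublevel hent (hT.pos_neg_qlin y₀) R
  have hmem0 : S.emb y₀ ∈ K := ⟨mem_range_self _, le_max_left (M (S.emb y₀)) (exp (-c / h))⟩
  have hcont : ContinuousOn Φ (K ×ˢ K) := by
    have hne : ∀ x ∈ K, 1 + M x ≠ 0 := by
      rintro x ⟨⟨z, rfl⟩, -⟩
      linarith [hMp z]
    refine (ContinuousOn.sub (continuous_qform continuous_fst continuous_snd).continuousOn
      (continuousOn_const.mul (ContinuousOn.log ?_ fun x hx => hne _ hx.1))).sub
      (continuousOn_const.mul (ContinuousOn.log ?_ fun x hx => hne _ hx.2))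
    · exact (continuous_const.add (hMc.comp continuous_fst)).continuousOn
    · exact (continuous_const.add (hMc.comp continuous_snd)).continuousOn
  obtain ⟨⟨_, _⟩, ⟨⟨⟨y₁, rfl⟩, hy1⟩, ⟨⟨y₂, rfl⟩, hy2⟩⟩, hm⟩ :=
    (hKc.prod hKc).exists_isMaxOn ⟨(S.emb y₀, S.emb y₀), hmem0, hmem0⟩ hcont
  have hm0 : c ≤ Φ (S.emb y₁, S.emb y₂) := hm (Set.mk_mem_prod hmem0 hmem0)
  have hout : ∀ z, S.emb z ∉ K → -c ≤ h * log (1 + M (S.emb z)) := by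
    intro z hz
    have h1 : R < M (S.emb z) := by
      by_contra hle
      exact hz ⟨mem_range_self _, not_lt.1 hle⟩
    have h2 : exp (-c / h) ≤ 1 + M (S.emb z) := by
      linarith [le_max_right (M (S.emb y₀)) (exp (-c / h))]
    have h3 : -c / h ≤ log (1 + M (S.emb z)) :=
      (Real.le_log_iff_exp_le (by linarith [hMp z])).2 h2
    rw [div_le_iff₀ hh] at h3
    linarith
  refine ⟨y₁, y₂, fun z₁ z₂ => ?_⟩
  change Φ (S.emb z₁, S.emb z₂) ≤ Φ (S.emb y₁, S.emb y₂)
  have hk := hT.qform_emb_nonpos hent hmax z₁ z₂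
  have l1 := mul_nonneg hh.le (hlog z₁)
  have l2 := mul_nonneg hh.le (hlog z₂)
  have hΦz : Φ (S.emb z₁, S.emb z₂) = qform (S.emb z₁) (S.emb z₂) -
    h * log (1 + M (S.emb z₁)) - h * log (1 + M (S.emb z₂)) := rfl
  by_cases hz1 : S.emb z₁ ∈ K
  · by_cases hz2 : S.emb z₂ ∈ K
    · exact hm (Set.mk_mem_prod hz1 hz2)
    · linarith [hout z₂ hz2]
  · linarith [hout z₁ hz1]

theorem IsTame.qform_emb_le_of_max (hT : S.IsTame L) (hent : S.IsEntire) (hmax : S.IsMaximal)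
    (y₀ : Fin 2 → ℝ) {h : ℝ} (hh : 0 < h) {y₁ y₂ : Fin 2 → ℝ} (hm : ∀ z₁ z₂,
      qform (S.emb z₁) (S.emb z₂) - h * log (1 + (-qlin (S.emb y₀)) (S.emb z₁)) -
        h * log (1 + (-qlin (S.emb y₀)) (S.emb z₂)) ≤
      qform (S.emb y₁) (S.emb y₂) - h * log (1 + (-qlin (S.emb y₀)) (S.emb y₁)) -
        h * log (1 + (-qlin (S.emb y₀)) (S.emb y₂))) :
    qform (S.emb y₁) (S.emb y₂) ≤ -1 + h := by
  set M := -qlin (S.emb y₀) with hMdef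
  have hMp : ∀ z, 0 ≤ M (S.emb z) := fun z => by
    have := hT.qform_emb_nonpos hent hmax y₀ z
    rw [hMdef, LinearMap.neg_apply, qlin_apply]
    linarith
  obtain ⟨e₁, e₂, f₁, f₂, h1, h2, h12, k1, k2, k12, hge⟩ := S.exists_close_frames y₁ y₂
  obtain ⟨χ, hχ⟩ := S.exists_isNormalChart y₁ h1 h2 h12
  obtain ⟨ψ, hψ⟩ := S.exists_isNormalChart y₂ k1 k2 k12
  have hs : ContDiff ℝ (⊤ : ℕ∞) fun z => S.emb (χ z) := S.smooth_emb.comp hχ.smooth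
  have hs' : ContDiff ℝ (⊤ : ℕ∞) fun z => S.emb (ψ z) := S.smooth_emb.comp hψ.smooth
  have key := fun v : Fin 2 → ℝ => penalized_second_deriv M hh.le
    (hasDerivAt_line v hs) (hasDerivAt_line v (contDiff_dirD v hs) 0)
    (hasDerivAt_line v hs') (hasDerivAt_line v (contDiff_dirD v hs') 0)
    (fun t => hMp _) (fun t => hMp _) (Eventually.of_forall fun t => by
      simp only [zero_smul, hχ.map_zero, hψ.map_zero]
      exact hm _ _)
  have q1 := key ![1, 0]
  have q2 := key ![0, 1]
  simp only [zero_smul, hχ.map_zero, hψ.map_zero, hχ.d11, hψ.d11, hχ.d22, hψ.d22, hχ.emb_zero.1,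
    hχ.emb_zero.2, hψ.emb_zero.1, hψ.emb_zero.2, qform_add_left, qform_smul_left, qform_add_right,
    qform_smul_right, map_add, map_smul, smul_eq_mul] at q1 q2
  have ht := ff2_add_eq_zero hmax h1 h2 h12
  have ht' := ff2_add_eq_zero hmax k1 k2 k12
  have e : S.ff2 y₁ e₂ e₂ = -S.ff2 y₁ e₁ e₁ := by linarith
  have e' : S.ff2 y₂ f₂ f₂ = -S.ff2 y₂ f₁ f₁ := by linarith
  rw [e, e'] at q2
  have hq : ∀ {m : ℝ}, 0 ≤ m → m / (1 + m) ≤ 1 := fun {m} hm => by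
    rw [div_le_one (by linarith)]
    linarith
  have r1 := mul_le_mul_of_nonneg_left (hq (hMp y₁)) hh.le
  have r2 := mul_le_mul_of_nonneg_left (hq (hMp y₂)) hh.le
  simp only [add_div, neg_mul, neg_div] at q1 q2
  nlinarith

/-- Points of an entire maximal surface are never timelike related. -/
theorem IsTame.qform_emb_le (hT : S.IsTame L) (hent : S.IsEntire) (hmax : S.IsMaximal)
    (z₁ z₂ : Fin 2 → ℝ) : qform (S.emb z₁) (S.emb z₂) ≤ -1 := by
  set M := -qlin (S.emb z₁) with hMdef
  have hMp : ∀ z, 0 ≤ M (S.emb z) := fun z => by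
    have := hT.qform_emb_nonpos hent hmax z₁ z
    rw [hMdef, LinearMap.neg_apply, qlin_apply]
    linarith
  have hlog : ∀ z, 0 ≤ log (1 + M (S.emb z)) := fun z => log_nonneg (by linarith [hMp z])
  have hall : ∀ h : ℝ, 0 < h → qform (S.emb z₁) (S.emb z₂) ≤
      -1 + h * (1 + log (1 + M (S.emb z₁)) + log (1 + M (S.emb z₂))) := by
    intro h hh
    obtain ⟨y₁, y₂, hm⟩ := hT.exists_max_penalized hent hmax z₁ hh
    have := hT.qform_emb_le_of_max hent hmax z₁ hh hm
    have l1 := mul_nonneg hh.le (hlog y₁)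
    have l2 := mul_nonneg hh.le (hlog y₂)
    have := hm z₁ z₂
    rw [← hMdef] at this
    linarith
  have hlim : Tendsto (fun h : ℝ => -1 + h * (1 + log (1 + M (S.emb z₁)) + log (1 + M (S.emb z₂))))
      (𝓝[>] 0) (𝓝 (-1)) := by
    have : Continuous fun h : ℝ =>
      -1 + h * (1 + log (1 + M (S.emb z₁)) + log (1 + M (S.emb z₂))) := by fun_prop
    simpa using (this.tendsto 0).mono_left nhdsWithin_le_nhds
  exact ge_of_tendsto hlim (eventually_nhdsWithin_of_forall fun h hh => hall h hh)

end SpacelikeSurface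

namespace SpacelikeSurface

variable {S : SpacelikeSurface} {L : (Fin 4 → ℝ) →ₗ[ℝ] ℝ}

theorem IsTame.projXY_injective (hT : S.IsTame L) (hent : S.IsEntire) (hmax : S.IsMaximal) :
    Function.Injective fun y => projXY (S.emb y) := by
  intro y y' h
  have h0 : S.emb y 0 = S.emb y' 0 := congrFun h 0
  have h1 : S.emb y 1 = S.emb y' 1 := congrFun h 1
  have hk := hT.qform_emb_le hent hmax y y'
  have hq := S.on_quadric y
  have hq' := S.on_quadric y'
  unfold qform at hk hq hq'
  rw [h0, h1] at hk hq
  have hs : (S.emb y 2 - S.emb y' 2) ^ 2 + (S.emb y 3 - S.emb y' 3) ^ 2 ≤ 0 := by nlinarith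
  have h2 : S.emb y 2 = S.emb y' 2 := by
    have : (S.emb y 2 - S.emb y' 2) ^ 2 = 0 := by
      nlinarith [sq_nonneg (S.emb y 2 - S.emb y' 2), sq_nonneg (S.emb y 3 - S.emb y' 3)]
    linarith [pow_eq_zero_iff (two_ne_zero) |>.1 this]
  have h3 : S.emb y 3 = S.emb y' 3 := by
    have : (S.emb y 3 - S.emb y' 3) ^ 2 = 0 := by
      nlinarith [sq_nonneg (S.emb y 2 - S.emb y' 2), sq_nonneg (S.emb y 3 - S.emb y' 3)]
    linarith [pow_eq_zero_iff (two_ne_zero) |>.1 this]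
  apply S.inj
  ext i
  fin_cases i
  exacts [h0, h1, h2, h3]

theorem continuous_projXY_emb (S : SpacelikeSurface) : Continuous fun y => projXY (S.emb y) :=
  projXY.continuous.comp S.smooth_emb.continuous

theorem isOpenMap_projXY_emb (S : SpacelikeSurface) : IsOpenMap fun y => projXY (S.emb y) :=
  isOpenMap_iff_nhds_le.2 fun y => (map_nhds_projXY S.smooth_emb (S.spacelike y)).ge

theorem norm_emb_le (S : SpacelikeSurface) (y : Fin 2 → ℝ) :
    ‖S.emb y‖ ≤ 1 + 2 * ‖projXY (S.emb y)‖ := by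
  have hq := S.on_quadric y
  unfold qform at hq
  set r := ‖projXY (S.emb y)‖ with hr
  have hr0 : 0 ≤ r := norm_nonneg _
  have h0 : |S.emb y 0| ≤ r := norm_le_pi_norm (projXY (S.emb y)) 0
  have h1 : |S.emb y 1| ≤ r := norm_le_pi_norm (projXY (S.emb y)) 1
  have s0 : S.emb y 0 ^ 2 ≤ r ^ 2 := sq_le_sq' (by linarith [(abs_le.1 h0).1]) (abs_le.1 h0).2
  have s1 : S.emb y 1 ^ 2 ≤ r ^ 2 := sq_le_sq' (by linarith [(abs_le.1 h1).1]) (abs_le.1 h1).2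
  refine (pi_norm_le_iff_of_nonneg (by linarith)).2 fun i => ?_
  rw [Real.norm_eq_abs]
  have hb : ∀ a : ℝ, a ^ 2 ≤ 1 + 2 * r ^ 2 → |a| ≤ 1 + 2 * r := fun a ha =>
    abs_le_of_sq_le_sq (by nlinarith) (by linarith)
  fin_cases i
  · exact h0.trans (by linarith)
  · exact h1.trans (by linarith)
  · exact hb _ (by change S.emb y 2 ^ 2 ≤ _; nlinarith [sq_nonneg (S.emb y 3)])
  · exact hb _ (by change S.emb y 3 ^ 2 ≤ _; nlinarith [sq_nonneg (S.emb y 2)])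

theorem IsTame.projXY_surjective (hT : S.IsTame L) (hent : S.IsEntire) :
    Function.Surjective fun y => projXY (S.emb y) := by
  rw [← range_eq_univ]
  refine IsClopen.eq_univ ⟨?_, S.isOpenMap_projXY_emb.isOpen_range⟩ (range_nonempty _)
  refine isClosed_of_closure_subset fun u hu => ?_
  set K := range S.emb ∩ Metric.closedBall 0 (1 + 2 * (‖u‖ + 1)) with hK
  have hKc : IsCompact K := (isCompact_closedBall _ _).inter_left (hT.isClosed_range hent)
  have hKi : IsClosed (projXY '' K) := (hKc.image projXY.continuous).isClosed
  have hu' : u ∈ closure (projXY '' K) := by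
    rw [Metric.mem_closure_iff] at hu ⊢
    intro ε hε
    obtain ⟨_, ⟨y, rfl⟩, hy⟩ := hu (min ε 1) (lt_min hε one_pos)
    refine ⟨_, ⟨S.emb y, ⟨mem_range_self _, ?_⟩, rfl⟩, hy.trans_le (min_le_left _ _)⟩
    rw [mem_closedBall_zero_iff]
    refine (S.norm_emb_le y).trans ?_
    have h1 : dist u (projXY (S.emb y)) ≤ 1 := (hy.trans_le (min_le_right _ _)).le
    rw [dist_eq_norm] at h1
    have h2 := norm_sub_norm_le (projXY (S.emb y)) u
    rw [norm_sub_rev] at h2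
    linarith
  rw [hKi.closure_eq] at hu'
  obtain ⟨_, ⟨⟨y, rfl⟩, -⟩, rfl⟩ := hu'
  exact mem_range_self y

/-- An entire maximal surface is a graph over the plane of spacelike coordinates. -/
theorem IsTame.exists_homeomorph (hT : S.IsTame L) (hent : S.IsEntire) (hmax : S.IsMaximal) :
    ∃ Q : (Fin 2 → ℝ) ≃ₜ (Fin 2 → ℝ), ∀ y, Q y = projXY (S.emb y) :=
  ⟨(Equiv.ofBijective _ ⟨hT.projXY_injective hent hmax, hT.projXY_surjective hent⟩).toHomeomorphOfContinuousOpen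
    S.continuous_projXY_emb S.isOpenMap_projXY_emb, fun _ => rfl⟩

theorem IsTame.isClosedEmbedding_emb (hT : S.IsTame L) (hent : S.IsEntire) (hmax : S.IsMaximal) :
    IsClosedEmbedding S.emb := by
  have h1 : IsEmbedding (projXY ∘ S.emb) :=
    (IsOpenEmbedding.of_continuous_injective_isOpenMap S.continuous_projXY_emb
      (hT.projXY_injective hent hmax) S.isOpenMap_projXY_emb).isEmbedding
  exact ⟨IsEmbedding.of_comp S.smooth_emb.continuous projXY.continuous h1, hT.isClosed_range hent⟩

theorem IsTame.isCompact_param_sublevel (hT : S.IsTame L) (hent : S.IsEntire) (hmax : S.IsMaximal)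
    (y₀ : Fin 2 → ℝ) (c : ℝ) : IsCompact {y | -qform (S.emb y₀) (S.emb y) ≤ c} := by
  have h := (hT.isClosedEmbedding_emb hent hmax).isCompact_preimage
    (hT.isCompact_sublevel hent (hT.pos_neg_qlin y₀) c)
  convert h using 1
  ext y
  simp [qlin_apply]

end SpacelikeSurface

theorem eventually_lt_of_deriv_pos {φ : ℝ → ℝ} {d : ℝ} (h : HasDerivAt φ d 0) (hd : 0 < d) :
    ∀ᶠ t in 𝓝[>] (0 : ℝ), φ 0 < φ t := by
  have h1 := (hasDerivWithinAt_iff_tendsto_slope' (s := Ioi (0 : ℝ)) (by simp)).1 h.hasDerivWithinAt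
  filter_upwards [h1.eventually (lt_mem_nhds hd), self_mem_nhdsWithin] with t ht ht0
  have ht0 : 0 < t := ht0
  rw [slope_def_field, sub_zero, div_pos_iff_of_pos_right ht0] at ht
  linarith

namespace SpacelikeSurface

variable {S : SpacelikeSurface} {L : (Fin 4 → ℝ) →ₗ[ℝ] ℝ}

/-- The tangential part of a vector. -/
theorem exists_tangential (S : SpacelikeSurface) (y : Fin 2 → ℝ) (p : Fin 4 → ℝ) :
    ∃ w, p = fderiv ℝ S.emb y w - qform p (S.emb y) • S.emb y - qform p (S.normal y) • S.normal y := by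
  obtain ⟨e₁, e₂, h1, h2, h12⟩ := S.exists_orthonormal y
  have h := (S.isFrame y h1 h2 h12).expand p
  refine ⟨qform p (fderiv ℝ S.emb y e₁) • e₁ + qform p (fderiv ℝ S.emb y e₂) • e₂, ?_⟩
  simp only [map_add, map_smul]
  exact h

/-- First order comparison: if the second fundamental form is dominated by the derivative of `β`,
then the normal component of a point of the surface is dominated by `β`. -/
theorem IsTame.abs_qform_normal_le (hT : S.IsTame L) (hent : S.IsEntire) (hmax : S.IsMaximal)
    (y₀ : Fin 2 → ℝ) {c : ℝ} {β β' : ℝ → ℝ} {μ : (Fin 2 → ℝ) → ℝ}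
    (hβ : ∀ y, -qform (S.emb y₀) (S.emb y) ≤ c →
      HasDerivAt β (β' (-qform (S.emb y₀) (S.emb y))) (-qform (S.emb y₀) (S.emb y)))
    (hβ0 : ∀ y, -qform (S.emb y₀) (S.emb y) ≤ c → 0 ≤ β (-qform (S.emb y₀) (S.emb y)))
    (hμ : ∀ y, -qform (S.emb y₀) (S.emb y) ≤ c → ∀ w, |S.ff2 y w w| ≤ μ y * S.ff1 y w w)
    (hlt : ∀ y, -qform (S.emb y₀) (S.emb y) ≤ c → μ y < β' (-qform (S.emb y₀) (S.emb y)))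
    {y : Fin 2 → ℝ} (hy : -qform (S.emb y₀) (S.emb y) ≤ c) :
    |qform (S.emb y₀) (S.normal y)| ≤ β (-qform (S.emb y₀) (S.emb y)) := by
  set f : (Fin 2 → ℝ) → ℝ := fun y => -qform (S.emb y₀) (S.emb y) with hf
  have hK : IsCompact {y | f y ≤ c} := hT.isCompact_param_sublevel hent hmax y₀ c
  have hfc : Continuous f := (continuous_qform continuous_const S.smooth_emb.continuous).neg
  suffices H : ∀ τ : ℝ, τ ^ 2 = 1 → τ * qform (S.emb y₀) (S.normal y) ≤ β (f y) by
    rw [abs_le]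
    have h1 := H 1 (by norm_num)
    have h2 := H (-1) (by norm_num)
    constructor <;> linarith
  intro τ hτ
  have hcont : ContinuousOn (fun y => τ * qform (S.emb y₀) (S.normal y) - β (f y)) {y | f y ≤ c} := by
    refine ContinuousOn.sub ?_ fun z hz => ?_
    · exact (continuous_const.mul
        (continuous_qform continuous_const S.smooth_normal.continuous)).continuousOn
    · exact ((hβ z hz).continuousAt.comp (f := f) hfc.continuousAt).continuousWithinAt
  obtain ⟨y₁, hy1, hm⟩ := hK.exists_isMaxOn ⟨y, hy⟩ hcont
  have hy1 : f y₁ ≤ c := hy1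
  have hm : ∀ z, f z ≤ c → τ * qform (S.emb y₀) (S.normal z) - β (f z) ≤
    τ * qform (S.emb y₀) (S.normal y₁) - β (f y₁) := fun z hz => hm hz
  by_contra hpos
  have hg : 0 < τ * qform (S.emb y₀) (S.normal y₁) - β (f y₁) := by linarith [hm y hy]
  obtain ⟨w, hw⟩ := S.exists_tangential y₁ (S.emb y₀)
  have hpw : qform (S.emb y₀) (fderiv ℝ S.emb y₁ w) = S.ff1 y₁ w w := by
    conv_lhs => rw [hw]
    simp only [qform_sub_left, qform_smul_left, qform_comm (S.emb y₁), S.emb_orth, S.normal_orth, ff1]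
    ring
  have hpn : qform (S.emb y₀) (fderiv ℝ S.normal y₁ w) = S.ff2 y₁ w w := by
    conv_lhs => rw [hw]
    rw [S.shape_spec]
    simp only [qform_sub_left, qform_smul_left, qform_comm (S.emb y₁), S.emb_orth, S.normal_orth]
    rw [ff2, S.shape_spec, qform_comm]
    ring
  have hI : S.ff1 y₁ w w = f y₁ ^ 2 + qform (S.emb y₀) (S.normal y₁) ^ 2 - 1 := by
    have hq := S.on_quadric y₀
    have h2 : qform (S.emb y₀) (S.emb y₀) = qform (S.emb y₀) (fderiv ℝ S.emb y₁ w -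
      qform (S.emb y₀) (S.emb y₁) • S.emb y₁ - qform (S.emb y₀) (S.normal y₁) • S.normal y₁) := by
      rw [← hw]
    simp only [qform_sub_right, qform_smul_right] at h2
    rw [hpw, hq] at h2
    simp only [hf]
    linarith
  have hI0 : 0 < S.ff1 y₁ w w := by
    rw [hI]
    have h1 : 1 ≤ f y₁ := by
      have := hT.qform_emb_le hent hmax y₀ y₁
      simp only [hf]; linarith
    have h2 : 0 < τ * qform (S.emb y₀) (S.normal y₁) := by linarith [hβ0 y₁ hy1]
    have h3 : 0 < qform (S.emb y₀) (S.normal y₁) ^ 2 := by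
      have : 0 < (τ * qform (S.emb y₀) (S.normal y₁)) ^ 2 := by positivity
      rwa [mul_pow, hτ, one_mul] at this
    nlinarith
  have hline : HasDerivAt (fun t : ℝ => y₁ + t • w) w 0 := by
    simpa using ((hasDerivAt_id (0 : ℝ)).smul_const w).const_add y₁
  have h0 : y₁ + (0 : ℝ) • w = y₁ := by simp
  have hds : HasDerivAt (fun t : ℝ => S.emb (y₁ + t • w)) (fderiv ℝ S.emb y₁ w) 0 := by
    have := (S.diff_emb (y₁ + (0 : ℝ) • w)).hasFDerivAt.comp_hasDerivAt (0 : ℝ) hline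
    rwa [h0] at this
  have hdn : HasDerivAt (fun t : ℝ => S.normal (y₁ + t • w)) (fderiv ℝ S.normal y₁ w) 0 := by
    have := (S.diff_normal (y₁ + (0 : ℝ) • w)).hasFDerivAt.comp_hasDerivAt (0 : ℝ) hline
    rwa [h0] at this
  have hdf : HasDerivAt (fun t : ℝ => f (y₁ + t • w)) (-S.ff1 y₁ w w) 0 := by
    have := (hasDerivAt_qform (hasDerivAt_const (0 : ℝ) (S.emb y₀)) hds).neg
    simp only [qform_zero_left, zero_add, hpw] at this
    exact this
  have hdv : HasDerivAt (fun t : ℝ => qform (S.emb y₀) (S.normal (y₁ + t • w))) (S.ff2 y₁ w w) 0 := by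
    have := hasDerivAt_qform (hasDerivAt_const (0 : ℝ) (S.emb y₀)) hdn
    simpa [hpn] using this
  have hdb : HasDerivAt (fun t : ℝ => β (f (y₁ + t • w))) (β' (f y₁) * -S.ff1 y₁ w w) 0 := by
    have hb : HasDerivAt β (β' (f y₁)) (f (y₁ + (0 : ℝ) • w)) := by
      rw [h0]; exact hβ y₁ hy1
    exact hb.comp (0 : ℝ) hdf
  have hd := (hdv.const_mul τ).sub hdb
  have hdpos : 0 < τ * S.ff2 y₁ w w - β' (f y₁) * -S.ff1 y₁ w w := by
    have h1 := abs_le.1 (hμ y₁ hy1 w)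
    have h2 := mul_lt_mul_of_pos_right (hlt y₁ hy1) hI0
    have h3 : -(μ y₁ * S.ff1 y₁ w w) ≤ τ * S.ff2 y₁ w w := by
      rcases (sq_eq_sq_iff_eq_or_eq_neg.1 (hτ.trans (one_pow 2).symm)) with h | h <;> rw [h] <;> linarith
    linarith
  have E1 := eventually_lt_of_deriv_pos hd hdpos
  have E2 := eventually_lt_of_deriv_pos hdf.neg (by linarith : 0 < -(-S.ff1 y₁ w w))
  obtain ⟨t, ht1, ht2⟩ := (E1.and E2).exists
  simp only [Pi.sub_apply, Pi.neg_apply, h0] at ht1 ht2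
  have := hm (y₁ + t • w) (by linarith)
  linarith

/-- A bound on the principal curvatures bounds the normal component of points of the surface. -/
theorem IsTame.abs_qform_normal_le_of_lambda (hT : S.IsTame L) (hent : S.IsEntire)
    (hmax : S.IsMaximal) {l : ℝ} (hl0 : 0 ≤ l) (hl : ∀ y, S.lambdaAt y ≤ l) (y₀ y : Fin 2 → ℝ) :
    |qform (S.emb y₀) (S.normal y)| ≤ l * -qform (S.emb y₀) (S.emb y) := by
  have hk := hT.qform_emb_le hent hmax y₀
  have key : ∀ ε : ℝ, 0 < ε → |qform (S.emb y₀) (S.normal y)| ≤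
      (l + ε) * -qform (S.emb y₀) (S.emb y) := by
    intro ε hε
    refine hT.abs_qform_normal_le hent hmax y₀ (c := -qform (S.emb y₀) (S.emb y))
      (β := fun x => (l + ε) * x) (β' := fun _ => l + ε) (μ := fun _ => l) ?_ ?_ ?_ ?_ le_rfl
    · intro z _
      simpa using (hasDerivAt_id (-qform (S.emb y₀) (S.emb z))).const_mul (l + ε)
    · intro z _
      have := hk z
      exact mul_nonneg (by linarith) (by linarith)
    · intro z _ w
      exact (abs_ff2_le hmax z w).trans
        (mul_le_mul_of_nonneg_right (hl z) (S.ff1_nonneg z w))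
    · intro z _
      linarith
  have hlim : Tendsto (fun ε : ℝ => (l + ε) * -qform (S.emb y₀) (S.emb y)) (𝓝[>] 0)
      (𝓝 (l * -qform (S.emb y₀) (S.emb y))) := by
    have : Continuous fun ε : ℝ => (l + ε) * -qform (S.emb y₀) (S.emb y) := by fun_prop
    simpa using (this.tendsto 0).mono_left nhdsWithin_le_nhds
  exact ge_of_tendsto hlim (eventually_nhdsWithin_of_forall fun ε hε => key ε hε)

end SpacelikeSurface

theorem dirD_dirD_qform (v w z : Fin 2 → ℝ) {F G : (Fin 2 → ℝ) → Fin 4 → ℝ}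
    (hF : ContDiff ℝ (⊤ : ℕ∞) F) (hG : ContDiff ℝ (⊤ : ℕ∞) G) :
    dirD v (dirD w (fun x => qform (F x) (G x))) z =
      qform (dirD v (dirD w F) z) (G z) + qform (dirD w F z) (dirD v G z) +
        qform (dirD v F z) (dirD w G z) + qform (F z) (dirD v (dirD w G) z) := by
  rw [dirD_qform w hF hG, dirD_add v (contDiff_qform (contDiff_dirD w hF) hG)
    (contDiff_qform hF (contDiff_dirD w hG)), dirD_qform v (contDiff_dirD w hF) hG,
    dirD_qform v hF (contDiff_dirD w hG)]
  ring

theorem dirD_dirD_mul (v z : Fin 2 → ℝ) {f g : (Fin 2 → ℝ) → ℝ}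
    (hf : ContDiff ℝ (⊤ : ℕ∞) f) (hg : ContDiff ℝ (⊤ : ℕ∞) g) :
    dirD v (dirD v (fun x => f x * g x)) z =
      dirD v (dirD v f) z * g z + 2 * (dirD v f z * dirD v g z) + f z * dirD v (dirD v g) z := by
  rw [dirD_mul v hf hg, dirD_add v ((contDiff_dirD v hf).mul hg) (hf.mul (contDiff_dirD v hg)),
    dirD_mul v (contDiff_dirD v hf) hg, dirD_mul v hf (contDiff_dirD v hg)]
  ring

/-- Simons' identity at the centre of a normal chart diagonalizing the second fundamental form. -/
theorem simons_identity {s n : (Fin 2 → ℝ) → Fin 4 → ℝ} {u v : Fin 2 → ℝ} {l : ℝ}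
    (hs : ContDiff ℝ (⊤ : ℕ∞) s) (hn : ContDiff ℝ (⊤ : ℕ∞) n)
    (hnu_s : ∀ z, qform (dirD u n z) (s z) = 0) (hnv_s : ∀ z, qform (dirD v n z) (s z) = 0)
    (hnu_n : ∀ z, qform (dirD u n z) (n z) = 0) (hnv_n : ∀ z, qform (dirD v n z) (n z) = 0)
    (hsymm : ∀ z, qform (dirD u n z) (dirD v s z) = qform (dirD v n z) (dirD u s z))
    (htrace : ∀ z, qform (dirD v s z) (dirD v s z) * qform (dirD u n z) (dirD u s z) +
      (-2) * (qform (dirD u s z) (dirD v s z) * qform (dirD u n z) (dirD v s z)) +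
      qform (dirD u s z) (dirD u s z) * qform (dirD v n z) (dirD v s z) = 0)
    (hnu : dirD u n 0 = l • dirD u s 0) (hnv : dirD v n 0 = -l • dirD v s 0)
    (huu : dirD u (dirD u s) 0 = s 0 + l • n 0) (huv : dirD u (dirD v s) 0 = 0)
    (hvv : dirD v (dirD v s) 0 = s 0 + -l • n 0)
    (g11 : qform (dirD u s 0) (dirD u s 0) = 1) (g22 : qform (dirD v s 0) (dirD v s 0) = 1)
    (g12 : qform (dirD u s 0) (dirD v s 0) = 0)
    (hus : qform (dirD u s 0) (s 0) = 0) (hvs : qform (dirD v s 0) (s 0) = 0)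
    (hun : qform (dirD u s 0) (n 0) = 0) (hvn : qform (dirD v s 0) (n 0) = 0) :
    dirD u (dirD u (fun z => qform (dirD u n z) (dirD u s z))) 0 +
      dirD v (dirD v (fun z => qform (dirD u n z) (dirD u s z))) 0 -
      l * (dirD u (dirD u (fun z => qform (dirD u s z) (dirD u s z))) 0 +
        dirD v (dirD v (fun z => qform (dirD u s z) (dirD u s z))) 0) = 2 * l ^ 3 - 2 * l := by
  have su := contDiff_dirD u hs
  have sv := contDiff_dirD v hs
  have nu := contDiff_dirD u hn
  have nv := contDiff_dirD v hn
  have cs : dirD v (dirD u s) = dirD u (dirD v s) := dirD_comm v u hs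
  have cn : dirD v (dirD u n) = dirD u (dirD v n) := dirD_comm v u hn
  have z0 : ∀ w : Fin 2 → ℝ, dirD w (fun _ => (0 : ℝ)) = fun _ => 0 := fun w => by
    funext x; simp [dirD]
  -- first order consequences
  have a1 := congrFun (dirD_qform u nu hs) 0
  rw [show (fun z => qform (dirD u n z) (s z)) = fun _ => 0 from funext hnu_s, z0] at a1
  have a2 := congrFun (dirD_qform u nu hn) 0
  rw [show (fun z => qform (dirD u n z) (n z)) = fun _ => 0 from funext hnu_n, z0] at a2
  have a3 := congrFun (dirD_qform v nv hs) 0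
  rw [show (fun z => qform (dirD v n z) (s z)) = fun _ => 0 from funext hnv_s, z0] at a3
  have a4 := congrFun (dirD_qform v nv hn) 0
  rw [show (fun z => qform (dirD v n z) (n z)) = fun _ => 0 from funext hnv_n, z0] at a4
  simp only [hnu, hnv, qform_smul_left, qform_smul_right, g11, g22] at a1 a2 a3 a4
  -- the differentiated symmetry of the second fundamental form
  have b := dirD_dirD_qform u v 0 nu sv
  rw [show (fun z => qform (dirD u n z) (dirD v s z)) = fun z => qform (dirD v n z) (dirD u s z)
    from funext hsymm, dirD_dirD_qform u v 0 nv su] at b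
  -- the differentiated trace identity
  have t := congrFun (congrArg (fun F => dirD u (dirD u F)) (funext htrace)) 0
  have ct1 : ContDiff ℝ (⊤ : ℕ∞) fun z => qform (dirD v s z) (dirD v s z) := contDiff_qform sv sv
  have ct2 : ContDiff ℝ (⊤ : ℕ∞) fun z => qform (dirD u n z) (dirD u s z) := contDiff_qform nu su
  have ct3 : ContDiff ℝ (⊤ : ℕ∞) fun z => qform (dirD u s z) (dirD v s z) := contDiff_qform su sv
  have ct4 : ContDiff ℝ (⊤ : ℕ∞) fun z => qform (dirD u n z) (dirD v s z) := contDiff_qform nu sv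
  have ct5 : ContDiff ℝ (⊤ : ℕ∞) fun z => qform (dirD u s z) (dirD u s z) := contDiff_qform su su
  have ct6 : ContDiff ℝ (⊤ : ℕ∞) fun z => qform (dirD v n z) (dirD v s z) := contDiff_qform nv sv
  have c34 := ct3.mul ct4
  have hadd : ∀ {f g : (Fin 2 → ℝ) → ℝ}, ContDiff ℝ (⊤ : ℕ∞) f → ContDiff ℝ (⊤ : ℕ∞) g →
      dirD u (dirD u (fun z => f z + g z)) 0 = dirD u (dirD u f) 0 + dirD u (dirD u g) 0 := by
    intro f g hf hg
    rw [dirD_add u hf hg, dirD_add u (contDiff_dirD u hf) (contDiff_dirD u hg)]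
  simp only [z0] at t
  rw [hadd ((ct1.mul ct2).add (contDiff_const.mul c34)) (ct5.mul ct6),
    hadd (ct1.mul ct2) (contDiff_const.mul c34), dirD_const_mul u (-2) c34,
    dirD_const_mul u (-2) (contDiff_dirD u c34)] at t
  beta_reduce at t
  rw [dirD_dirD_mul u 0 ct1 ct2, dirD_dirD_mul u 0 ct3 ct4, dirD_dirD_mul u 0 ct5 ct6] at t
  have d1 : dirD u (fun z => qform (dirD v s z) (dirD v s z)) 0 = 0 := by
    rw [dirD_qform u sv sv]
    simp [huv]
  have d2 : dirD u (fun z => qform (dirD u s z) (dirD v s z)) 0 = 0 := by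
    rw [dirD_qform u su sv]
    simp [huv, huu, qform_comm (s 0), qform_comm (n 0), hvs, hvn]
  have d3 : dirD u (fun z => qform (dirD u s z) (dirD u s z)) 0 = 0 := by
    rw [dirD_qform u su su]
    simp [huu, qform_comm (s 0), qform_comm (n 0), hus, hun]
  rw [d1, d2, d3, g11, g12, g22, hnu, hnv] at t
  simp only [qform_smul_left, g11, g12, g22] at t
  have e1 := dirD_dirD_qform v v 0 nu su
  have e2 := dirD_dirD_qform v v 0 su su
  have e3 := dirD_dirD_qform u u 0 nv sv
  have e4 := dirD_dirD_qform u u 0 sv sv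
  have cs' : dirD v (dirD u (dirD v s)) = dirD u (dirD v (dirD v s)) := dirD_comm v u sv
  have cn' : dirD v (dirD u (dirD v n)) = dirD u (dirD v (dirD v n)) := dirD_comm v u nv
  simp only [cs, cn, cs', cn'] at b e1 e2
  simp only [hnu, hnv, huu, huv, hvv, qform_add_right, qform_smul_left, qform_smul_right,
    qform_zero_right] at b e1 e2 e3 e4
  rw [qform_comm (dirD v s 0)] at b e3 e4
  rw [qform_comm (dirD u s 0)] at b e1 e2
  rw [e1, e2]
  rw [e3, e4] at t
  linear_combination t + b - a1 + a3 + l * a4 + l * a2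

theorem weighted_second_deriv {h h' g g' ζ ζ' : ℝ → ℝ} {h'' g'' ζ'' m : ℝ}
    (dh : ∀ t, HasDerivAt h (h' t) t) (dh' : HasDerivAt h' h'' 0)
    (dg : ∀ t, HasDerivAt g (g' t) t) (dg' : HasDerivAt g' g'' 0)
    (dζ : ∀ t, HasDerivAt ζ (ζ' t) t) (dζ' : HasDerivAt ζ' ζ'' 0)
    (hg0 : g' 0 = 0) (hζ : 0 < ζ 0) (hm : h 0 * ζ 0 ^ 10 = m)
    (hmax : IsLocalMax (fun t => h t * ζ t ^ 10 - m * g t) 0) :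
    ζ 0 ^ 2 * (h'' - h 0 * g'') + 10 * (h 0 * (ζ 0 * ζ'')) ≤ 110 * (h 0 * ζ' 0 ^ 2) := by
  have d1 : ∀ t, HasDerivAt (fun t => h t * ζ t ^ 10 - m * g t)
      (h' t * ζ t ^ 10 + h t * (10 * ζ t ^ 9 * ζ' t) - m * g' t) t := fun t => by
    exact (((dh t).mul ((dζ t).pow 10)).sub ((dg t).const_mul m)).congr_deriv (by simp)
  have d9 : HasDerivAt (fun t => 10 * ζ t ^ 9 * ζ' t)
      (10 * (9 * ζ 0 ^ 8 * ζ' 0) * ζ' 0 + 10 * ζ 0 ^ 9 * ζ'') 0 := by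
    exact ((((dζ 0).pow 9).const_mul 10).mul dζ').congr_deriv (by simp)
  have d2 : HasDerivAt (fun t => h' t * ζ t ^ 10 + h t * (10 * ζ t ^ 9 * ζ' t) - m * g' t)
      (h'' * ζ 0 ^ 10 + h' 0 * (10 * ζ 0 ^ 9 * ζ' 0) + (h' 0 * (10 * ζ 0 ^ 9 * ζ' 0) +
        h 0 * (10 * (9 * ζ 0 ^ 8 * ζ' 0) * ζ' 0 + 10 * ζ 0 ^ 9 * ζ'')) - m * g'') 0 := by
    exact (((dh'.mul ((dζ 0).pow 10)).add ((dh 0).mul d9)).sub (dg'.const_mul m)).congr_deriv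
      (by simp)
  obtain ⟨k1, k2⟩ := second_deriv_nonpos d1 d2 hmax
  rw [hg0] at k1
  subst hm
  have k3 : ζ 0 * h' 0 = -10 * (h 0 * ζ' 0) := by
    have h9 : ζ 0 ^ 9 ≠ 0 := by positivity
    apply mul_left_cancel₀ h9
    linear_combination k1
  have h8 : 0 < ζ 0 ^ 8 := by positivity
  have k4 : ζ 0 ^ 8 * (ζ 0 ^ 2 * (h'' - h 0 * g'') + 10 * (h 0 * (ζ 0 * ζ''))
      - 110 * (h 0 * ζ' 0 ^ 2)) ≤ 0 := by
    have : ζ 0 ^ 8 * (ζ 0 ^ 2 * (h'' - h 0 * g'') + 10 * (h 0 * (ζ 0 * ζ''))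
      - 110 * (h 0 * ζ' 0 ^ 2)) = h'' * ζ 0 ^ 10 + h' 0 * (10 * ζ 0 ^ 9 * ζ' 0) +
        (h' 0 * (10 * ζ 0 ^ 9 * ζ' 0) +
        h 0 * (10 * (9 * ζ 0 ^ 8 * ζ' 0) * ζ' 0 + 10 * ζ 0 ^ 9 * ζ'')) -
        h 0 * ζ 0 ^ 10 * g'' := by
      linear_combination (-20 * ζ 0 ^ 8 * ζ' 0) * k3
    linarith
  have := nonpos_of_mul_nonpos_right k4 h8
  linarith

namespace SpacelikeSurface

variable {S : SpacelikeSurface} {L : (Fin 4 → ℝ) →ₗ[ℝ] ℝ}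

/-- Extremal unit direction of the weighted second fundamental form. -/
theorem IsTame.exists_extremal (hT : S.IsTame L) (hent : S.IsEntire) (hmax : S.IsMaximal)
    {y₀ : Fin 2 → ℝ} {C : ℝ} (hC : 0 ≤ C) (hlam : C < S.lambdaAt y₀) :
    ∃ m y₁ e, C < m ∧ -qform (S.emb y₀) (S.emb y₁) < 2 ∧ S.ff1 y₁ e e = 1 ∧
      S.ff2 y₁ e e * (2 + qform (S.emb y₀) (S.emb y₁)) ^ 10 = m ∧
      ∀ y, -qform (S.emb y₀) (S.emb y) ≤ 2 → ∀ v,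
        S.ff2 y v v * (2 + qform (S.emb y₀) (S.emb y)) ^ 10 ≤ m * S.ff1 y v v := by
  have hK := hT.isCompact_param_sublevel hent hmax y₀ 2
  have hB := hK.prod (isCompact_sphere (0 : Fin 2 → ℝ) 1)
  set q : (Fin 2 → ℝ) × (Fin 2 → ℝ) → ℝ := fun x =>
    S.ff2 x.1 x.2 x.2 * (2 + qform (S.emb y₀) (S.emb x.1)) ^ 10 / S.ff1 x.1 x.2 x.2 with hq
  have hd : ∀ {F : (Fin 2 → ℝ) → Fin 4 → ℝ}, ContDiff ℝ (⊤ : ℕ∞) F →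
      Continuous fun x : (Fin 2 → ℝ) × (Fin 2 → ℝ) => fderiv ℝ F x.1 x.2 := fun hF =>
    ((hF.continuous_fderiv (by simp)).comp continuous_fst).clm_apply continuous_snd
  have hne : ∀ v ∈ Metric.sphere (0 : Fin 2 → ℝ) 1, v ≠ 0 := by
    rintro v hv rfl
    simp at hv
  have hqc : ContinuousOn q ({y | -qform (S.emb y₀) (S.emb y) ≤ 2} ×ˢ
      Metric.sphere (0 : Fin 2 → ℝ) 1) := by
    refine ContinuousOn.div (Continuous.continuousOn ?_) (Continuous.continuousOn ?_) ?_
    · exact (continuous_qform (hd S.smooth_normal) (hd S.smooth_emb)).mul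
        ((continuous_const.add (continuous_qform continuous_const
          (S.smooth_emb.continuous.comp continuous_fst))).pow 10)
    · exact continuous_qform (hd S.smooth_emb) (hd S.smooth_emb)
    · rintro ⟨y, v⟩ ⟨-, hv⟩
      exact (S.ff1_pos y (hne v hv)).ne'
  have hself : qform (S.emb y₀) (S.emb y₀) = -1 := S.on_quadric y₀
  have h1s : (![1, 0] : Fin 2 → ℝ) ≠ 0 := by
    intro h; simpa using congrFun h 0
  have hscale : ∀ v : Fin 2 → ℝ, v ≠ 0 → ‖v‖⁻¹ • v ∈ Metric.sphere (0 : Fin 2 → ℝ) 1 := by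
    intro v hv
    rw [mem_sphere_zero_iff_norm, norm_smul, norm_inv, norm_norm,
      inv_mul_cancel₀ (norm_ne_zero_iff.2 hv)]
  obtain ⟨⟨y₁, v₁⟩, ⟨hy1, hv1⟩, hm⟩ := hB.exists_isMaxOn
    ⟨(y₀, ‖(![1, 0] : Fin 2 → ℝ)‖⁻¹ • ![1, 0]), by
      change -qform (S.emb y₀) (S.emb y₀) ≤ 2
      rw [hself]; norm_num, hscale _ h1s⟩ hqc
  have hy1 : -qform (S.emb y₀) (S.emb y₁) ≤ 2 := hy1
  have hall : ∀ y, -qform (S.emb y₀) (S.emb y) ≤ 2 → ∀ v,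
      S.ff2 y v v * (2 + qform (S.emb y₀) (S.emb y)) ^ 10 ≤ q (y₁, v₁) * S.ff1 y v v := by
    intro y hy v
    by_cases hv : v = 0
    · simp [hv, ff1, ff2]
    have h1 : q (y, ‖v‖⁻¹ • v) ≤ q (y₁, v₁) := hm (Set.mk_mem_prod hy (hscale v hv))
    have h2 : q (y, ‖v‖⁻¹ • v) = S.ff2 y v v * (2 + qform (S.emb y₀) (S.emb y)) ^ 10 /
        S.ff1 y v v := by
      have : ‖v‖ ≠ 0 := norm_ne_zero_iff.2 hv
      have := (S.ff1_pos y hv).ne'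
      simp only [hq, ff1_smul_left, ff1_smul_right, ff2_smul_left, ff2_smul_right]
      field_simp
    rw [h2, div_le_iff₀ (S.ff1_pos y hv)] at h1
    exact h1
  have hCm : C < q (y₁, v₁) := by
    by_contra hle
    refine absurd (lambdaAt_le_of_ff2_le hmax y₀ hC fun v => ?_) (not_le.2 hlam)
    have := hall y₀ (by rw [hself]; norm_num) v
    rw [hself] at this
    have h2 := mul_le_mul_of_nonneg_right (not_lt.1 hle) (S.ff1_nonneg y₀ v)
    linarith
  have hI := S.ff1_pos y₁ (hne v₁ hv1)
  obtain ⟨c, hc, hunit⟩ := S.exists_unit y₁ (hne v₁ hv1)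
  refine ⟨q (y₁, v₁), y₁, c • v₁, hCm, lt_of_le_of_ne hy1 fun h => ?_, hunit, ?_, hall⟩
  · have hz : 2 + qform (S.emb y₀) (S.emb y₁) = 0 := by linarith
    have : q (y₁, v₁) = 0 := by simp [hq, hz]
    linarith
  · have e : c ^ 2 * S.ff1 y₁ v₁ v₁ = 1 := by
      rw [← hunit, ff1_smul_left, ff1_smul_right]; ring
    simp only [hq, ff2_smul_left, ff2_smul_right]
    rw [eq_div_iff hI.ne']
    linear_combination S.ff2 y₁ v₁ v₁ * (2 + qform (S.emb y₀) (S.emb y₁)) ^ 10 * e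

theorem IsTame.normal_component_le (hT : S.IsTame L) (hent : S.IsEntire) (hmax : S.IsMaximal)
    {y₀ y₁ : Fin 2 → ℝ} {m : ℝ} (hm : 0 < m) (hy1 : -qform (S.emb y₀) (S.emb y₁) < 2)
    (hall : ∀ y, -qform (S.emb y₀) (S.emb y) ≤ 2 → ∀ v,
        S.ff2 y v v * (2 + qform (S.emb y₀) (S.emb y)) ^ 10 ≤ m * S.ff1 y v v) :
    |qform (S.emb y₀) (S.normal y₁)| * (2 + qform (S.emb y₀) (S.emb y₁)) ^ 9 ≤ m / 8 := by
  have hpos : ∀ y, -qform (S.emb y₀) (S.emb y) ≤ -qform (S.emb y₀) (S.emb y₁) →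
      0 < 2 + qform (S.emb y₀) (S.emb y) := fun y hy => by linarith
  have key := hT.abs_qform_normal_le hent hmax y₀ (c := -qform (S.emb y₀) (S.emb y₁))
    (β := fun x => m / 8 * ((2 - x) ^ 9)⁻¹) (β' := fun x => m / 8 * (9 * ((2 - x) ^ 10)⁻¹))
    (μ := fun y => m * ((2 + qform (S.emb y₀) (S.emb y)) ^ 10)⁻¹) ?_ ?_ ?_ ?_ (y := y₁) le_rfl
  · rw [sub_neg_eq_add] at key
    have h9 : 0 < (2 + qform (S.emb y₀) (S.emb y₁)) ^ 9 := pow_pos (hpos y₁ le_rfl) 9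
    rwa [← div_eq_mul_inv, le_div_iff₀ h9] at key
  · intro y hy
    have hp := hpos y hy
    have hne : (2 - -qform (S.emb y₀) (S.emb y)) ≠ 0 := by
      rw [sub_neg_eq_add]; exact hp.ne'
    have h1 := ((((hasDerivAt_id (-qform (S.emb y₀) (S.emb y))).const_sub 2).pow 9).inv
      (pow_ne_zero 9 hne)).const_mul (m / 8)
    refine h1.congr_deriv ?_
    simp only [id, Pi.pow_apply, sub_neg_eq_add]
    field_simp
    norm_num
    ring
  · intro y hy
    have hp := hpos y hy
    rw [sub_neg_eq_add]
    positivity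
  · intro y hy w
    have hp := hpos y hy
    refine (abs_ff2_le hmax y w).trans (mul_le_mul_of_nonneg_right ?_ (S.ff1_nonneg y w))
    refine lambdaAt_le_of_ff2_le hmax y (by positivity) fun v => ?_
    have h10 : 0 < (2 + qform (S.emb y₀) (S.emb y)) ^ 10 := by positivity
    have := hall y (by linarith) v
    rw [← le_div_iff₀ h10] at this
    refine this.trans (le_of_eq ?_)
    ring
  · intro y hy
    have hp := hpos y hy
    rw [sub_neg_eq_add]
    have : 0 < m * ((2 + qform (S.emb y₀) (S.emb y)) ^ 10)⁻¹ := by positivity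
    linarith

end SpacelikeSurface

namespace SpacelikeSurface

variable {S : SpacelikeSurface} {L : (Fin 4 → ℝ) →ₗ[ℝ] ℝ}

theorem fderiv_normal_eq (y : Fin 2 → ℝ) {e₁ e₂ : Fin 2 → ℝ} (h1 : S.ff1 y e₁ e₁ = 1)
    (h2 : S.ff1 y e₂ e₂ = 1) (h12 : S.ff1 y e₁ e₂ = 0) (w : Fin 2 → ℝ) :
    fderiv ℝ S.normal y w =
      S.ff2 y w e₁ • fderiv ℝ S.emb y e₁ + S.ff2 y w e₂ • fderiv ℝ S.emb y e₂ := by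
  have := (S.isFrame y h1 h2 h12).expand (fderiv ℝ S.normal y w)
  have a1 : qform (fderiv ℝ S.normal y w) (S.emb y) = 0 := by
    rw [S.shape_spec]; exact S.emb_orth y _
  have a2 : qform (fderiv ℝ S.normal y w) (S.normal y) = 0 := by
    rw [S.shape_spec, qform_comm]; exact S.normal_orth y _
  rw [a1, a2, zero_smul, zero_smul, sub_zero, sub_zero] at this
  exact this

/-- A unit direction maximizing the second fundamental form is a principal direction. -/
theorem ff2_eq_zero_of_extremal {y : Fin 2 → ℝ} {e₁ e₂ : Fin 2 → ℝ} {l : ℝ}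
    (h1 : S.ff1 y e₁ e₁ = 1) (h2 : S.ff1 y e₂ e₂ = 1) (h12 : S.ff1 y e₁ e₂ = 0)
    (hl : S.ff2 y e₁ e₁ = l) (h : ∀ v, S.ff2 y v v ≤ l * S.ff1 y v v) : S.ff2 y e₁ e₂ = 0 := by
  have key : ∀ t : ℝ, 2 * t * S.ff2 y e₁ e₂ ≤ t ^ 2 * (l - S.ff2 y e₂ e₂) := by
    intro t
    have := h (e₁ + t • e₂)
    simp only [ff1_add_left, ff1_add_right, ff1_smul_left, ff1_smul_right, ff2_add_left,
      ff2_add_right, ff2_smul_left, ff2_smul_right, h1, h2, h12, S.ff1_comm y e₂ e₁,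
      S.ff2_comm y e₂ e₁, hl] at this
    linarith
  set a := S.ff2 y e₁ e₂
  set b := l - S.ff2 y e₂ e₂
  have hb : 0 ≤ b := by
    have k1 := key 1
    have k2 := key (-1)
    linarith
  have k := key (a / (b + 1))
  have hb1 : 0 < b + 1 := by linarith
  have e1 : 2 * (a / (b + 1)) * a = 2 * (b + 1) * (a / (b + 1)) ^ 2 := by field_simp
  have e2 : (b + 2) * (a / (b + 1)) ^ 2 ≤ 0 := by linarith
  have e3 : (a / (b + 1)) ^ 2 ≤ 0 := by nlinarith [sq_nonneg (a / (b + 1))]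
  have e4 : a / (b + 1) = 0 := by
    have := sq_nonneg (a / (b + 1))
    exact pow_eq_zero_iff (two_ne_zero) |>.1 (le_antisymm e3 this)
  rcases div_eq_zero_iff.1 e4 with h | h
  · exact h
  · linarith

set_option maxHeartbeats 1000000 in
theorem IsTame.lambdaAt_le (hT : S.IsTame L) (hent : S.IsEntire) (hmax : S.IsMaximal)
    (y₀ : Fin 2 → ℝ) : S.lambdaAt y₀ ≤ 37 := by
  by_contra hlam
  obtain ⟨m, y, e₁, hCm, hy, h1, hm, hall⟩ :=
    hT.exists_extremal hent hmax (by norm_num) (not_le.1 hlam)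
  have hv := hT.normal_component_le hent hmax (by linarith) hy hall
  obtain ⟨e₂, h2, h12⟩ := S.exists_orthonormal_of_unit y h1
  set p := S.emb y₀ with hp
  set l := S.ff2 y e₁ e₁ with hl
  set Z := 2 + qform p (S.emb y) with hZ
  have hZ0 : 0 < Z := by linarith
  have hZ1 : Z ≤ 1 := by linarith [hT.qform_emb_le hent hmax y₀ y]
  have hl0 : 0 < l := by
    by_contra hle
    have := mul_nonpos_of_nonpos_of_nonneg (not_lt.1 hle) (pow_pos hZ0 10).le
    linarith
  have hoff : S.ff2 y e₁ e₂ = 0 := by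
    refine ff2_eq_zero_of_extremal h1 h2 h12 hl.symm fun v => ?_
    have h3 := hall y hy.le v
    rw [← hm] at h3
    have h4 : 0 < Z ^ 10 := by positivity
    refine le_of_mul_le_mul_right ?_ h4
    linarith
  have h22 : S.ff2 y e₂ e₂ = -l := by linarith [ff2_add_eq_zero hmax h1 h2 h12]
  obtain ⟨χ, hχ⟩ := S.exists_isNormalChart y h1 h2 h12
  set s : (Fin 2 → ℝ) → Fin 4 → ℝ := fun z => S.emb (χ z) with hsdef
  set n : (Fin 2 → ℝ) → Fin 4 → ℝ := fun z => S.normal (χ z) with hndef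
  have hs : ContDiff ℝ (⊤ : ℕ∞) s := S.smooth_emb.comp hχ.smooth
  have hn : ContDiff ℝ (⊤ : ℕ∞) n := S.smooth_normal.comp hχ.smooth
  have ds : ∀ w z, dirD w s z = fderiv ℝ S.emb (χ z) (fderiv ℝ χ z w) := fun w z =>
    dirD_comp S.smooth_emb hχ.smooth w z
  have dn : ∀ w z, dirD w n z = fderiv ℝ S.normal (χ z) (fderiv ℝ χ z w) := fun w z =>
    dirD_comp S.smooth_normal hχ.smooth w z
  have s0 : s 0 = S.emb y := by rw [hsdef]; simp only [hχ.map_zero]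
  have n0 : n 0 = S.normal y := by rw [hndef]; simp only [hχ.map_zero]
  set u : Fin 2 → ℝ := ![1, 0] with hu
  set v : Fin 2 → ℝ := ![0, 1] with hvdef
  have su0 : dirD u s 0 = fderiv ℝ S.emb y e₁ := hχ.emb_zero.1
  have sv0 : dirD v s 0 = fderiv ℝ S.emb y e₂ := hχ.emb_zero.2
  have nu0 : dirD u n 0 = l • dirD u s 0 := by
    rw [dn, hχ.map_zero, hχ.d1, fderiv_normal_eq y h1 h2 h12, hoff, su0, ← hl]; simp
  have nv0 : dirD v n 0 = -l • dirD v s 0 := by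
    rw [dn, hχ.map_zero, hχ.d2, fderiv_normal_eq y h1 h2 h12, h22, sv0, S.ff2_comm y e₂ e₁, hoff]
    simp
  have huu : dirD u (dirD u s) 0 = s 0 + l • n 0 := by rw [s0, n0]; exact hχ.d11
  have huv : dirD u (dirD v s) 0 = 0 := by
    have := hχ.d12
    rw [hoff, zero_smul] at this
    exact this
  have hvv : dirD v (dirD v s) 0 = s 0 + -l • n 0 := by
    rw [s0, n0, ← h22]; exact hχ.d22
  have g11 : qform (dirD u s 0) (dirD u s 0) = 1 := by rw [su0]; exact h1
  have g22 : qform (dirD v s 0) (dirD v s 0) = 1 := by rw [sv0]; exact h2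
  have g12 : qform (dirD u s 0) (dirD v s 0) = 0 := by rw [su0, sv0]; exact h12
  have hos : ∀ w z, qform (dirD w s z) (s z) = 0 := fun w z => by rw [ds]; exact S.emb_orth _ _
  have hon : ∀ w z, qform (dirD w s z) (n z) = 0 := fun w z => by
    rw [ds, qform_comm]; exact S.normal_orth _ _
  have hns : ∀ w z, qform (dirD w n z) (s z) = 0 := fun w z => by
    rw [dn, S.shape_spec]; exact S.emb_orth _ _
  have hnn : ∀ w z, qform (dirD w n z) (n z) = 0 := fun w z => by
    rw [dn, S.shape_spec, qform_comm]; exact S.normal_orth _ _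
  have simons := simons_identity hs hn (hns u) (hns v) (hnn u) (hnn v)
    (fun z => by rw [dn, dn, ds, ds]; exact S.ff2_comm _ _ _)
    (fun z => by
      have := trace_identity hmax (χ z) (fderiv ℝ χ z u) (fderiv ℝ χ z v)
      simp only [dn, ds]
      change S.ff1 _ _ _ * S.ff2 _ _ _ + (-2) * (S.ff1 _ _ _ * S.ff2 _ _ _) +
        S.ff1 _ _ _ * S.ff2 _ _ _ = 0
      linarith) nu0 nv0 huu huv hvv g11 g22 g12 (hos u 0) (hos v 0) (hon u 0) (hon v 0)
  -- the weighted maximum principle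
  set h : (Fin 2 → ℝ) → ℝ := fun z => qform (dirD u n z) (dirD u s z) with hh
  set g : (Fin 2 → ℝ) → ℝ := fun z => qform (dirD u s z) (dirD u s z) with hg
  set ζ : (Fin 2 → ℝ) → ℝ := fun z => 2 + qform p (s z) with hζ
  have hsu := contDiff_dirD u hs
  have Sh : ContDiff ℝ (⊤ : ℕ∞) h := contDiff_qform (contDiff_dirD u hn) hsu
  have Sg : ContDiff ℝ (⊤ : ℕ∞) g := contDiff_qform hsu hsu
  have Sq : ContDiff ℝ (⊤ : ℕ∞) fun z => qform p (s z) := contDiff_qform contDiff_const hs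
  have Sζ : ContDiff ℝ (⊤ : ℕ∞) ζ := contDiff_const.add Sq
  have dζ : ∀ w, dirD w ζ = fun z => qform p (dirD w s z) := by
    intro w
    rw [← dirD_qform_const w p hs]
    funext z
    simp [dirD, hζ]
  have ddζ : ∀ w z, dirD w (dirD w ζ) z = qform p (dirD w (dirD w s) z) := by
    intro w z
    rw [dζ, dirD_qform_const w p (contDiff_dirD w hs)]
  have h0 : h 0 = l := by
    simp only [hh]
    rw [nu0, qform_smul_left, g11, mul_one]
  have ζ0 : ζ 0 = Z := by simp only [hζ]; rw [s0]
  have hnear : ∀ᶠ z in 𝓝 (0 : Fin 2 → ℝ), h z * ζ z ^ 10 - m * g z ≤ 0 := by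
    have : ∀ᶠ z in 𝓝 (0 : Fin 2 → ℝ), 0 < ζ z :=
      (Sζ.continuous.tendsto 0).eventually (lt_mem_nhds (by rw [ζ0]; exact hZ0))
    filter_upwards [this] with z hz
    have h3 := hall (χ z) (by simp only [hζ, hsdef] at hz; linarith) (fderiv ℝ χ z u)
    have h4 : h z = S.ff2 (χ z) (fderiv ℝ χ z u) (fderiv ℝ χ z u) := by
      simp only [hh]; rw [dn, ds]; rfl
    have h5 : g z = S.ff1 (χ z) (fderiv ℝ χ z u) (fderiv ℝ χ z u) := by
      simp only [hg]; rw [ds]; rfl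
    rw [h4, h5]
    linarith
  have htest : ∀ w : Fin 2 → ℝ, dirD w g 0 = 0 →
      Z ^ 2 * (dirD w (dirD w h) 0 - l * dirD w (dirD w g) 0) +
        10 * (l * (Z * qform p (dirD w (dirD w s) 0))) ≤ 110 * (l * qform p (dirD w s 0) ^ 2) := by
    intro w hw
    have := weighted_second_deriv (m := m) (hasDerivAt_line w Sh)
      (hasDerivAt_line w (contDiff_dirD w Sh) 0) (hasDerivAt_line w Sg)
      (hasDerivAt_line w (contDiff_dirD w Sg) 0) (hasDerivAt_line w Sζ)
      (hasDerivAt_line w (contDiff_dirD w Sζ) 0) (by rw [zero_smul]; exact hw)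
      (by rw [zero_smul, ζ0]; exact hZ0) (by rw [zero_smul, ζ0, h0]; exact hm) ?_
    · simp only [zero_smul, h0, ζ0, ddζ] at this
      rwa [dζ] at this
    · have hc : Tendsto (fun t : ℝ => t • w) (𝓝 0) (𝓝 (0 : Fin 2 → ℝ)) := by
        have : Continuous fun t : ℝ => t • w := by fun_prop
        simpa using this.tendsto 0
      filter_upwards [hc.eventually hnear] with t ht
      have g0 : g 0 = 1 := g11
      simp only [zero_smul, h0, ζ0, g0]
      linarith
  have hgu : dirD u g 0 = 0 := by
    simp only [hg]
    rw [dirD_qform u hsu hsu]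
    simp only [huu]
    rw [qform_comm (dirD u s 0)]
    simp only [qform_add_left, qform_smul_left]
    rw [qform_comm (s 0), qform_comm (n 0), hos, hon]
    ring
  have hgv : dirD v g 0 = 0 := by
    simp only [hg]
    rw [dirD_qform v hsu hsu, dirD_comm v u hs]
    simp only [huv]
    simp
  have t1 := htest u hgu
  have t2 := htest v hgv
  rw [huu, qform_add_right, qform_smul_right, s0] at t1
  rw [hvv, qform_add_right, qform_smul_right, s0] at t2
  -- the gradient of the height function
  have hexp := (S.isFrame y h1 h2 h12).qform_expand p p
  rw [← su0, ← sv0, show qform p p = -1 from S.on_quadric y₀] at hexp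
  set A := qform p (dirD u s 0)
  set B := qform p (dirD v s 0)
  set V := qform p (S.normal y) with hV
  set f := qform p (S.emb y) with hf
  have hsum : l * (Z ^ 2 * (2 * l ^ 2 - 2)) ≤ l * (110 * (A ^ 2 + B ^ 2) - 20 * Z * f) := by
    have : Z ^ 2 * (2 * l ^ 3 - 2 * l) = Z ^ 2 * (dirD u (dirD u h) 0 - l * dirD u (dirD u g) 0) +
        Z ^ 2 * (dirD v (dirD v h) 0 - l * dirD v (dirD v g) 0) := by
      rw [← simons]; ring
    rw [n0] at t1 t2
    linarith
  have hsum' := le_of_mul_le_mul_left hsum hl0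
  have hVl : |V| ≤ l * Z / 8 := by
    have h9 : 0 < Z ^ 9 := by positivity
    refine le_of_mul_le_mul_right ?_ h9
    calc |V| * Z ^ 9 ≤ m / 8 := hv
      _ = l * Z / 8 * Z ^ 9 := by rw [← hm]; ring
  have hV2 : V ^ 2 ≤ (l * Z / 8) ^ 2 := by
    rw [← sq_abs V]
    exact pow_le_pow_left₀ (abs_nonneg V) hVl 2
  have hbound : (l * Z) ^ 2 < 37 ^ 2 := by
    have e : A ^ 2 + B ^ 2 = f ^ 2 + V ^ 2 - 1 := by linarith
    rw [e] at hsum'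
    have f1 : f = Z - 2 := by rw [hZ]; ring
    rw [f1] at hsum'
    have hZZ : Z ^ 2 ≤ Z := by rw [pow_two]; exact mul_le_of_le_one_left hZ0.le hZ1
    clear_value A B V Z f
    clear hexp t1 t2 hsum simons
    nlinarith only [hsum', hV2, hZZ, hZ0]
  have hlt : l * Z < 37 := by
    have := abs_lt_of_sq_lt_sq hbound (by norm_num)
    exact (abs_lt.1 this).2
  have : m ≤ l * Z := by
    rw [← hm]
    refine mul_le_mul_of_nonneg_left ?_ hl0.le
    calc Z ^ 10 ≤ Z ^ 1 := pow_le_pow_of_le_one hZ0.le hZ1 (by norm_num)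
      _ = Z := pow_one Z
  linarith

theorem IsTame.lambdaAt_le_lambdaSup (hT : S.IsTame L) (hent : S.IsEntire) (hmax : S.IsMaximal)
    (y : Fin 2 → ℝ) : S.lambdaAt y ≤ S.lambdaSup := by
  refine le_ciSup (f := fun y => S.lambdaAt y) ⟨37, ?_⟩ y
  rintro _ ⟨z, rfl⟩
  exact hT.lambdaAt_le hent hmax z

end SpacelikeSurface

theorem exists_sinusoid_zero (A B : ℝ) :
    ∃ t₁, A * cos t₁ + B * sin t₁ = 0 ∧ ∀ t ∈ Icc t₁ (t₁ + π), 0 ≤ A * cos t + B * sin t := by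
  set z : ℂ := ⟨B, -A⟩ with hz
  have h1 : ‖z‖ * cos z.arg = B := Complex.norm_mul_cos_arg z
  have h2 : ‖z‖ * sin z.arg = -A := Complex.norm_mul_sin_arg z
  have h3 : ∀ t, A * cos t + B * sin t = ‖z‖ * sin (t - z.arg) := fun t => by
    rw [sin_sub]
    linear_combination (-sin t) * h1 + cos t * h2
  refine ⟨z.arg, by rw [h3]; simp, fun t ht => ?_⟩
  rw [h3]
  exact mul_nonneg (norm_nonneg z)
    (sin_nonneg_of_nonneg_of_le_pi (by linarith [ht.1]) (by linarith [ht.2]))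

theorem tan_le_of_sin_le_cos {l T t₀ : ℝ} (hl0 : 0 ≤ l) (hl1 : l < 1) (hT : 0 ≤ T)
    (h : ∀ t ∈ Icc 0 T, |sin (t - t₀)| ≤ l * |cos (t - t₀)|) :
    0 < cos T ∧ tan T ≤ 2 * l / (1 - l ^ 2) := by
  have hne : ∀ t ∈ Icc 0 T, cos (t - t₀) ≠ 0 := fun t ht h0 => by
    have h1 := h t ht
    rw [h0, abs_zero, mul_zero] at h1
    have h2 := sin_sq_add_cos_sq (t - t₀)
    rw [h0, abs_nonpos_iff.1 h1] at h2
    norm_num at h2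
  have hprod : 0 < cos (0 - t₀) * cos (T - t₀) := by
    by_contra hle
    have hc : ContinuousOn (fun t => cos (t - t₀)) (uIcc 0 T) := by fun_prop
    have h0 : (0 : ℝ) ∈ uIcc (cos (0 - t₀)) (cos (T - t₀)) := by
      rw [mem_uIcc]
      rcases mul_nonpos_iff.1 (not_lt.1 hle) with h | h
      · exact Or.inr ⟨h.2, h.1⟩
      · exact Or.inl h
    obtain ⟨t, ht, h1⟩ := intermediate_value_uIcc hc h0
    rw [uIcc_of_le hT] at ht
    exact hne t ht h1
  have k1 := h 0 ⟨le_rfl, hT⟩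
  have k2 := h T ⟨hT, le_rfl⟩
  have hcos : cos T = cos (T - t₀) * cos (0 - t₀) + sin (T - t₀) * sin (0 - t₀) := by
    rw [← cos_sub]; ring_nf
  have hsin : sin T = sin (T - t₀) * cos (0 - t₀) - cos (T - t₀) * sin (0 - t₀) := by
    rw [← sin_sub]; ring_nf
  set c₁ := cos (0 - t₀)
  set s₁ := sin (0 - t₀)
  set c₂ := cos (T - t₀)
  set s₂ := sin (T - t₀)
  have hcc : |c₁| * |c₂| = c₁ * c₂ := by rw [← abs_mul, abs_of_pos hprod]
  have hss : |s₂ * s₁| ≤ l ^ 2 * (c₁ * c₂) := by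
    rw [abs_mul, ← hcc]
    calc |s₂| * |s₁| ≤ (l * |c₂|) * (l * |c₁|) :=
          mul_le_mul k2 k1 (abs_nonneg _) (by positivity)
      _ = _ := by ring
  have h21 : |s₂ * c₁| ≤ l * (c₁ * c₂) := by
    rw [abs_mul, ← hcc]
    calc |s₂| * |c₁| ≤ (l * |c₂|) * |c₁| := mul_le_mul_of_nonneg_right k2 (abs_nonneg _)
      _ = _ := by ring
  have h12 : |c₂ * s₁| ≤ l * (c₁ * c₂) := by
    rw [abs_mul, ← hcc]
    calc |c₂| * |s₁| ≤ |c₂| * (l * |c₁|) := mul_le_mul_of_nonneg_left k1 (abs_nonneg _)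
      _ = _ := by ring
  have hl2 : 0 < 1 - l ^ 2 := by nlinarith
  have hge : c₁ * c₂ * (1 - l ^ 2) ≤ cos T := by
    rw [hcos]; linarith [(abs_le.1 hss).1]
  have hpos : 0 < cos T := lt_of_lt_of_le (by positivity) hge
  refine ⟨hpos, ?_⟩
  rw [tan_eq_sin_div_cos, div_le_div_iff₀ hpos hl2]
  have hs : sin T ≤ 2 * l * (c₁ * c₂) := by
    rw [hsin]; linarith [(abs_le.1 h21).2, (abs_le.1 h12).1]
  calc sin T * (1 - l ^ 2) ≤ 2 * l * (c₁ * c₂) * (1 - l ^ 2) :=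
        mul_le_mul_of_nonneg_right hs hl2.le
    _ = 2 * l * (c₁ * c₂ * (1 - l ^ 2)) := by ring
    _ ≤ 2 * l * cos T := mul_le_mul_of_nonneg_left hge (by linarith)

namespace SpacelikeSurface

variable {S : SpacelikeSurface} {L : (Fin 4 → ℝ) →ₗ[ℝ] ℝ}

/-- Every complete timelike geodesic meets the surface. -/
theorem IsTame.exists_geodesic_mem (hT : S.IsTame L) (hent : S.IsEntire) (hmax : S.IsMaximal)
    {a b : Fin 4 → ℝ} (ha : qform a a = -1) (hb : qform b b = -1) (hab : qform a b = 0) :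
    ∃ t y, cos t • a + sin t • b = S.emb y := by
  obtain ⟨Q, hQ⟩ := hT.exists_homeomorph hent hmax
  set γ : ℝ → Fin 4 → ℝ := fun t => cos t • a + sin t • b with hγ
  have hγc : Continuous γ := by fun_prop
  set G : ℝ → Fin 4 → ℝ := fun t => S.emb (Q.symm (projXY (γ t))) with hG
  have hGc : Continuous G :=
    S.smooth_emb.continuous.comp (Q.symm.continuous.comp (projXY.continuous.comp hγc))
  have hGp : ∀ t, projXY (G t) = projXY (γ t) := fun t => by
    rw [hG]; simp only [← hQ, Homeomorph.apply_symm_apply]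
  have hG0 : ∀ t, G t 0 = γ t 0 := fun t => congrFun (hGp t) 0
  have hG1 : ∀ t, G t 1 = γ t 1 := fun t => congrFun (hGp t) 1
  set D := S.emb (Q.symm 0) with hD
  have hDp : projXY D = 0 := by rw [hD, ← hQ, Homeomorph.apply_symm_apply]
  have hD0 : D 0 = 0 := congrFun hDp 0
  have hD1 : D 1 = 0 := congrFun hDp 1
  have hGD : ∀ t, 0 < G t 2 * D 2 + G t 3 * D 3 := fun t => by
    have := hT.qform_emb_le hent hmax (Q.symm (projXY (γ t))) (Q.symm 0)
    change qform (G t) D ≤ -1 at this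
    unfold qform at this
    rw [hD0, hD1] at this
    linarith
  have hGq : ∀ t, qform (G t) (G t) = -1 := fun t => S.on_quadric _
  have hγq : ∀ t, qform (γ t) (γ t) = -1 := fun t => by
    have := sin_sq_add_cos_sq t
    simp only [hγ, qform_add_left, qform_add_right, qform_smul_left, qform_smul_right, ha, hb,
      hab, qform_comm b a]
    linarith
  have hDq : D 2 ^ 2 + D 3 ^ 2 = 1 := by
    have : qform D D = -1 := S.on_quadric _
    unfold qform at this
    rw [hD0, hD1] at this
    linarith
  obtain ⟨t₁, hz, hnn⟩ := exists_sinusoid_zero (a 2 * D 2 + a 3 * D 3) (b 2 * D 2 + b 3 * D 3)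
  have hγD : ∀ t, γ t 2 * D 2 + γ t 3 * D 3 =
      (a 2 * D 2 + a 3 * D 3) * cos t + (b 2 * D 2 + b 3 * D 3) * sin t := fun t => by
    simp only [hγ, Pi.add_apply, Pi.smul_apply, smul_eq_mul]; ring
  have hγπ : ∀ i, γ (t₁ + π) i = -γ t₁ i := fun i => by
    simp only [hγ, Pi.add_apply, Pi.smul_apply, smul_eq_mul, cos_add_pi, sin_add_pi]; ring
  set c : ℝ → ℝ := fun t => γ t 2 * G t 3 - γ t 3 * G t 2 with hc
  have hcc : Continuous c := by
    have h1 := fun i => (continuous_apply i).comp hγc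
    have h2 := fun i => (continuous_apply i).comp hGc
    exact ((h1 2).mul (h2 3)).sub ((h1 3).mul (h2 2))
  have hzt := (hγD t₁).trans hz
  have e1 : c t₁ = (γ t₁ 2 * D 3 - γ t₁ 3 * D 2) * (G t₁ 2 * D 2 + G t₁ 3 * D 3) := by
    simp only [hc]
    linear_combination -(γ t₁ 2 * G t₁ 3 - γ t₁ 3 * G t₁ 2) * hDq +
      (D 2 * G t₁ 3 - D 3 * G t₁ 2) * hzt
  have e2 : c (t₁ + π) = -(γ t₁ 2 * D 3 - γ t₁ 3 * D 2) *
      (G (t₁ + π) 2 * D 2 + G (t₁ + π) 3 * D 3) := by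
    simp only [hc, hγπ]
    linear_combination (γ t₁ 2 * G (t₁ + π) 3 - γ t₁ 3 * G (t₁ + π) 2) * hDq -
      (D 2 * G (t₁ + π) 3 - D 3 * G (t₁ + π) 2) * hzt
  have h0 : (0 : ℝ) ∈ uIcc (c t₁) (c (t₁ + π)) := by
    rw [mem_uIcc, e1, e2]
    have p1 := (hGD t₁).le
    have p2 := (hGD (t₁ + π)).le
    rcases le_total 0 (γ t₁ 2 * D 3 - γ t₁ 3 * D 2) with h | h
    · exact Or.inr ⟨mul_nonpos_of_nonpos_of_nonneg (by linarith) p2, mul_nonneg h p1⟩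
    · exact Or.inl ⟨mul_nonpos_of_nonpos_of_nonneg h p1, mul_nonneg (by linarith) p2⟩
  obtain ⟨t, ht, hct⟩ := intermediate_value_uIcc hcc.continuousOn h0
  rw [uIcc_of_le (by linarith [pi_pos])] at ht
  refine ⟨t, Q.symm (projXY (γ t)), ?_⟩
  change γ t = G t
  have hd : 0 ≤ γ t 2 * D 2 + γ t 3 * D 3 := by rw [hγD]; exact hnn t ht
  have q1 := hGq t
  have q2 := hγq t
  unfold qform at q1 q2
  rw [hG0, hG1] at q1
  have hct : γ t 2 * G t 3 - γ t 3 * G t 2 = 0 := hct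
  have hGDt := hGD t
  generalize γ t 0 = x0 at q1 q2
  generalize γ t 1 = x1 at q1 q2
  have hpar : γ t 2 = G t 2 ∧ γ t 3 = G t 3 := by
    generalize γ t 2 = x at *
    generalize γ t 3 = y at *
    generalize G t 2 = u at *
    generalize G t 3 = v at *
    have hn : u ^ 2 + v ^ 2 = x ^ 2 + y ^ 2 := by linarith
    have hpos : 0 < u ^ 2 + v ^ 2 := by nlinarith [sq_nonneg x0, sq_nonneg x1]
    set k := (x * u + y * v) / (u ^ 2 + v ^ 2) with hk
    have hx : x = k * u := by
      rw [hk]; field_simp; linear_combination v * hct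
    have hy : y = k * v := by
      rw [hk]; field_simp; linear_combination (-u) * hct
    have hk2 : (k - 1) * (k + 1) = 0 := by
      apply mul_right_cancel₀ hpos.ne'
      rw [hx, hy] at hn
      linear_combination -hn
    have hk0 : 0 ≤ k := by
      by_contra hneg
      rw [hx, hy] at hd
      nlinarith [mul_pos (neg_pos.2 (not_le.1 hneg)) hGDt]
    have hk1 : k = 1 := by
      rcases mul_eq_zero.1 hk2 with h | h <;> linarith
    rw [hx, hy, hk1]; simp
  ext i
  fin_cases i
  · exact (hG0 t).symm
  · exact (hG1 t).symm
  · exact hpar.1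
  · exact hpar.2

theorem IsTame.abs_qform_normal_le_of_mem_hull (hT : S.IsTame L) (hent : S.IsEntire)
    (hmax : S.IsMaximal) (hw : width S.bdryAtInfinity < π / 2) {l : ℝ} (hl0 : 0 ≤ l)
    (hl : ∀ y, S.lambdaAt y ≤ l) {x : Fin 4 → ℝ} (hx0 : x ≠ 0)
    (hx : projPt x hx0 ∈ projConvexHull S.bdryAtInfinity) (y : Fin 2 → ℝ) :
    |qform (S.normal y) x| ≤ l * |qform (S.emb y) x| := by
  obtain ⟨M, hM, z, hz0, hzx, hz⟩ := hx
  obtain ⟨c, hc, rfl⟩ := (projPt_eq_iff hx0 hz0).1 hzx.symm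
  have hset : posNull (closure S.cone) M = {x | x ∈ lifts S.bdryAtInfinity ∧ 0 < M x} := by
    ext x
    simp only [posNull, mem_ofPred_eq, mem_lifts_iff_null hent]
    tauto
  have hM' : ∀ x ∈ closure S.cone, x ≠ 0 → qform x x = 0 → M x ≠ 0 := fun x h1 h2 h3 =>
    hM x ((mem_lifts_iff_null hent x).2 ⟨h2, h1, h3⟩)
  have hprop := posNull_closure_cone_properties hent hM' (isAcausalCone_toCone hent hw hM)
    (fun x hx => ConvexCone.subset_hull (subset_convexHull ℝ _ hx)) y
  rw [← hset] at hz
  obtain ⟨⟨τ, hτ⟩, -, -, x₀, hx₀⟩ := hprop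
  have hτ0 : τ ≠ 0 := by
    rintro rfl
    have := hτ x₀ hx₀
    simp at this
  have hcl : ∀ x ∈ closure S.cone, |qform (S.normal y) x| ≤ l * |qform (S.emb y) x| := by
    have hclosed : IsClosed {x | |qform (S.normal y) x| ≤ l * |qform (S.emb y) x|} :=
      isClosed_le (continuous_qform continuous_const continuous_id).abs
        (continuous_const.mul (continuous_qform continuous_const continuous_id).abs)
    refine fun x hx => closure_minimal ?_ hclosed hx
    rintro _ ⟨d, y', -, rfl⟩
    have := hT.abs_qform_normal_le_of_lambda hent hmax hl0 hl y' y
    rw [qform_comm, qform_comm (S.emb y')] at this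
    have h2 : |qform (S.normal y) (S.emb y')| ≤ l * |qform (S.emb y) (S.emb y')| :=
      this.trans (mul_le_mul_of_nonneg_left (neg_le_abs _) hl0)
    simp only [mem_ofPred_eq, qform_smul_right, abs_mul]
    calc |d| * |qform (S.normal y) (S.emb y')| ≤ |d| * (l * |qform (S.emb y) (S.emb y')|) :=
          mul_le_mul_of_nonneg_left h2 (abs_nonneg d)
      _ = _ := by ring
  have hconv : Convex ℝ ({x | 0 ≤ (l * τ) * qform (S.emb y) x - τ * qform (S.normal y) x} ∩
      {x | 0 ≤ (l * τ) * qform (S.emb y) x + τ * qform (S.normal y) x}) :=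
    (convex_halfSpace_ge ((l * τ) • qlin (S.emb y) - τ • qlin (S.normal y)).isLinear 0).inter
      (convex_halfSpace_ge ((l * τ) • qlin (S.emb y) + τ • qlin (S.normal y)).isLinear 0)
  have hmem := convexHull_min (fun x hx => by
    have h1 := hcl x hx.1
    have h2 := hτ x hx
    rw [qform_comm] at h2
    have h3 := mul_le_mul_of_nonneg_left h1 (abs_nonneg τ)
    have h4 : |τ| * (l * |qform (S.emb y) x|) = l * (τ * qform (S.emb y) x) := by
      rw [← abs_of_pos h2, abs_mul]; ring
    rw [h4, ← abs_mul, abs_le] at h3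
    exact ⟨by rw [mem_ofPred_eq]; linarith, by rw [mem_ofPred_eq]; linarith⟩) hconv hz
  obtain ⟨m1, m2⟩ : 0 ≤ (l * τ) * qform (S.emb y) z - τ * qform (S.normal y) z ∧
    0 ≤ (l * τ) * qform (S.emb y) z + τ * qform (S.normal y) z := hmem
  have h5 : |τ * qform (S.normal y) z| ≤ l * (τ * qform (S.emb y) z) :=
    abs_le.2 ⟨by linarith, by linarith⟩
  have h6 : |τ| * |qform (S.normal y) z| ≤ |τ| * (l * |qform (S.emb y) z|) := by
    rw [← abs_mul]
    refine h5.trans ?_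
    calc l * (τ * qform (S.emb y) z) ≤ l * |τ * qform (S.emb y) z| :=
          mul_le_mul_of_nonneg_left (le_abs_self _) hl0
      _ = _ := by rw [abs_mul]; ring
  have h7 := le_of_mul_le_mul_left h6 (abs_pos.2 hτ0)
  simp only [qform_smul_right, abs_mul]
  calc |c| * |qform (S.normal y) z| ≤ |c| * (l * |qform (S.emb y) z|) :=
        mul_le_mul_of_nonneg_left h7 (abs_nonneg c)
    _ = _ := by ring

theorem lambdaSup_nonneg (S : SpacelikeSurface) : 0 ≤ S.lambdaSup :=
  Real.iSup_nonneg fun _ => Real.sqrt_nonneg _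

theorem tan_le_of_segment (hent : S.IsEntire) (hmax : S.IsMaximal) (hlam : S.lambdaSup < 1)
    (hw : width S.bdryAtInfinity < π / 2) {T : ℝ} (hT0 : 0 ≤ T) {a b : Fin 4 → ℝ}
    (ha : qform a a = -1) (hb : qform b b = -1) (hab : qform a b = 0)
    (hseg : ∀ t ∈ Icc (0 : ℝ) T, ∃ h : (Real.cos t • a + Real.sin t • b) ≠ 0,
        projPt (Real.cos t • a + Real.sin t • b) h ∈ projConvexHull S.bdryAtInfinity) :
    0 < cos T ∧ tan T ≤ 2 * S.lambdaSup / (1 - S.lambdaSup ^ 2) := by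
  obtain ⟨-, L₀, hL₀, -⟩ := hseg 0 ⟨le_rfl, hT0⟩
  obtain ⟨L, hT⟩ := exists_isTame hent hw hL₀
  have hl0 := S.lambdaSup_nonneg
  obtain ⟨t₀, y, hy⟩ := hT.exists_geodesic_mem hent hmax ha hb hab
  refine tan_le_of_sin_le_cos (t₀ := t₀) hl0 hlam hT0 fun t ht => ?_
  obtain ⟨h0, hmem⟩ := hseg t ht
  have key := hT.abs_qform_normal_le_of_mem_hull hent hmax hw hl0
    (hT.lambdaAt_le_lambdaSup hent hmax) h0 hmem y
  set b' := -sin t₀ • a + cos t₀ • b with hb'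
  have hsc := sin_sq_add_cos_sq t₀
  have hdec : cos t • a + sin t • b = cos (t - t₀) • S.emb y + sin (t - t₀) • b' := by
    rw [← hy, hb']
    ext i
    simp only [Pi.add_apply, Pi.smul_apply, smul_eq_mul, cos_sub, sin_sub]
    linear_combination (-(cos t * a i) - sin t * b i) * hsc
  have hbb : qform b' b' = -1 := by
    simp only [hb', qform_add_left, qform_add_right, qform_smul_left, qform_smul_right, ha, hb,
      hab, qform_comm b a]
    linarith
  have hbs : qform b' (S.emb y) = 0 := by
    rw [← hy]
    simp only [hb', qform_add_left, qform_add_right, qform_smul_left, qform_smul_right, ha, hb,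
      hab, qform_comm b a]
    ring
  have hbN : 1 ≤ |qform (S.normal y) b'| := by
    obtain ⟨v, w, hv, hw, hvw⟩ := S.exists_orthonormal y
    have := (S.isFrame y hv hw hvw).qform_expand b' b'
    rw [hbb, hbs] at this
    rw [qform_comm, ← one_le_sq_iff_one_le_abs]
    nlinarith [sq_nonneg (qform b' (fderiv ℝ S.emb y v)), sq_nonneg (qform b' (fderiv ℝ S.emb y w))]
  rw [hdec] at key
  simp only [qform_add_right, qform_smul_right, S.normal_orth_base, S.on_quadric,
    qform_comm (S.emb y) b', hbs, mul_zero, zero_add, add_zero, mul_neg, mul_one, abs_neg] at key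
  rw [abs_mul] at key
  exact (le_mul_of_one_le_right (abs_nonneg _) hbN).trans key

end SpacelikeSurface

/-- **Proposition C.** Let `S` be an entire maximal surface in AdS³ with principal
curvatures satisfying `‖λ‖∞ < 1` (so that the bound is finite), and let `w` be the width
of the convex hull of its asymptotic boundary.  Then `tan w ≤ 2‖λ‖∞/(1 − ‖λ‖∞²)`. -/
theorem tan_width_le_of_principal_curvatures (S : SpacelikeSurface)
    (hmax : S.IsMaximal) (hent : S.IsEntire) (hlam : S.lambdaSup < 1) :
    Real.tan (width S.bdryAtInfinity) ≤ 2 * S.lambdaSup / (1 - S.lambdaSup ^ 2) := by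
  have hl0 := S.lambdaSup_nonneg
  have hden : 0 < 1 - S.lambdaSup ^ 2 := by nlinarith
  have hbound : 0 ≤ 2 * S.lambdaSup / (1 - S.lambdaSup ^ 2) := by positivity
  by_contra hcon
  have htan : 0 < tan (width S.bdryAtInfinity) := lt_of_le_of_lt hbound (not_le.1 hcon)
  have hwpi : width S.bdryAtInfinity ≤ π := Real.sSup_le (fun T hT => hT.2.1.le) pi_pos.le
  have hw0 : 0 ≤ width S.bdryAtInfinity := Real.sSup_nonneg fun T hT => hT.1
  have hw : width S.bdryAtInfinity < π / 2 := by
    by_contra hle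
    refine absurd htan (not_lt.2 ?_)
    rw [tan_eq_sin_div_cos]
    exact div_nonpos_of_nonneg_of_nonpos (sin_nonneg_of_nonneg_of_le_pi hw0 hwpi)
      (cos_nonpos_of_pi_div_two_le_of_le (not_lt.1 hle) (by linarith [pi_pos]))
  have hle : width S.bdryAtInfinity ≤ arctan (2 * S.lambdaSup / (1 - S.lambdaSup ^ 2)) := by
    refine Real.sSup_le ?_ (arctan_nonneg.2 hbound)
    rintro T ⟨hT0, hTpi, a, b, ha, hb, hab, hseg⟩
    obtain ⟨hc, ht⟩ := SpacelikeSurface.tan_le_of_segment hent hmax hlam hw hT0 ha hb hab hseg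
    have hT2 : T < π / 2 := by
      by_contra hge
      exact absurd hc (not_lt.2 (cos_nonpos_of_pi_div_two_le_of_le (not_lt.1 hge)
        (by linarith [pi_pos])))
    rw [← arctan_tan (by linarith [pi_pos]) hT2]
    exact arctan_mono ht
  refine hcon ?_
  have h1 : arctan (tan (width S.bdryAtInfinity)) ≤
      arctan (2 * S.lambdaSup / (1 - S.lambdaSup ^ 2)) := by
    rwa [arctan_tan (by linarith [pi_pos]) hw]
  exact arctan_strictMono.le_iff_le.1 h1

end AdSPaper
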